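/- Let P and Q be convex polytopes in ℝ³ that are convex bodies (i.e. each is the convex hull of a finite set and has nonempty interior), and suppose they have equal covariograms, g_P = g_Q. Then Q is a translate of P or a translate of −P. -/

import Mathlib

open MeasureTheory Pointwise
set_option linter.all false
namespace Cov

section GroupRing
variable {V : Type*} [AddCommGroup V] [Module ℝ V] {K : Type*} [CommRing K]

instance instTUS : TwoUniqueSums V := by
  letI : Module ℚ V := Module.compHom V (algebraMap ℚ ℝ)
  infer_instance

def supp (f : AddMonoidAlgebra K V) : Finset V := f.coeff.support

lemma mem_supp {f : AddMonoidAlgebra K V} {v : V} : v ∈ supp f ↔ f.coeff v ≠ 0 := by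
  simp [supp]

lemma supp_nonempty {f : AddMonoidAlgebra K V} (hf : f ≠ 0) : (supp f).Nonempty := by
  rw [supp, Finsupp.support_nonempty_iff]
  simpa using hf

lemma supp_mul {f g : AddMonoidAlgebra K V} {y : V} (hy : y ∈ supp (f * g)) :
    ∃ a ∈ supp f, ∃ b ∈ supp g, y = a + b := by
  classical
  rw [mem_supp, AddMonoidAlgebra.coeff_mul, Finsupp.sum] at hy
  obtain ⟨a, ha, h⟩ := Finset.exists_ne_zero_of_sum_ne_zero hy
  rw [Finsupp.sum] at h
  obtain ⟨b, hb, h⟩ := Finset.exists_ne_zero_of_sum_ne_zero h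
  refine ⟨a, ha, b, hb, ?_⟩
  by_contra hne
  exact h (if_neg (fun e => hne e.symm))

noncomputable def face (φ : V →ₗ[ℝ] ℝ) (s : Finset V) : Finset V :=
  open Classical in s.filter (fun v => ∀ u ∈ s, φ u ≤ φ v)

lemma mem_face {φ : V →ₗ[ℝ] ℝ} {s : Finset V} {v : V} :
    v ∈ face φ s ↔ v ∈ s ∧ ∀ u ∈ s, φ u ≤ φ v := by
  classical
  simp [face]

lemma face_subset {φ : V →ₗ[ℝ] ℝ} {s : Finset V} : face φ s ⊆ s := fun _ h => (mem_face.1 h).1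

lemma face_nonempty {φ : V →ₗ[ℝ] ℝ} {s : Finset V} (h : s.Nonempty) : (face φ s).Nonempty := by
  obtain ⟨v, hv, hm⟩ := Finset.exists_max_image s φ h
  exact ⟨v, mem_face.2 ⟨hv, hm⟩⟩

lemma face_eq {φ : V →ₗ[ℝ] ℝ} {s : Finset V} {u v : V} (hu : u ∈ face φ s) (hv : v ∈ face φ s) :
    φ u = φ v :=
  le_antisymm ((mem_face.1 hv).2 u (mem_face.1 hu).1) ((mem_face.1 hu).2 v (mem_face.1 hv).1)

noncomputable def inn (φ : V →ₗ[ℝ] ℝ) (f : AddMonoidAlgebra K V) : AddMonoidAlgebra K V :=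
  open Classical in AddMonoidAlgebra.ofCoeff (f.coeff.filter (fun v => v ∈ face φ (supp f)))

lemma inn_coeff_of_mem {φ : V →ₗ[ℝ] ℝ} {f : AddMonoidAlgebra K V} {v : V}
    (h : v ∈ face φ (supp f)) : (inn φ f).coeff v = f.coeff v := by
  classical
  simp [inn, h]

lemma inn_coeff_of_not_mem {φ : V →ₗ[ℝ] ℝ} {f : AddMonoidAlgebra K V} {v : V}
    (h : v ∉ face φ (supp f)) : (inn φ f).coeff v = 0 := by
  classical
  simp [inn, h]

lemma supp_inn (φ : V →ₗ[ℝ] ℝ) (f : AddMonoidAlgebra K V) : supp (inn φ f) = face φ (supp f) := by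
  ext v
  by_cases h : v ∈ face φ (supp f)
  · rw [mem_supp, inn_coeff_of_mem h]
    simp only [h, iff_true]
    exact mem_supp.1 (face_subset h)
  · rw [mem_supp, inn_coeff_of_not_mem h]
    simp [h]

lemma inn_ne_zero {φ : V →ₗ[ℝ] ℝ} {f : AddMonoidAlgebra K V} (h : f ≠ 0) : inn φ f ≠ 0 := by
  intro h0
  have := face_nonempty (φ := φ) (supp_nonempty h)
  rw [← supp_inn, h0] at this
  simp [supp] at this

lemma mul_coeff_eq (f g : AddMonoidAlgebra K V) (y : V) (s t : Finset V) (hs : supp f ⊆ s)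
    (ht : supp g ⊆ t) : open Classical in (f * g).coeff y =
      ∑ a ∈ s, ∑ b ∈ t, if a + b = y then f.coeff a * g.coeff b else 0 := by
  classical
  rw [AddMonoidAlgebra.coeff_mul, Finsupp.sum_of_support_subset _ hs]
  · apply Finset.sum_congr rfl
    intro a _
    rw [Finsupp.sum_of_support_subset _ ht]
    simp
  · simp

variable [IsDomain K]

lemma inn_mul (φ : V →ₗ[ℝ] ℝ) {f g : AddMonoidAlgebra K V} (hf : f ≠ 0) (hg : g ≠ 0) :
    inn φ (f * g) = inn φ f * inn φ g := by
  classical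
  obtain ⟨a0, ha0⟩ := face_nonempty (φ := φ) (supp_nonempty hf)
  obtain ⟨b0, hb0⟩ := face_nonempty (φ := φ) (supp_nonempty hg)
  have hA := (mem_face.1 ha0).2
  have hB := (mem_face.1 hb0).2
  have key : ∀ y, φ y = φ a0 + φ b0 → (inn φ f * inn φ g).coeff y = (f * g).coeff y := by
    intro y hy
    rw [mul_coeff_eq f g y _ _ subset_rfl subset_rfl,
      mul_coeff_eq (inn φ f) (inn φ g) y (supp f) (supp g)
        (by rw [supp_inn]; exact face_subset) (by rw [supp_inn]; exact face_subset)]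
    apply Finset.sum_congr rfl
    intro a ha
    apply Finset.sum_congr rfl
    intro b hb
    split_ifs with h
    · have h1 := hA a ha
      have h2 := hB b hb
      rw [← h, map_add] at hy
      have h3 : φ a = φ a0 := by linarith
      have h4 : φ b = φ b0 := by linarith
      rw [inn_coeff_of_mem (mem_face.2 ⟨ha, fun u hu => h3 ▸ hA u hu⟩),
        inn_coeff_of_mem (mem_face.2 ⟨hb, fun u hu => h4 ▸ hB u hu⟩)]
    · rfl
  have hne : inn φ f * inn φ g ≠ 0 := mul_ne_zero (inn_ne_zero hf) (inn_ne_zero hg)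
  obtain ⟨y0, hy0⟩ := supp_nonempty hne
  have hlev : ∀ y ∈ supp (inn φ f * inn φ g), φ y = φ a0 + φ b0 := by
    intro y hy
    obtain ⟨a, ha, b, hb, rfl⟩ := supp_mul hy
    rw [supp_inn] at ha hb
    rw [map_add, face_eq ha ha0, face_eq hb hb0]
  have hy0' : y0 ∈ supp (f * g) := by
    rw [mem_supp, ← key y0 (hlev y0 hy0)]
    exact mem_supp.1 hy0
  have hle : ∀ y ∈ supp (f * g), φ y ≤ φ a0 + φ b0 := by
    intro y hy
    obtain ⟨a, ha, b, hb, rfl⟩ := supp_mul hy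
    rw [map_add]
    exact add_le_add (hA a ha) (hB b hb)
  have hfc : ∀ y, y ∈ face φ (supp (f * g)) ↔ y ∈ supp (f * g) ∧ φ y = φ a0 + φ b0 := by
    intro y
    rw [mem_face]
    constructor
    · rintro ⟨h1, h2⟩
      exact ⟨h1, le_antisymm (hle y h1) (by rw [← hlev y0 hy0]; exact h2 y0 hy0')⟩
    · rintro ⟨h1, h2⟩
      exact ⟨h1, fun u hu => h2 ▸ hle u hu⟩
  apply AddMonoidAlgebra.coeff_injective
  ext y
  by_cases hy : φ y = φ a0 + φ b0
  · rw [key y hy]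
    by_cases hm : y ∈ supp (f * g)
    · rw [inn_coeff_of_mem ((hfc y).2 ⟨hm, hy⟩)]
    · rw [inn_coeff_of_not_mem (fun h => hm (face_subset h))]
      by_contra h
      exact hm (mem_supp.2 (Ne.symm h))
  · rw [inn_coeff_of_not_mem (fun h => hy ((hfc y).1 h).2)]
    by_contra h
    exact hy (hlev y (mem_supp.2 (Ne.symm h)))

lemma face_mul (φ : V →ₗ[ℝ] ℝ) {f g : AddMonoidAlgebra K V} (hf : f ≠ 0) (hg : g ≠ 0)
    {a b y : V} (ha : a ∈ face φ (supp f)) (hb : b ∈ face φ (supp g))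
    (hy : y ∈ face φ (supp (f * g))) : φ y = φ a + φ b := by
  rw [← supp_inn, inn_mul φ hf hg] at hy
  obtain ⟨a', ha', b', hb', rfl⟩ := supp_mul hy
  rw [supp_inn] at ha' hb'
  rw [map_add, face_eq ha' ha, face_eq hb' hb]

noncomputable def face3 (n w x : V →ₗ[ℝ] ℝ) (s : Finset V) : Finset V := face x (face w (face n s))

lemma face3_nonempty {n w x : V →ₗ[ℝ] ℝ} {s : Finset V} (h : s.Nonempty) :
    (face3 n w x s).Nonempty := face_nonempty (face_nonempty (face_nonempty h))

def Frame (n w x : V →ₗ[ℝ] ℝ) : Prop := ∀ v, n v = 0 → w v = 0 → x v = 0 → v = 0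

lemma face3_unique {n w x : V →ₗ[ℝ] ℝ} (F : Frame n w x) {s : Finset V} {u v : V}
    (hu : u ∈ face3 n w x s) (hv : v ∈ face3 n w x s) : u = v := by
  rw [← sub_eq_zero]
  apply F
  · rw [map_sub, face_eq (face_subset (face_subset hu)) (face_subset (face_subset hv)), sub_self]
  · rw [map_sub, face_eq (face_subset hu) (face_subset hv), sub_self]
  · rw [map_sub, face_eq hu hv, sub_self]

lemma face3_mul {n w x : V →ₗ[ℝ] ℝ} (F : Frame n w x) {f g : AddMonoidAlgebra K V}
    (hf : f ≠ 0) (hg : g ≠ 0) {a b : V} (ha : a ∈ face3 n w x (supp f))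
    (hb : b ∈ face3 n w x (supp g)) : a + b ∈ face3 n w x (supp (f * g)) ∧
      (f * g).coeff (a + b) = f.coeff a * g.coeff b := by
  have h1 : inn x (inn w (inn n (f * g))) = inn x (inn w (inn n f)) * inn x (inn w (inn n g)) := by
    rw [inn_mul n hf hg, inn_mul w (inn_ne_zero hf) (inn_ne_zero hg),
      inn_mul x (inn_ne_zero (inn_ne_zero hf)) (inn_ne_zero (inn_ne_zero hg))]
  have hs : ∀ h : AddMonoidAlgebra K V, supp (inn x (inn w (inn n h))) = face3 n w x (supp h) := by
    intro h
    rw [supp_inn, supp_inn, supp_inn, face3]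
  have hc : ∀ (h : AddMonoidAlgebra K V) (v : V), v ∈ face3 n w x (supp h) →
      (inn x (inn w (inn n h))).coeff v = h.coeff v := by
    intro h v hv
    have h2 := face_subset hv
    have h3 := face_subset h2
    rw [inn_coeff_of_mem, inn_coeff_of_mem, inn_coeff_of_mem h3]
    · rwa [supp_inn]
    · rw [supp_inn, supp_inn]; exact hv
  have hsing : ∀ (h : AddMonoidAlgebra K V) (v : V), v ∈ face3 n w x (supp h) →
      inn x (inn w (inn n h)) = AddMonoidAlgebra.single v (h.coeff v) := by
    intro h v hv
    apply AddMonoidAlgebra.coeff_injective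
    ext y
    by_cases hy : y = v
    · subst hy
      rw [hc h y hv]; simp
    · have : y ∉ supp (inn x (inn w (inn n h))) := by
        rw [hs]
        intro hy'
        exact hy (face3_unique F hy' hv)
      rw [mem_supp, not_not] at this
      rw [this]
      simp [Finsupp.single_apply, Ne.symm hy]
  obtain ⟨y, hy⟩ := face3_nonempty (n := n) (w := w) (x := x) (supp_nonempty (mul_ne_zero hf hg))
  rw [hsing _ a ha, hsing _ b hb, hsing _ y hy, AddMonoidAlgebra.single_mul_single] at h1
  rw [AddMonoidAlgebra.single_inj] at h1
  rcases h1 with ⟨h1, h2⟩ | ⟨h1, -⟩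
  · subst h1
    exact ⟨hy, h2⟩
  · exact absurd h1 (mem_supp.1 (face_subset (face_subset (face_subset hy))))

end GroupRing

section Hat
variable {V : Type*} [AddCommGroup V] [Module ℝ V] {K : Type*} [CommRing K]

noncomputable def st : AddMonoidAlgebra K V →+* AddMonoidAlgebra K V :=
  AddMonoidAlgebra.mapDomainRingHom K (-AddMonoidHom.id V)

lemma st_single (v : V) (c : K) :
    st (AddMonoidAlgebra.single v c) = AddMonoidAlgebra.single (-v) c := by
  simp [st]

lemma st_coeff (f : AddMonoidAlgebra K V) (v : V) : (st f).coeff v = f.coeff (-v) := by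
  induction f using AddMonoidAlgebra.induction_linear with
  | zero => simp
  | add f g hf hg => simp [map_add, hf, hg]
  | single u c =>
    classical
    rw [st_single]
    simp [Finsupp.single_apply, neg_eq_iff_eq_neg]

lemma st_st (f : AddMonoidAlgebra K V) : st (st f) = f := by
  apply AddMonoidAlgebra.coeff_injective
  ext v
  simp [st_coeff]

lemma mem_supp_st {f : AddMonoidAlgebra K V} {v : V} : v ∈ supp (st f) ↔ -v ∈ supp f := by
  rw [mem_supp, mem_supp, st_coeff]

lemma st_ne_zero {f : AddMonoidAlgebra K V} (h : f ≠ 0) : st f ≠ 0 := by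
  intro h0
  apply h
  rw [← st_st f, h0, map_zero]

lemma mem_face_st {φ : V →ₗ[ℝ] ℝ} {s t : Finset V} (hst : ∀ v, v ∈ t ↔ -v ∈ s) {v : V} :
    v ∈ face φ t ↔ -v ∈ face (-φ) s := by
  rw [mem_face, mem_face, hst]
  refine and_congr_right fun _ => ⟨fun h u hu => ?_, fun h u hu => ?_⟩
  · have := h (-u) (by rw [hst]; simpa using hu)
    simp at this ⊢
    linarith
  · have := h (-u) ((hst u).1 hu)
    simp at this ⊢
    linarith

lemma mem_face3_st {n w x : V →ₗ[ℝ] ℝ} {s t : Finset V} (hst : ∀ v, v ∈ t ↔ -v ∈ s) {v : V} :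
    v ∈ face3 n w x t ↔ -v ∈ face3 (-n) (-w) (-x) s := by
  refine mem_face_st fun v => mem_face_st fun v => mem_face_st hst

open Polynomial

noncomputable def dN (F : AddMonoidAlgebra ℝ[X] V) : ℕ := (supp F).sup fun v => (F.coeff v).natDegree

lemma le_dN (F : AddMonoidAlgebra ℝ[X] V) (v : V) : (F.coeff v).natDegree ≤ dN F := by
  by_cases h : v ∈ supp F
  · exact Finset.le_sup (f := fun v => (F.coeff v).natDegree) h
  · rw [mem_supp, not_not] at h
    simp [h]

noncomputable def hatk (k : ℕ) (F : AddMonoidAlgebra ℝ[X] V) : AddMonoidAlgebra ℝ V :=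
  AddMonoidAlgebra.map (Polynomial.lcoeff ℝ k).toAddMonoidHom F

lemma hatk_coeff (k : ℕ) (F : AddMonoidAlgebra ℝ[X] V) (v : V) :
    (hatk k F).coeff v = (F.coeff v).coeff k := by
  simp [hatk]

lemma hatk_mul (a b : ℕ) (F G : AddMonoidAlgebra ℝ[X] V) (hF : dN F ≤ a) (hG : dN G ≤ b) :
    hatk (a + b) (F * G) = hatk a F * hatk b G := by
  classical
  apply AddMonoidAlgebra.coeff_injective
  ext y
  have h1 : ∀ (k) (H : AddMonoidAlgebra ℝ[X] V), supp (hatk k H) ⊆ supp H := by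
    intro k H v hv
    rw [mem_supp, hatk_coeff] at hv
    rw [mem_supp]
    rintro h
    simp [h] at hv
  rw [hatk_coeff, mul_coeff_eq F G y _ _ subset_rfl subset_rfl,
    mul_coeff_eq _ _ y _ _ (h1 a F) (h1 b G), Polynomial.finset_sum_coeff]
  apply Finset.sum_congr rfl
  intro u _
  rw [Polynomial.finset_sum_coeff]
  apply Finset.sum_congr rfl
  intro v _
  split_ifs
  · rw [hatk_coeff, hatk_coeff, Polynomial.coeff_mul_add_eq_of_natDegree_le ((le_dN F u).trans hF)
      ((le_dN G v).trans hG)]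
  · simp

noncomputable def hat (F : AddMonoidAlgebra ℝ[X] V) : AddMonoidAlgebra ℝ V := hatk (dN F) F

lemma mem_supp_hat {F : AddMonoidAlgebra ℝ[X] V} {v : V} :
    v ∈ supp (hat F) ↔ v ∈ supp F ∧ (F.coeff v).natDegree = dN F := by
  rw [mem_supp, mem_supp, hat, hatk_coeff]
  constructor
  · intro h
    refine ⟨fun h0 => by simp [h0] at h, le_antisymm (le_dN F v) (Polynomial.le_natDegree_of_ne_zero h)⟩
  · rintro ⟨h1, h2⟩
    rw [← h2]
    simpa using h1

lemma hat_ne_zero {F : AddMonoidAlgebra ℝ[X] V} (h : F ≠ 0) : hat F ≠ 0 := by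
  obtain ⟨v, hv, hm⟩ := Finset.exists_mem_eq_sup (supp F) (supp_nonempty h)
    (fun v => (F.coeff v).natDegree)
  have : v ∈ supp (hat F) := mem_supp_hat.2 ⟨hv, hm.symm⟩
  intro h0
  rw [h0] at this
  simp [supp] at this

lemma dN_mul {F G : AddMonoidAlgebra ℝ[X] V} (hF : F ≠ 0) (hG : G ≠ 0) :
    dN (F * G) = dN F + dN G := by
  apply le_antisymm
  · apply Finset.sup_le
    intro v _
    classical
    rw [mul_coeff_eq F G v _ _ subset_rfl subset_rfl]
    apply Polynomial.natDegree_sum_le_of_forall_le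
    intro a _
    apply Polynomial.natDegree_sum_le_of_forall_le
    intro b _
    split_ifs
    · exact Polynomial.natDegree_mul_le.trans (add_le_add (le_dN F a) (le_dN G b))
    · simp
  · have h := mul_ne_zero (hat_ne_zero hF) (hat_ne_zero hG)
    rw [hat, hat, ← hatk_mul _ _ _ _ le_rfl le_rfl] at h
    obtain ⟨v, hv⟩ := supp_nonempty h
    rw [mem_supp, hatk_coeff] at hv
    exact (Polynomial.le_natDegree_of_ne_zero hv).trans (le_dN _ v)

lemma hat_mul {F G : AddMonoidAlgebra ℝ[X] V} (hF : F ≠ 0) (hG : G ≠ 0) :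
    hat (F * G) = hat F * hat G := by
  rw [hat, dN_mul hF hG, hatk_mul _ _ _ _ le_rfl le_rfl, hat, hat]

lemma dN_st (F : AddMonoidAlgebra ℝ[X] V) : dN (st F) = dN F := by
  apply le_antisymm
  · apply Finset.sup_le
    intro v _
    rw [st_coeff]; exact le_dN F _
  · apply Finset.sup_le
    intro v _
    have := le_dN (st F) (-v)
    rwa [st_coeff, neg_neg] at this

lemma hat_st (F : AddMonoidAlgebra ℝ[X] V) : hat (st F) = st (hat F) := by
  apply AddMonoidAlgebra.coeff_injective
  ext v
  rw [hat, hatk_coeff, st_coeff, st_coeff, hat, hatk_coeff, dN_st]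

end Hat

lemma vand {ι k : Type*} [Field k] (s : Finset ι) (z c : ι → k) (hz : Set.InjOn z s)
    (h : ∀ m : ℕ, ∑ i ∈ s, c i * z i ^ m = 0) : ∀ i ∈ s, c i = 0 := by
  classical
  have h2 : ∀ P : Polynomial k, ∑ i ∈ s, c i * P.eval (z i) = 0 := by
    intro P
    induction P using Polynomial.induction_on' with
    | add p q hp hq => simp [mul_add, Finset.sum_add_distrib, hp, hq]
    | monomial n a =>
      have := h n
      calc _ = ∑ i ∈ s, a * (c i * z i ^ n) := by
            apply Finset.sum_congr rfl; intro i _; simp; ring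
        _ = 0 := by rw [← Finset.mul_sum, this, mul_zero]
  intro i hi
  have h3 := h2 (∏ j ∈ s.erase i, (Polynomial.X - Polynomial.C (z j)))
  rw [Finset.sum_eq_single_of_mem i hi] at h3
  · rcases mul_eq_zero.1 h3 with h | h
    · exact h
    · rw [Polynomial.eval_prod, Finset.prod_eq_zero_iff] at h
      obtain ⟨j, hj, hj2⟩ := h
      rw [Finset.mem_erase] at hj
      simp [sub_eq_zero] at hj2
      exact absurd (hz hj.2 hi hj2.symm) hj.1
  · intro j hj hne
    rw [Polynomial.eval_prod, Finset.prod_eq_zero (i := j)]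
    · simp
    · exact Finset.mem_erase.2 ⟨hne, hj⟩
    · simp

section BL

abbrev EE := AddMonoidAlgebra ℝ ℝ

noncomputable def evE (τ : ℂ) : EE →+* ℂ :=
  (AddMonoidAlgebra.lift ℝ ℂ ℝ
    { toFun := fun s => Complex.exp (τ * (Multiplicative.toAdd s : ℝ))
      map_one' := by simp
      map_mul' := by intro a b; simp [mul_add, Complex.exp_add] } : EE →ₐ[ℝ] ℂ).toRingHom

lemma evE_single (τ : ℂ) (s c : ℝ) :
    evE τ (AddMonoidAlgebra.single s c) = c * Complex.exp (τ * s) := by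
  simp [evE]

lemma evE_eq (τ : ℂ) (h : EE) : evE τ h = ∑ s ∈ supp h, (h.coeff s : ℂ) * Complex.exp (τ * s) := by
  conv_lhs => rw [← AddMonoidAlgebra.sum_coeff_single h]
  rw [Finsupp.sum, map_sum]
  apply Finset.sum_congr rfl
  intro s _
  rw [evE_single]

lemma evE_diff (h : EE) (τ : ℂ) : DifferentiableAt ℂ (fun t => evE t h) τ := by
  simp only [evE_eq]
  fun_prop

abbrev idf : ℝ →ₗ[ℝ] ℝ := LinearMap.id

lemma frame_id : Frame (V := ℝ) idf idf idf := fun v h _ _ => h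
lemma frame_nid : Frame (V := ℝ) (-idf) (-idf) (-idf) := fun v h _ _ => by simpa using h

lemma mem_face3_id {s : Finset ℝ} {a : ℝ} : a ∈ face3 idf idf idf s ↔ a ∈ s ∧ ∀ u ∈ s, u ≤ a := by
  constructor
  · intro h
    have := mem_face.1 (face_subset (face_subset h))
    simpa using this
  · rintro ⟨h1, h2⟩
    have hf : ∀ t ⊆ s, a ∈ t → a ∈ face idf t := fun t ht ha => mem_face.2 ⟨ha, fun u hu => h2 u (ht hu)⟩
    have A := hf s subset_rfl h1
    have B := hf _ face_subset A
    exact hf _ (face_subset.trans face_subset) B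

lemma mem_face3_nid {s : Finset ℝ} {a : ℝ} :
    a ∈ face3 (-idf) (-idf) (-idf) s ↔ a ∈ s ∧ ∀ u ∈ s, a ≤ u := by
  constructor
  · intro h
    have := mem_face.1 (face_subset (face_subset h))
    simpa using this
  · rintro ⟨h1, h2⟩
    have hf : ∀ t ⊆ s, a ∈ t → a ∈ face (-idf) t :=
      fun t ht ha => mem_face.2 ⟨ha, fun u hu => by simpa using h2 u (ht hu)⟩
    have A := hf s subset_rfl h1
    have B := hf _ face_subset A
    exact hf _ (face_subset.trans face_subset) B

section
variable {K : Type*} [CommRing K] [IsDomain K]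

def IsTop (f : AddMonoidAlgebra K ℝ) (a : ℝ) : Prop := a ∈ supp f ∧ ∀ u ∈ supp f, u ≤ a
def IsBot (f : AddMonoidAlgebra K ℝ) (a : ℝ) : Prop := a ∈ supp f ∧ ∀ u ∈ supp f, a ≤ u

lemma exists_top {f : AddMonoidAlgebra K ℝ} (h : f ≠ 0) : ∃ a, IsTop f a := by
  obtain ⟨a, h1, h2⟩ := Finset.exists_max_image (supp f) id (supp_nonempty h)
  exact ⟨a, h1, h2⟩
lemma exists_bot {f : AddMonoidAlgebra K ℝ} (h : f ≠ 0) : ∃ a, IsBot f a := by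
  obtain ⟨a, h1, h2⟩ := Finset.exists_min_image (supp f) id (supp_nonempty h)
  exact ⟨a, h1, h2⟩

lemma ne_of_top {f : AddMonoidAlgebra K ℝ} {a : ℝ} (h : a ∈ supp f) : f ≠ 0 := by
  rintro rfl
  simp [supp] at h

lemma top_mul {f g : AddMonoidAlgebra K ℝ} {a b : ℝ} (ha : IsTop f a) (hb : IsTop g b) :
    IsTop (f * g) (a + b) ∧ (f * g).coeff (a + b) = f.coeff a * g.coeff b := by
  have := face3_mul frame_id (ne_of_top ha.1) (ne_of_top hb.1) (mem_face3_id.2 ha) (mem_face3_id.2 hb)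
  exact ⟨mem_face3_id.1 this.1, this.2⟩

lemma bot_mul {f g : AddMonoidAlgebra K ℝ} {a b : ℝ} (ha : IsBot f a) (hb : IsBot g b) :
    IsBot (f * g) (a + b) ∧ (f * g).coeff (a + b) = f.coeff a * g.coeff b := by
  have := face3_mul frame_nid (ne_of_top ha.1) (ne_of_top hb.1)
    (mem_face3_nid.2 ha) (mem_face3_nid.2 hb)
  exact ⟨mem_face3_nid.1 this.1, this.2⟩

lemma IsTop.eq {f : AddMonoidAlgebra K ℝ} {a b : ℝ} (ha : IsTop f a) (hb : IsTop f b) : a = b :=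
  le_antisymm (hb.2 a ha.1) (ha.2 b hb.1)
lemma IsBot.eq {f : AddMonoidAlgebra K ℝ} {a b : ℝ} (ha : IsBot f a) (hb : IsBot f b) : a = b :=
  le_antisymm (ha.2 b hb.1) (hb.2 a ha.1)
end

lemma two_single_coeff {K : Type*} [CommRing K] {M1 M0 : ℝ} (h : M0 < M1) (U T : K) :
    (AddMonoidAlgebra.single M1 U + AddMonoidAlgebra.single M0 T).coeff M1 = U ∧
    (AddMonoidAlgebra.single M1 U + AddMonoidAlgebra.single M0 T).coeff M0 = T ∧
    ∀ y, y ∈ supp (AddMonoidAlgebra.single M1 U + AddMonoidAlgebra.single M0 T) → y = M1 ∨ y = M0 := by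
  classical
  refine ⟨by simp [Finsupp.single_apply, h.ne], by simp [Finsupp.single_apply, h.ne'], ?_⟩
  intro y hy
  by_contra hcon
  push Not at hcon
  rw [mem_supp] at hy
  apply hy
  simp [Finsupp.single_apply, hcon.1.symm, hcon.2.symm]

lemma two_single_top {K : Type*} [CommRing K] {M1 M0 : ℝ} (h : M0 < M1) {U T : K} (hU : U ≠ 0)
    (hT : T ≠ 0) : IsTop (AddMonoidAlgebra.single M1 U + AddMonoidAlgebra.single M0 T) M1 ∧
      IsBot (AddMonoidAlgebra.single M1 U + AddMonoidAlgebra.single M0 T) M0 := by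
  obtain ⟨h1, h2, h3⟩ := two_single_coeff h U T
  refine ⟨⟨mem_supp.2 (by rwa [h1]), ?_⟩, ⟨mem_supp.2 (by rwa [h2]), ?_⟩⟩ <;>
  · intro u hu
    rcases h3 u hu with rfl | rfl
    · first | exact le_rfl | exact h.le
    · first | exact le_rfl | exact h.le

lemma ext_ge {h : EE} {t b ℓ : ℝ} (ht : IsTop h t) (hb : IsBot h b) (hℓ : 0 < ℓ) (τ0 : ℂ)
    (hv : ∀ k : ℕ, evE (τ0 + k * (2 * Real.pi * Complex.I / ℓ)) h = 0) : ℓ ≤ t - b := by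
  by_contra hlt
  push Not at hlt
  have hℓ' : (ℓ : ℂ) ≠ 0 := by exact_mod_cast hℓ.ne'
  have key := vand (supp h) (fun s : ℝ => Complex.exp (2 * Real.pi * Complex.I / ℓ * s))
    (fun s : ℝ => (h.coeff s : ℂ) * Complex.exp (τ0 * s)) ?_ ?_ t ht.1
  · rcases mul_eq_zero.1 key with h1 | h1
    · exact mem_supp.1 ht.1 (by exact_mod_cast h1)
    · exact Complex.exp_ne_zero _ h1
  · intro s hs s' hs' he
    simp only at he
    rw [Complex.exp_eq_exp_iff_exists_int] at he
    obtain ⟨n, hn⟩ := he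
    have hpi : (2 * Real.pi * Complex.I : ℂ) ≠ 0 := by simp [Real.pi_ne_zero]
    have h2 : (s : ℂ) = s' + n * ℓ := by
      field_simp at hn
      linear_combination hn
    have h3 : s = s' + n * ℓ := by exact_mod_cast h2
    have a1 := ht.2 s hs
    have a2 := ht.2 s' hs'
    have a3 := hb.2 s hs
    have a4 := hb.2 s' hs'
    have hn0 : n = 0 := by
      rcases lt_trichotomy n 0 with h | h | h
      · have : (n : ℝ) ≤ -1 := by exact_mod_cast (by omega : n ≤ -1)
        nlinarith
      · exact h
      · have : (1 : ℝ) ≤ n := by exact_mod_cast (by omega : 1 ≤ n)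
        nlinarith
    simpa [hn0] using h3
  · intro m
    rw [← hv m, evE_eq]
    apply Finset.sum_congr rfl
    intro s _
    rw [mul_assoc, ← Complex.exp_nat_mul, ← Complex.exp_add]
    congr 2
    ring

lemma binom_zero {u1 u2 c1 c2 : ℝ} (hu : u2 < u1) (h1 : c1 ≠ 0) (h2 : c2 ≠ 0) (τ : ℂ) :
    evE τ (AddMonoidAlgebra.single u1 c1 + AddMonoidAlgebra.single u2 c2) = 0 ↔
      Complex.exp (τ * (u1 - u2 : ℝ)) = ((-c2 / c1 : ℝ) : ℂ) := by
  rw [map_add, evE_single, evE_single]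
  have h1' : (c1 : ℂ) ≠ 0 := by exact_mod_cast h1
  have e : Complex.exp (τ * u1) = Complex.exp (τ * (u1 - u2 : ℝ)) * Complex.exp (τ * u2) := by
    rw [← Complex.exp_add]; congr 1; push_cast; ring
  rw [e]
  have hne := Complex.exp_ne_zero (τ * u2)
  push_cast
  rw [eq_div_iff h1']
  constructor
  · intro h
    apply mul_right_cancel₀ hne
    linear_combination h
  · intro h
    linear_combination Complex.exp (τ * u2) * h

lemma binom_simple {u1 u2 c1 c2 : ℝ} (hu : u2 < u1) (h1 : c1 ≠ 0) (h2 : c2 ≠ 0) (τ : ℂ)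
    {α β : EE} (hm : α * β = AddMonoidAlgebra.single u1 c1 + AddMonoidAlgebra.single u2 c2)
    (hα : evE τ α = 0) (hβ : evE τ β = 0) : False := by
  have d1 : HasDerivAt (fun t => evE t α * evE t β) 0 τ := by
    have := (evE_diff α τ).hasDerivAt.mul (evE_diff β τ).hasDerivAt
    simp only [hα, hβ, mul_zero, zero_mul, add_zero] at this
    exact this
  have d2 : HasDerivAt (fun t : ℂ => (c1 : ℂ) * Complex.exp (t * u1) + c2 * Complex.exp (t * u2))
      (c1 * (Complex.exp (τ * u1) * u1) + c2 * (Complex.exp (τ * u2) * u2)) τ := by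
    have e : ∀ u : ℝ, HasDerivAt (fun t : ℂ => Complex.exp (t * u)) (Complex.exp (τ * u) * u) τ := by
      intro u
      simpa using ((hasDerivAt_id τ).mul_const (u : ℂ)).cexp
    exact ((e u1).const_mul _).add ((e u2).const_mul _)
  have e3 : (fun t => evE t α * evE t β) =
      (fun t : ℂ => (c1 : ℂ) * Complex.exp (t * u1) + c2 * Complex.exp (t * u2)) := by
    ext t
    rw [← map_mul, hm, map_add, evE_single, evE_single]
  rw [e3] at d1
  have e4 := d1.unique d2
  have e5 : (c1 : ℂ) * Complex.exp (τ * u1) + c2 * Complex.exp (τ * u2) = 0 := by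
    have := congrFun e3 τ
    simp only [hα, zero_mul] at this
    exact this.symm
  have e6 : ((u1 : ℂ) - u2) * (c1 * Complex.exp (τ * u1)) = 0 := by
    linear_combination -e4 - u2 * e5
  have : (u1 : ℂ) - u2 ≠ 0 := by
    rw [sub_ne_zero]; exact_mod_cast hu.ne'
  simp [this, h1, Complex.exp_ne_zero] at e6

lemma zeros_ext {U T : EE} {u1 u2 c1 c2 t1 t2 d1 d2 : ℝ} (hu : u2 < u1) (h1 : c1 ≠ 0) (h2 : c2 ≠ 0)
    (ht : t2 < t1) (k1 : d1 ≠ 0) (k2 : d2 ≠ 0)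
    (hU : U = AddMonoidAlgebra.single u1 c1 + AddMonoidAlgebra.single u2 c2)
    (hT : T = AddMonoidAlgebra.single t1 d1 + AddMonoidAlgebra.single t2 d2)
    (hz : ∀ τ, evE τ U = 0 → evE τ T = 0) :
    u1 - u2 ≤ t1 - t2 ∧ ∃ τ0 : ℂ, ∀ k : ℕ,
      evE (τ0 + k * (2 * Real.pi * Complex.I / (u1 - u2 : ℝ))) U = 0 := by
  subst hU hT
  have hl : 0 < u1 - u2 := by linarith
  have hl' : ((u1 - u2 : ℝ) : ℂ) ≠ 0 := by exact_mod_cast hl.ne'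
  have hc : ((-c2 / c1 : ℝ) : ℂ) ≠ 0 := by
    have : -c2 / c1 ≠ 0 := div_ne_zero (neg_ne_zero.2 h2) h1
    exact_mod_cast this
  set ω : ℂ := Complex.log ((-c2 / c1 : ℝ) : ℂ) / (u1 - u2 : ℝ) with hω
  have hk : ∀ k : ℕ, evE (ω + k * (2 * Real.pi * Complex.I / (u1 - u2 : ℝ)))
      (AddMonoidAlgebra.single u1 c1 + AddMonoidAlgebra.single u2 c2) = 0 := by
    intro k
    rw [binom_zero hu h1 h2]
    have : (ω + k * (2 * Real.pi * Complex.I / (u1 - u2 : ℝ))) * (u1 - u2 : ℝ) =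
        Complex.log ((-c2 / c1 : ℝ) : ℂ) + k * (2 * Real.pi * Complex.I) := by
      rw [hω]; field_simp
    rw [this, Complex.exp_add, Complex.exp_log hc, Complex.exp_nat_mul_two_pi_mul_I, mul_one]
  refine ⟨?_, ω, hk⟩
  exact ext_ge (two_single_top ht k1 k2).1 (two_single_top ht k1 k2).2 hl ω (fun k => hz _ (hk k))

lemma BL' {F G : AddMonoidAlgebra EE ℝ} {M1 M0 : ℝ} (hM : M0 < M1)
    {U T : EE} {u1 u2 c1 c2 t1 t2 d1 d2 : ℝ} (hu : u2 < u1) (h1 : c1 ≠ 0) (h2 : c2 ≠ 0)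
    (ht : t2 < t1) (k1 : d1 ≠ 0) (k2 : d2 ≠ 0)
    (hU : U = AddMonoidAlgebra.single u1 c1 + AddMonoidAlgebra.single u2 c2)
    (hT : T = AddMonoidAlgebra.single t1 d1 + AddMonoidAlgebra.single t2 d2)
    (hFG : F * G = AddMonoidAlgebra.single M1 U + AddMonoidAlgebra.single M0 T)
    {a1 a0 b1 b0 : ℝ} (ha1 : IsTop F a1) (ha0 : IsBot F a0) (hb1 : IsTop G b1) (hb0 : IsBot G b0)
    (ha : a0 < a1) (hb : b0 < b1) {p q r s : ℝ} (hp : IsTop (F.coeff a1) p) (hq : IsBot (F.coeff a1) q)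
    (hr : IsTop (F.coeff a0) r) (hs : IsBot (F.coeff a0) s) : p - q = r - s := by
  have hUt := two_single_top hu h1 h2
  have hTt := two_single_top ht k1 k2
  rw [← hU] at hUt
  rw [← hT] at hTt
  have hU0 : U ≠ 0 := ne_of_top hUt.1.1
  have hT0 : T ≠ 0 := ne_of_top hTt.1.1
  have hFt := two_single_top hM hU0 hT0
  have hco := two_single_coeff hM U T
  rw [← hFG] at hFt hco
  have m1 := top_mul ha1 hb1
  have m0 := bot_mul ha0 hb0
  have e1 := m1.1.eq hFt.1
  have e0 := m0.1.eq hFt.2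
  rw [e1, hco.1] at m1
  rw [e0, hco.2.1] at m0
  have hsp : ∀ τ, (AddMonoidAlgebra.mapRingHom ℝ (evE τ) F) * (AddMonoidAlgebra.mapRingHom ℝ (evE τ) G)
      = AddMonoidAlgebra.single M1 (evE τ U) + AddMonoidAlgebra.single M0 (evE τ T) := by
    intro τ
    rw [← map_mul, hFG, map_add, AddMonoidAlgebra.mapRingHom_single, AddMonoidAlgebra.mapRingHom_single]
  have hsup : ∀ τ (H : AddMonoidAlgebra EE ℝ) y, y ∈ supp (AddMonoidAlgebra.mapRingHom ℝ (evE τ) H) →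
      y ∈ supp H := by
    intro τ H y hy
    rw [mem_supp, AddMonoidAlgebra.coeff_mapRingHom] at hy
    rw [mem_supp]
    intro h
    rw [h, map_zero] at hy
    exact hy rfl
  have hnotin : ∀ τ (H : AddMonoidAlgebra EE ℝ) y,
      y ∉ supp (AddMonoidAlgebra.mapRingHom ℝ (evE τ) H) → evE τ (H.coeff y) = 0 := by
    intro τ H y hy
    rwa [mem_supp, AddMonoidAlgebra.coeff_mapRingHom, not_not] at hy
  have hZ1 : ∀ τ, evE τ U = 0 → evE τ T = 0 := by
    intro τ hU'
    by_contra hT'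
    have hh := hsp τ
    rw [hU', AddMonoidAlgebra.single_zero, zero_add] at hh
    have hne : AddMonoidAlgebra.single M0 (evE τ T) ≠ 0 := AddMonoidAlgebra.single_ne_zero.2 hT'
    rw [← hh] at hne
    obtain ⟨a, hat⟩ := exists_top (left_ne_zero_of_mul hne)
    obtain ⟨b, hbt⟩ := exists_top (right_ne_zero_of_mul hne)
    have hab := (top_mul hat hbt).1.1
    rw [hh, mem_supp] at hab
    have hab' : a + b = M0 := by
      by_contra hc
      apply hab
      simp [Finsupp.single_apply, Ne.symm hc]
    have ha' := ha0.2 a (hsup τ F a hat.1)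
    have hb' := hb0.2 b (hsup τ G b hbt.1)
    have : a = a0 := by linarith
    have : b = b0 := by linarith
    subst a b
    refine binom_simple hu h1 h2 τ (m1.2.symm.trans hU) (hnotin τ F a1 fun hc => ?_)
      (hnotin τ G b1 fun hc => ?_)
    · linarith [hat.2 _ hc]
    · linarith [hbt.2 _ hc]
  have hZ0 : ∀ τ, evE τ T = 0 → evE τ U = 0 := by
    intro τ hT'
    by_contra hU'
    have hh := hsp τ
    rw [hT', AddMonoidAlgebra.single_zero, add_zero] at hh
    have hne : AddMonoidAlgebra.single M1 (evE τ U) ≠ 0 := AddMonoidAlgebra.single_ne_zero.2 hU'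
    rw [← hh] at hne
    obtain ⟨a, hat⟩ := exists_bot (left_ne_zero_of_mul hne)
    obtain ⟨b, hbt⟩ := exists_bot (right_ne_zero_of_mul hne)
    have hab := (bot_mul hat hbt).1.1
    rw [hh, mem_supp] at hab
    have hab' : a + b = M1 := by
      by_contra hc
      apply hab
      simp [Finsupp.single_apply, Ne.symm hc]
    have ha' := ha1.2 a (hsup τ F a hat.1)
    have hb' := hb1.2 b (hsup τ G b hbt.1)
    have : a = a1 := by linarith
    have : b = b1 := by linarith
    subst a b
    refine binom_simple ht k1 k2 τ (m0.2.symm.trans hT) (hnotin τ F a0 fun hc => ?_)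
      (hnotin τ G b0 fun hc => ?_)
    · linarith [hat.2 _ hc]
    · linarith [hbt.2 _ hc]
  obtain ⟨l1, τ0, hτ⟩ := zeros_ext hu h1 h2 ht k1 k2 hU hT hZ1
  obtain ⟨l2, -⟩ := zeros_ext ht k1 k2 hu h1 h2 hT hU hZ0
  have hl : 0 < u1 - u2 := by linarith
  have hcase : ∀ k : ℕ, (∀ y, evE (τ0 + k * (2 * Real.pi * Complex.I / (u1 - u2 : ℝ))) (F.coeff y) = 0) ∨
      (∀ y, evE (τ0 + k * (2 * Real.pi * Complex.I / (u1 - u2 : ℝ))) (G.coeff y) = 0) := by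
    intro k
    have hh := hsp (τ0 + k * (2 * Real.pi * Complex.I / (u1 - u2 : ℝ)))
    rw [hτ k, hZ1 _ (hτ k), AddMonoidAlgebra.single_zero, AddMonoidAlgebra.single_zero, zero_add] at hh
    rcases mul_eq_zero.1 hh with h | h
    · left; intro y
      rw [← AddMonoidAlgebra.coeff_mapRingHom, h]; rfl
    · right; intro y
      rw [← AddMonoidAlgebra.coeff_mapRingHom, h]; rfl
  have hv : ∀ y z, ∀ k : ℕ, evE (τ0 + k * (2 * Real.pi * Complex.I / (u1 - u2 : ℝ)))
      (F.coeff y * G.coeff z) = 0 := by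
    intro y z k
    rw [map_mul]
    rcases hcase k with h | h
    · rw [h, zero_mul]
    · rw [h, mul_zero]
  obtain ⟨p', hp'⟩ := exists_top (mem_supp.1 hb1.1)
  obtain ⟨q', hq'⟩ := exists_bot (mem_supp.1 hb1.1)
  obtain ⟨r', hr'⟩ := exists_top (mem_supp.1 hb0.1)
  obtain ⟨s', hs'⟩ := exists_bot (mem_supp.1 hb0.1)
  have x1 := ext_ge (top_mul hp hr').1 (bot_mul hq hs').1 hl τ0 (hv a1 b0)
  have x2 := ext_ge (top_mul hr hp').1 (bot_mul hs hq').1 hl τ0 (hv a0 b1)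
  have y1 := (top_mul hp hp').1
  have y2 := (bot_mul hq hq').1
  have y3 := (top_mul hr hr').1
  have y4 := (bot_mul hs hs').1
  rw [← m1.2] at y1 y2
  rw [← m0.2] at y3 y4
  have z1 := y1.eq hUt.1
  have z2 := y2.eq hUt.2
  have z3 := y3.eq hTt.1
  have z4 := y4.eq hTt.2
  linarith

end BL

section BLV
variable {V : Type*} [AddCommGroup V] [Module ℝ V]

noncomputable def Th (ψ x : V →ₗ[ℝ] ℝ) : AddMonoidAlgebra ℝ V →+* AddMonoidAlgebra EE ℝ :=
  (AddMonoidAlgebra.lift ℝ (AddMonoidAlgebra EE ℝ) V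
    { toFun := fun v => AddMonoidAlgebra.single (ψ v.toAdd) (AddMonoidAlgebra.single (x v.toAdd) (1:ℝ))
      map_one' := by simp [AddMonoidAlgebra.one_def]
      map_mul' := by
        intro a b
        simp [AddMonoidAlgebra.single_mul_single] }).toRingHom

lemma Th_single (ψ x : V →ₗ[ℝ] ℝ) (v : V) (c : ℝ) : Th ψ x (AddMonoidAlgebra.single v c) =
    AddMonoidAlgebra.single (ψ v) (AddMonoidAlgebra.single (x v) c) := by
  simp [Th, AddMonoidAlgebra.lift_single, AddMonoidAlgebra.smul_single]

lemma Th_coeff (ψ x : V →ₗ[ℝ] ℝ) (f : AddMonoidAlgebra ℝ V) (y s : ℝ) :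
    ((Th ψ x f).coeff y).coeff s = ∑ v ∈ supp f, if ψ v = y ∧ x v = s then f.coeff v else 0 := by
  classical
  have h : Th ψ x f = ∑ v ∈ supp f, Th ψ x (AddMonoidAlgebra.single v (f.coeff v)) := by
    rw [← map_sum]
    congr 1
    exact (AddMonoidAlgebra.sum_coeff_single f).symm
  have : ∀ (t : Finset V), ((∑ v ∈ t, Th ψ x (AddMonoidAlgebra.single v (f.coeff v))).coeff y).coeff s
      = ∑ v ∈ t, if ψ v = y ∧ x v = s then f.coeff v else 0 := by
    intro t
    induction t using Finset.induction_on with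
    | empty => simp
    | insert a t ha ih =>
      rw [Finset.sum_insert ha, Finset.sum_insert ha, ← ih, Th_single]
      simp only [AddMonoidAlgebra.coeff_add, AddMonoidAlgebra.coeff_single, Finsupp.add_apply]
      congr 1
      by_cases h1 : ψ a = y <;> by_cases h2 : x a = s <;> simp [h1, h2, Finsupp.single_apply]
  rw [← this, ← h]

lemma Th_mem {φ ψ x : V →ₗ[ℝ] ℝ} (F : Frame φ ψ x) {f : AddMonoidAlgebra ℝ V}
    (hφ : ∀ u ∈ supp f, ∀ v ∈ supp f, φ u = φ v) {v : V} (hv : v ∈ supp f) :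
    ((Th ψ x f).coeff (ψ v)).coeff (x v) = f.coeff v := by
  rw [Th_coeff, Finset.sum_eq_single v]
  · simp
  · intro u hu huv
    rw [if_neg]
    rintro ⟨h1, h2⟩
    apply huv
    rw [← sub_eq_zero]
    apply F <;> rw [map_sub, sub_eq_zero]
    · exact hφ u hu v hv
    · exact h1
    · exact h2
  · intro h; exact absurd hv h

lemma Th_exists {ψ x : V →ₗ[ℝ] ℝ} {f : AddMonoidAlgebra ℝ V} {y s : ℝ}
    (h : s ∈ supp ((Th ψ x f).coeff y)) : ∃ v ∈ supp f, ψ v = y ∧ x v = s := by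
  rw [mem_supp, Th_coeff] at h
  obtain ⟨v, hv, hne⟩ := Finset.exists_ne_zero_of_sum_ne_zero h
  refine ⟨v, hv, ?_⟩
  by_contra hc
  exact hne (if_neg hc)

lemma Th_exists' {ψ x : V →ₗ[ℝ] ℝ} {f : AddMonoidAlgebra ℝ V} {y : ℝ}
    (h : y ∈ supp (Th ψ x f)) : ∃ v ∈ supp f, ψ v = y := by
  obtain ⟨s, hs⟩ := supp_nonempty (mem_supp.1 h)
  obtain ⟨v, hv, h1, _⟩ := Th_exists hs
  exact ⟨v, hv, h1⟩

lemma Th_ne {φ ψ x : V →ₗ[ℝ] ℝ} (F : Frame φ ψ x) {f : AddMonoidAlgebra ℝ V}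
    (hφ : ∀ u ∈ supp f, ∀ v ∈ supp f, φ u = φ v) {v : V} (hv : v ∈ supp f) :
    ψ v ∈ supp (Th ψ x f) ∧ x v ∈ supp ((Th ψ x f).coeff (ψ v)) := by
  have h2 : x v ∈ supp ((Th ψ x f).coeff (ψ v)) := by
    rw [mem_supp, Th_mem F hφ hv]; exact mem_supp.1 hv
  exact ⟨mem_supp.2 (ne_of_top h2), h2⟩

lemma mem_face_neg {φ : V →ₗ[ℝ] ℝ} {s : Finset V} {v : V} :
    v ∈ face (-φ) s ↔ v ∈ s ∧ ∀ u ∈ s, φ v ≤ φ u := by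
  rw [mem_face]; simp

lemma BLV {φ ψ x : V →ₗ[ℝ] ℝ} (F : Frame φ ψ x) {f g : AddMonoidAlgebra ℝ V} (hf : f ≠ 0) (hg : g ≠ 0)
    {p1 p2 p3 p4 : V} (hs : ∀ v, v ∈ face φ (supp (f * g)) ↔ v = p1 ∨ v = p2 ∨ v = p3 ∨ v = p4)
    (h12 : ψ p1 = ψ p2) (h34 : ψ p3 = ψ p4) (h13 : ψ p3 < ψ p1) (hx1 : x p2 < x p1) (hx3 : x p4 < x p3)
    {a1 a2 a3 a4 b1 b3 : V} (ha1 : a1 ∈ face3 φ ψ x (supp f)) (ha2 : a2 ∈ face3 φ ψ (-x) (supp f))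
    (ha3 : a3 ∈ face3 φ (-ψ) x (supp f)) (ha4 : a4 ∈ face3 φ (-ψ) (-x) (supp f))
    (hb1 : b1 ∈ face ψ (face φ (supp g))) (hb3 : b3 ∈ face (-ψ) (face φ (supp g)))
    (ha : ψ a3 < ψ a1) (hb : ψ b3 < ψ b1) : x a1 - x a2 = x a3 - x a4 := by
  classical
  set f' := inn φ f with hf'
  set g' := inn φ g with hg'
  have hfe := supp_inn φ f
  have hge := supp_inn φ g
  have flatf : ∀ u ∈ supp f', ∀ v ∈ supp f', φ u = φ v := by
    rw [hfe]; intro u hu v hv; exact face_eq hu hv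
  have flatg : ∀ u ∈ supp g', ∀ v ∈ supp g', φ u = φ v := by
    rw [hge]; intro u hu v hv; exact face_eq hu hv
  have n12 : p1 ≠ p2 := by rintro rfl; exact lt_irrefl _ hx1
  have n34 : p3 ≠ p4 := by rintro rfl; exact lt_irrefl _ hx3
  have n13 : p1 ≠ p3 := by rintro rfl; exact lt_irrefl _ h13
  have n14 : p1 ≠ p4 := by rintro rfl; linarith
  have n23 : p2 ≠ p3 := by rintro rfl; linarith
  have n24 : p2 ≠ p4 := by rintro rfl; linarith
  have hmul := inn_mul φ hf hg
  rw [← hf', ← hg'] at hmul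
  set h := inn φ (f * g) with hh
  have hhe : ∀ v, v ∈ supp h ↔ v = p1 ∨ v = p2 ∨ v = p3 ∨ v = p4 := by
    intro v; rw [hh, supp_inn]; exact hs v
  have c1 : h.coeff p1 ≠ 0 := mem_supp.1 ((hhe _).2 (by simp))
  have c2 : h.coeff p2 ≠ 0 := mem_supp.1 ((hhe _).2 (by simp))
  have c3 : h.coeff p3 ≠ 0 := mem_supp.1 ((hhe _).2 (by simp))
  have c4 : h.coeff p4 ≠ 0 := mem_supp.1 ((hhe _).2 (by simp))
  have hdec : h = AddMonoidAlgebra.single p1 (h.coeff p1) + AddMonoidAlgebra.single p2 (h.coeff p2) +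
      AddMonoidAlgebra.single p3 (h.coeff p3) + AddMonoidAlgebra.single p4 (h.coeff p4) := by
    have : supp h = {p1, p2, p3, p4} := by ext v; rw [hhe]; simp
    have h2 : h = ∑ v ∈ supp h, AddMonoidAlgebra.single v (h.coeff v) :=
      (AddMonoidAlgebra.sum_coeff_single h).symm
    rw [this, Finset.sum_insert (by simp [*]), Finset.sum_insert (by simp [*]),
      Finset.sum_insert (by simp [*]), Finset.sum_singleton] at h2
    simpa only [add_assoc] using h2
  have key : Th ψ x f' * Th ψ x g' =
      AddMonoidAlgebra.single (ψ p1) (AddMonoidAlgebra.single (x p1) (h.coeff p1) +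
        AddMonoidAlgebra.single (x p2) (h.coeff p2)) +
      AddMonoidAlgebra.single (ψ p3) (AddMonoidAlgebra.single (x p3) (h.coeff p3) +
        AddMonoidAlgebra.single (x p4) (h.coeff p4)) := by
    rw [← map_mul, ← hmul]
    conv_lhs => rw [hdec]
    simp only [map_add, Th_single]
    rw [← h12, ← h34, AddMonoidAlgebra.single_add, AddMonoidAlgebra.single_add]
    abel
  unfold face3 at ha1 ha2 ha3 ha4
  rw [← hfe] at ha1 ha2 ha3 ha4
  rw [← hge] at hb1 hb3
  have m1 := mem_face.1 (face_subset ha1)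
  have m2 := mem_face.1 (face_subset ha2)
  have m3 := mem_face_neg.1 (face_subset ha3)
  have m4 := mem_face_neg.1 (face_subset ha4)
  have k1 := mem_face.1 hb1
  have k3 := mem_face_neg.1 hb3
  have e12 : ψ a2 = ψ a1 := le_antisymm (m1.2 _ m2.1) (m2.2 _ m1.1)
  have e34 : ψ a4 = ψ a3 := le_antisymm (m4.2 _ m3.1) (m3.2 _ m4.1)
  have T1 : IsTop (Th ψ x f') (ψ a1) := ⟨(Th_ne F flatf m1.1).1, fun u hu => by
    obtain ⟨v, hv, rfl⟩ := Th_exists' hu; exact m1.2 v hv⟩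
  have T3 : IsBot (Th ψ x f') (ψ a3) := ⟨(Th_ne F flatf m3.1).1, fun u hu => by
    obtain ⟨v, hv, rfl⟩ := Th_exists' hu; exact m3.2 v hv⟩
  have S1 : IsTop (Th ψ x g') (ψ b1) := ⟨(Th_ne F flatg k1.1).1, fun u hu => by
    obtain ⟨v, hv, rfl⟩ := Th_exists' hu; exact k1.2 v hv⟩
  have S3 : IsBot (Th ψ x g') (ψ b3) := ⟨(Th_ne F flatg k3.1).1, fun u hu => by
    obtain ⟨v, hv, rfl⟩ := Th_exists' hu; exact k3.2 v hv⟩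
  have up : ∀ a, a ∈ face ψ (supp f') → ∀ v ∈ supp f', ψ v = ψ a → v ∈ face ψ (supp f') := by
    intro a ha v hv he
    rw [mem_face] at ha ⊢
    exact ⟨hv, fun u hu => he ▸ ha.2 u hu⟩
  have dn : ∀ a, a ∈ face (-ψ) (supp f') → ∀ v ∈ supp f', ψ v = ψ a → v ∈ face (-ψ) (supp f') := by
    intro a ha v hv he
    rw [mem_face_neg] at ha ⊢
    exact ⟨hv, fun u hu => he ▸ ha.2 u hu⟩
  refine BL' h13 hx1 c1 c2 hx3 c3 c4 rfl rfl key T1 T3 S1 S3 ha hb (p := x a1) (q := x a2) (r := x a3)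
    (s := x a4) ?_ ?_ ?_ ?_
  · refine ⟨(Th_ne F flatf m1.1).2, fun u hu => ?_⟩
    obtain ⟨v, hv, h1, rfl⟩ := Th_exists hu
    exact (mem_face.1 ha1).2 v (up _ (face_subset ha1) v hv h1)
  · refine ⟨e12 ▸ (Th_ne F flatf m2.1).2, fun u hu => ?_⟩
    obtain ⟨v, hv, h1, rfl⟩ := Th_exists hu
    exact (mem_face_neg.1 ha2).2 v (up _ (face_subset ha1) v hv h1)
  · refine ⟨(Th_ne F flatf m3.1).2, fun u hu => ?_⟩
    obtain ⟨v, hv, h1, rfl⟩ := Th_exists hu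
    exact (mem_face.1 ha3).2 v (dn _ (face_subset ha3) v hv h1)
  · refine ⟨e34 ▸ (Th_ne F flatf m4.1).2, fun u hu => ?_⟩
    obtain ⟨v, hv, h1, rfl⟩ := Th_exists hu
    exact (mem_face_neg.1 ha4).2 v (dn _ (face_subset ha3) v hv h1)
end BLV

section FL
variable {V : Type*} [AddCommGroup V] [Module ℝ V]
open Polynomial

lemma face_of_add {K : Type*} [CommRing K] [IsDomain K] {φ : V →ₗ[ℝ] ℝ} {f g : AddMonoidAlgebra K V} {a b : V}
    (ha : a ∈ supp f) (hb : b ∈ supp g) (h : a + b ∈ face φ (supp (f * g))) :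
    a ∈ face φ (supp f) ∧ b ∈ face φ (supp g) := by
  have hf := (fun h0 => by simp [h0, supp] at ha : f ≠ 0)
  have hg := (fun h0 => by simp [h0, supp] at hb : g ≠ 0)
  obtain ⟨a', ha'⟩ := face_nonempty (φ := φ) ⟨a, ha⟩
  obtain ⟨b', hb'⟩ := face_nonempty (φ := φ) ⟨b, hb⟩
  have := face_mul φ hf hg ha' hb' h
  rw [map_add] at this
  rw [mem_face] at ha' hb' ⊢
  rw [mem_face]
  have h1 := ha'.2 a ha
  have h2 := hb'.2 b hb
  exact ⟨⟨ha, fun u hu => by linarith [ha'.2 u hu]⟩, ⟨hb, fun u hu => by linarith [hb'.2 u hu]⟩⟩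

lemma face3_of_add {K : Type*} [CommRing K] [IsDomain K] {n w x : V →ₗ[ℝ] ℝ} {f g : AddMonoidAlgebra K V} {a b : V}
    (ha : a ∈ supp f) (hb : b ∈ supp g) (h : a + b ∈ face3 n w x (supp (f * g))) :
    a ∈ face3 n w x (supp f) ∧ b ∈ face3 n w x (supp g) := by
  have hf := (fun h0 => by simp [h0, supp] at ha : f ≠ 0)
  have hg := (fun h0 => by simp [h0, supp] at hb : g ≠ 0)
  unfold face3 at *
  have h1 := face_of_add ha hb (face_subset (face_subset h))
  rw [← supp_inn n, ← supp_inn n] at h1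
  rw [← supp_inn n, inn_mul n hf hg] at h
  have h2 := face_of_add h1.1 h1.2 (face_subset h)
  rw [← supp_inn w, ← supp_inn w] at h2
  rw [← supp_inn w, inn_mul w (inn_ne_zero hf) (inn_ne_zero hg)] at h
  have h3 := face_of_add h2.1 h2.2 h
  rw [supp_inn, supp_inn, supp_inn, supp_inn] at h3
  exact h3

lemma Edge {φ ψ x : V →ₗ[ℝ] ℝ} (F : Frame φ ψ x) {f g : AddMonoidAlgebra ℝ V}
    {a1 a2 a3 a4 b1 b2 b3 b4 : V} (ha1 : a1 ∈ supp f) (ha2 : a2 ∈ supp f) (ha3 : a3 ∈ supp f)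
    (ha4 : a4 ∈ supp f) (hb1 : b1 ∈ supp g) (hb2 : b2 ∈ supp g) (hb3 : b3 ∈ supp g) (hb4 : b4 ∈ supp g)
    (hs : ∀ v, v ∈ face φ (supp (f * g)) ↔ v = a1 + b1 ∨ v = a2 + b2 ∨ v = a3 + b3 ∨ v = a4 + b4)
    (h12 : ψ (a1 + b1) = ψ (a2 + b2)) (h34 : ψ (a3 + b3) = ψ (a4 + b4))
    (hx1 : x (a2 + b2) < x (a1 + b1)) (hx3 : x (a4 + b4) < x (a3 + b3))
    (ha : ψ a3 < ψ a1) (hb : ψ b3 < ψ b1) : x a1 - x a2 = x a3 - x a4 := by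
  have hf := (fun h0 => by simp [h0, supp] at ha1 : f ≠ 0)
  have hg := (fun h0 => by simp [h0, supp] at hb1 : g ≠ 0)
  have h13 : ψ (a3 + b3) < ψ (a1 + b1) := by rw [map_add, map_add]; linarith
  have q1 : a1 + b1 ∈ face3 φ ψ x (supp (f * g)) := by
    unfold face3
    rw [mem_face, mem_face, hs]
    refine ⟨⟨by simp, ?_⟩, ?_⟩
    · intro u hu
      rw [hs] at hu
      rcases hu with rfl | rfl | rfl | rfl <;> linarith
    · intro u hu
      rw [mem_face, hs] at hu
      rcases hu with ⟨rfl | rfl | rfl | rfl, hu⟩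
      · linarith
      · linarith
      · have := hu (a1 + b1) (by rw [hs]; simp); linarith
      · have := hu (a1 + b1) (by rw [hs]; simp); linarith
  have q2 : a2 + b2 ∈ face3 φ ψ (-x) (supp (f * g)) := by
    unfold face3
    rw [mem_face_neg, mem_face, hs]
    refine ⟨⟨by simp, ?_⟩, ?_⟩
    · intro u hu
      rw [hs] at hu
      rcases hu with rfl | rfl | rfl | rfl <;> linarith
    · intro u hu
      rw [mem_face, hs] at hu
      rcases hu with ⟨rfl | rfl | rfl | rfl, hu⟩
      · linarith
      · linarith
      · have := hu (a1 + b1) (by rw [hs]; simp); linarith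
      · have := hu (a1 + b1) (by rw [hs]; simp); linarith
  have q3 : a3 + b3 ∈ face3 φ (-ψ) x (supp (f * g)) := by
    unfold face3
    rw [mem_face, mem_face_neg, hs]
    refine ⟨⟨by simp, ?_⟩, ?_⟩
    · intro u hu
      rw [hs] at hu
      rcases hu with rfl | rfl | rfl | rfl <;> linarith
    · intro u hu
      rw [mem_face_neg, hs] at hu
      rcases hu with ⟨rfl | rfl | rfl | rfl, hu⟩
      · have := hu (a3 + b3) (by rw [hs]; simp); linarith
      · have := hu (a3 + b3) (by rw [hs]; simp); linarith
      · linarith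
      · linarith
  have q4 : a4 + b4 ∈ face3 φ (-ψ) (-x) (supp (f * g)) := by
    unfold face3
    rw [mem_face_neg, mem_face_neg, hs]
    refine ⟨⟨by simp, ?_⟩, ?_⟩
    · intro u hu
      rw [hs] at hu
      rcases hu with rfl | rfl | rfl | rfl <;> linarith
    · intro u hu
      rw [mem_face_neg, hs] at hu
      rcases hu with ⟨rfl | rfl | rfl | rfl, hu⟩
      · have := hu (a3 + b3) (by rw [hs]; simp); linarith
      · have := hu (a3 + b3) (by rw [hs]; simp); linarith
      · linarith
      · linarith
  exact BLV F hf hg hs h12 h34 h13 hx1 hx3 (face3_of_add ha1 hb1 q1).1 (face3_of_add ha2 hb2 q2).1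
    (face3_of_add ha3 hb3 q3).1 (face3_of_add ha4 hb4 q4).1 (face_subset (face3_of_add ha1 hb1 q1).2)
    (face_subset (face3_of_add ha3 hb3 q3).2) ha hb

lemma flat_of_mul {φ : V →ₗ[ℝ] ℝ} {f g : AddMonoidAlgebra ℝ V} (hf : f ≠ 0) (hg : g ≠ 0)
    (h : ∀ u ∈ supp (f * g), ∀ v ∈ supp (f * g), φ u = φ v) :
    ∀ u ∈ supp f, ∀ v ∈ supp f, φ u = φ v := by
  obtain ⟨a, ha⟩ := face_nonempty (φ := φ) (supp_nonempty hf)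
  obtain ⟨b, hb⟩ := face_nonempty (φ := φ) (supp_nonempty hg)
  obtain ⟨y, hy⟩ := face_nonempty (φ := φ) (supp_nonempty (mul_ne_zero hf hg))
  obtain ⟨a', ha'⟩ := face_nonempty (φ := -φ) (supp_nonempty hf)
  obtain ⟨b', hb'⟩ := face_nonempty (φ := -φ) (supp_nonempty hg)
  obtain ⟨y', hy'⟩ := face_nonempty (φ := -φ) (supp_nonempty (mul_ne_zero hf hg))
  have h1 := face_mul φ hf hg ha hb hy
  have h2 := face_mul (-φ) hf hg ha' hb' hy'
  have h3 := h y (face_subset hy) y' (face_subset hy')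
  rw [mem_face] at ha hb
  rw [mem_face_neg] at ha' hb'
  simp only [LinearMap.neg_apply] at h2
  have h4 := ha.2 a' ha'.1
  have h5 := hb.2 b' hb'.1
  intro u hu v hv
  have := ha.2 u hu
  have := ha.2 v hv
  have := ha'.2 u hu
  have := ha'.2 v hv
  linarith

def sg (b : Bool) (φ : V →ₗ[ℝ] ℝ) : V →ₗ[ℝ] ℝ := if b then φ else -φ

@[simp] lemma sg_true (φ : V →ₗ[ℝ] ℝ) : sg true φ = φ := rfl
@[simp] lemma sg_false (φ : V →ₗ[ℝ] ℝ) : sg false φ = -φ := rfl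
lemma sg_not (b : Bool) (φ : V →ₗ[ℝ] ℝ) : sg (!b) φ = - sg b φ := by cases b <;> simp
lemma sg_zero {b : Bool} {φ : V →ₗ[ℝ] ℝ} {v : V} (h : sg b φ v = 0) : φ v = 0 := by
  cases b <;> simpa using h

lemma Frame.sg {n w x : V →ₗ[ℝ] ℝ} (F : Frame n w x) (σ τ ρ : Bool) :
    Frame (sg σ n) (sg τ w) (sg ρ x) :=
  fun v h1 h2 h3 => F v (sg_zero h1) (sg_zero h2) (sg_zero h3)

abbrev C3 (V : Type*) := Bool → Bool → Bool → V

def Cor (n w x : V →ₗ[ℝ] ℝ) (s : Finset V) (c : C3 V) : Prop :=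
  ∀ σ τ ρ, c σ τ ρ ∈ face3 (sg σ n) (sg τ w) (sg ρ x) s

variable {n w x : V →ₗ[ℝ] ℝ} {s : Finset V} {c : C3 V}

lemma exists_cor (n w x : V →ₗ[ℝ] ℝ) (hs : s.Nonempty) : ∃ c, Cor n w x s c := by
  choose c hc using fun σ τ ρ => face3_nonempty (n := sg σ n) (w := sg τ w) (x := sg ρ x) hs
  exact ⟨c, hc⟩

lemma Cor.mem (h : Cor n w x s c) (σ τ ρ) : c σ τ ρ ∈ s :=
  face_subset (face_subset (face_subset (h σ τ ρ)))

lemma Cor.n_le (h : Cor n w x s c) (τ ρ) {v : V} (hv : v ∈ s) : n v ≤ n (c true τ ρ) :=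
  (mem_face.1 (face_subset (face_subset (h true τ ρ)))).2 v hv
lemma Cor.le_n (h : Cor n w x s c) (τ ρ) {v : V} (hv : v ∈ s) : n (c false τ ρ) ≤ n v := by
  simpa using (mem_face.1 (face_subset (face_subset (h false τ ρ)))).2 v hv
lemma Cor.n_eq (h : Cor n w x s c) (σ τ ρ τ' ρ') : n (c σ τ ρ) = n (c σ τ' ρ') := by
  have := face_eq (face_subset (face_subset (h σ τ ρ))) (face_subset (face_subset (h σ τ' ρ')))
  cases σ <;> simpa using this
lemma Cor.mem_n (h : Cor n w x s c) (σ τ ρ) {v : V} (hv : v ∈ s) (hn : n v = n (c σ τ ρ)) :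
    v ∈ face (Cov.sg σ n) s := by
  rw [mem_face]
  refine ⟨hv, fun u hu => ?_⟩
  cases σ
  · simpa [hn] using h.le_n τ ρ hu
  · simpa [hn] using h.n_le τ ρ hu
lemma Cor.w_le (h : Cor n w x s c) (σ τ ρ τ' ρ') {v : V} (hv : v ∈ s) (hn : n v = n (c σ τ ρ)) :
    Cov.sg τ' w v ≤ Cov.sg τ' w (c σ τ' ρ') :=
  (mem_face.1 (face_subset (h σ τ' ρ'))).2 v (h.mem_n σ τ ρ hv hn)
lemma Cor.w_eq (h : Cor n w x s c) (σ τ ρ ρ') : w (c σ τ ρ) = w (c σ τ ρ') := by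
  have := face_eq (face_subset (h σ τ ρ)) (face_subset (h σ τ ρ'))
  cases τ <;> simpa using this
lemma Cor.x_le (h : Cor n w x s c) (σ τ ρ ρ') {v : V} (hv : v ∈ s) (hn : n v = n (c σ τ ρ))
    (hw : w v = w (c σ τ ρ)) : Cov.sg ρ' x v ≤ Cov.sg ρ' x (c σ τ ρ') := by
  refine (mem_face.1 (h σ τ ρ')).2 v ?_
  rw [mem_face]
  refine ⟨h.mem_n σ τ ρ hv hn, fun u hu => ?_⟩
  have := (mem_face.1 (face_subset (h σ τ ρ))).2 u hu
  cases τ <;> simpa [hw] using this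

def wd (w : V →ₗ[ℝ] ℝ) (c : C3 V) (σ : Bool) : ℝ := w (c σ true true) - w (c σ false true)
def ln (x : V →ₗ[ℝ] ℝ) (c : C3 V) (σ τ : Bool) : ℝ := x (c σ τ true) - x (c σ τ false)

lemma Cor.wd_nonneg (h : Cor n w x s c) (σ) : 0 ≤ wd w c σ := by
  have := h.w_le σ false true true true (h.mem σ false true) rfl
  simp at this
  unfold wd; linarith
lemma Cor.ln_nonneg (h : Cor n w x s c) (σ τ) : 0 ≤ ln x c σ τ := by
  have := h.x_le σ τ false true (h.mem σ τ false) rfl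
  simp at this
  unfold ln; linarith

lemma Cor.ln_eq_of_wd (h : Cor n w x s c) (σ) (hw : wd w c σ = 0) (τ τ') : ln x c σ τ = ln x c σ τ' := by
  have e : ∀ τ τ', w (c σ τ true) = w (c σ τ' true) := by
    unfold wd at hw
    intro τ τ'
    cases τ <;> cases τ' <;> linarith
  have key : ∀ τ τ' ρ, Cov.sg ρ x (c σ τ ρ) ≤ Cov.sg ρ x (c σ τ' ρ) := by
    intro τ τ' ρ
    apply h.x_le σ τ' ρ ρ (h.mem _ _ _) (h.n_eq _ _ _ _ _)
    rw [h.w_eq σ τ ρ true, h.w_eq σ τ' ρ true, e]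
  have h1 := key τ τ' true
  have h2 := key τ' τ true
  have h3 := key τ τ' false
  have h4 := key τ' τ false
  simp at h1 h2 h3 h4
  unfold ln; linarith

lemma Cor.eq_of_ln (F : Frame n w x) (h : Cor n w x s c) (σ τ) (hl : ln x c σ τ = 0) (ρ ρ') :
    c σ τ ρ = c σ τ ρ' := by
  rw [← sub_eq_zero]
  apply F <;> rw [map_sub, sub_eq_zero]
  · exact h.n_eq _ _ _ _ _
  · exact h.w_eq _ _ _ _
  · unfold ln at hl
    cases ρ <;> cases ρ' <;> linarith

def cneg (c : C3 V) : C3 V := fun σ τ ρ => - c (!σ) (!τ) (!ρ)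

lemma cneg_cneg (c : C3 V) : cneg (cneg c) = c := by
  funext σ τ ρ; simp [cneg]

lemma Cor.neg {t : Finset V} (h : Cor n w x s c) (hst : ∀ v, v ∈ t ↔ -v ∈ s) : Cor n w x t (cneg c) := by
  intro σ τ ρ
  rw [mem_face3_st hst]
  have := h (!σ) (!τ) (!ρ)
  simpa [cneg, sg_not] using this

lemma ln_neg (σ τ) : ln x (cneg c) σ τ = ln x c (!σ) (!τ) := by
  simp [ln, cneg]; ring

lemma Cor.wd_neg' (h : Cor n w x s c) (σ) : wd w (cneg c) σ = wd w c (!σ) := by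
  simp [wd, cneg, h.w_eq _ _ false true]; ring

lemma Cor.add {K : Type*} [CommRing K] [IsDomain K] (F : Frame n w x) {f g : AddMonoidAlgebra K V} (hf : f ≠ 0) (hg : g ≠ 0)
    {a b : C3 V} (ha : Cor n w x (supp f) a) (hb : Cor n w x (supp g) b) :
    Cor n w x (supp (f * g)) (a + b) := fun σ τ ρ =>
  (face3_mul (F.sg σ τ ρ) hf hg (ha σ τ ρ) (hb σ τ ρ)).1

lemma wd_add (a b : C3 V) (σ) : wd w (a + b) σ = wd w a σ + wd w b σ := by
  simp [wd]; ring
lemma ln_add (a b : C3 V) (σ τ) : ln x (a + b) σ τ = ln x a σ τ + ln x b σ τ := by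
  simp [ln]; ring

structure GF (n w x : V →ₗ[ℝ] ℝ) (F : AddMonoidAlgebra ℝ[X] V) (c : C3 V) (d : ℕ) : Prop where
  g1 : ∀ v ∈ supp F, (F.coeff v).natDegree + 4 ≤ d
  g2 : ∀ v ∈ supp F, (F.coeff v).natDegree + 4 = d → ∃ σ τ ρ, v = c σ τ ρ ∧ 0 < wd w c σ ∧ 0 < ln x c σ τ
  l1 : ∀ σ τ ρ, 0 < wd w c σ → 0 < ln x c σ τ → d ≤ (F.coeff (c σ τ ρ)).natDegree + 4
  l2 : ∀ σ τ ρ, 0 < wd w c σ → 0 < ln x c σ (!τ) → d ≤ (F.coeff (c σ τ ρ)).natDegree + 5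

lemma GF.st {F : AddMonoidAlgebra ℝ[X] V} {d : ℕ} (hc : Cor n w x (supp F) c) (h : GF n w x F c d) :
    GF n w x (Cov.st F) (cneg c) d where
  g1 v hv := by
    rw [st_coeff]; exact h.g1 _ (mem_supp_st.1 hv)
  g2 v hv he := by
    rw [st_coeff] at he
    obtain ⟨σ, τ, ρ, h1, h2, h3⟩ := h.g2 _ (mem_supp_st.1 hv) he
    refine ⟨!σ, !τ, !ρ, ?_, ?_, ?_⟩
    · simp [cneg, ← h1]
    · rw [hc.wd_neg']; simpa using h2
    · rw [ln_neg]; simpa using h3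
  l1 σ τ ρ h1 h2 := by
    rw [hc.wd_neg'] at h1
    rw [ln_neg] at h2
    rw [st_coeff]
    simpa [cneg] using h.l1 _ _ (!ρ) h1 h2
  l2 σ τ ρ h1 h2 := by
    rw [hc.wd_neg'] at h1
    rw [ln_neg] at h2
    rw [st_coeff]
    simpa [cneg] using h.l2 _ (!τ) (!ρ) h1 h2

end FL

section FL
variable {V : Type*} [AddCommGroup V] [Module ℝ V]
open Polynomial

structure Sys (n w x : V →ₗ[ℝ] ℝ) (A B : AddMonoidAlgebra ℝ[X] V) (a b : C3 V) (d : ℕ) : Prop where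
  fr : Frame n w x
  A0 : A ≠ 0
  B0 : B ≠ 0
  ca : Cor n w x (supp A) a
  cb : Cor n w x (supp B) b
  nA : n (a false true true) < n (a true true true)
  nB : n (b false true true) < n (b true true true)
  gp : GF n w x (A * B) (a + b) d
  gq : GF n w x (A * st B) (a + cneg b) d

variable {n w x : V →ₗ[ℝ] ℝ} {A B : AddMonoidAlgebra ℝ[X] V} {a b : C3 V} {d : ℕ}

lemma cneg_add (a b : C3 V) : cneg (a + b) = cneg a + cneg b := by
  funext σ τ ρ; simp [cneg]; abel

lemma Cor.st {F : AddMonoidAlgebra ℝ[X] V} {c : C3 V} (h : Cor n w x (supp F) c) :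
    Cor n w x (supp (Cov.st F)) (cneg c) := h.neg fun v => mem_supp_st

lemma Sys.flip (S : Sys n w x A B a b d) : Sys n w x A (st B) a (cneg b) d where
  fr := S.fr
  A0 := S.A0
  B0 := st_ne_zero S.B0
  ca := S.ca
  cb := S.cb.st
  nA := S.nA
  nB := by
    have := S.nB
    simp only [cneg, map_neg, Bool.not_true, Bool.not_false]
    rw [S.cb.n_eq true false false true true, S.cb.n_eq false false false true true]
    linarith
  gp := S.gq
  gq := by rw [st_st, cneg_cneg]; exact S.gp

lemma Sys.swap (S : Sys n w x A B a b d) : Sys n w x B A b a d where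
  fr := S.fr
  A0 := S.B0
  B0 := S.A0
  ca := S.cb
  cb := S.ca
  nA := S.nB
  nB := S.nA
  gp := by rw [mul_comm, add_comm]; exact S.gp
  gq := by
    have := S.gq.st (S.ca.add S.fr S.A0 (st_ne_zero S.B0) S.cb.st)
    rw [map_mul, st_st, cneg_add, cneg_cneg, mul_comm, add_comm] at this
    exact this

lemma Sys.cp (S : Sys n w x A B a b d) : Cor n w x (supp (A * B)) (a + b) :=
  S.ca.add S.fr S.A0 S.B0 S.cb

lemma Sys.P0 (S : Sys n w x A B a b d) : A * B ≠ 0 := mul_ne_zero S.A0 S.B0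

def HP (w x : V →ₗ[ℝ] ℝ) (c : C3 V) (σ τ : Bool) : Prop := 0 < wd w c σ ∧ 0 < ln x c σ τ
def hv (A : AddMonoidAlgebra ℝ[X] V) (a : C3 V) (σ τ : Bool) : Prop := ∀ ρ, a σ τ ρ ∈ supp (hat A)

lemma dN_attained {F : AddMonoidAlgebra ℝ[X] V} (h : F ≠ 0) :
    ∃ v ∈ supp F, (F.coeff v).natDegree = dN F := by
  obtain ⟨v, hv⟩ := supp_nonempty (hat_ne_zero h)
  exact ⟨v, mem_supp_hat.1 hv⟩

lemma Sys.dN_le (S : Sys n w x A B a b d) : dN (A * B) + 4 ≤ d := by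
  obtain ⟨v, h1, h2⟩ := dN_attained S.P0
  rw [← h2]; exact S.gp.g1 v h1

lemma Sys.flag (S : Sys n w x A B a b d) {σ τ} (h : HP w x (a + b) σ τ) : dN (A * B) + 4 = d := by
  have := S.gp.l1 σ τ true h.1 h.2
  have h2 := le_dN (A * B) ((a + b) σ τ true)
  have := S.dN_le
  omega

lemma Sys.dN_flip (S : Sys n w x A B a b d) : dN (A * st B) = dN (A * B) := by
  rw [dN_mul S.A0 S.B0, dN_mul S.A0 (st_ne_zero S.B0), dN_st]

lemma Sys.deg (S : Sys n w x A B a b d) (σ τ ρ) : ((A * B).coeff ((a + b) σ τ ρ)).natDegree =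
    (A.coeff (a σ τ ρ)).natDegree + (B.coeff (b σ τ ρ)).natDegree := by
  have := (face3_mul (S.fr.sg σ τ ρ) S.A0 S.B0 (S.ca σ τ ρ) (S.cb σ τ ρ)).2
  simp only [Pi.add_apply]
  rw [this, natDegree_mul (mem_supp.1 (S.ca.mem _ _ _)) (mem_supp.1 (S.cb.mem _ _ _))]

lemma Sys.hat_iff (S : Sys n w x A B a b d) (σ τ ρ) : (a + b) σ τ ρ ∈ supp (hat (A * B)) ↔
    a σ τ ρ ∈ supp (hat A) ∧ b σ τ ρ ∈ supp (hat B) := by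
  rw [mem_supp_hat, mem_supp_hat, mem_supp_hat, S.deg, dN_mul S.A0 S.B0]
  have h1 := S.ca.mem σ τ ρ
  have h2 := S.cb.mem σ τ ρ
  have h3 := S.cp.mem σ τ ρ
  have h4 := le_dN A (a σ τ ρ)
  have h5 := le_dN B (b σ τ ρ)
  simp only [h1, h2, h3, true_and]
  omega

lemma Sys.K1 (S : Sys n w x A B a b d) {σ τ} (h : HP w x (a + b) σ τ) : hv A a σ τ ∧ hv B b σ τ := by
  have key : ∀ ρ, (a + b) σ τ ρ ∈ supp (hat (A * B)) := by
    intro ρ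
    rw [mem_supp_hat]
    refine ⟨S.cp.mem _ _ _, ?_⟩
    have := S.gp.l1 σ τ ρ h.1 h.2
    have := S.flag h
    have := le_dN (A * B) ((a + b) σ τ ρ)
    omega
  exact ⟨fun ρ => ((S.hat_iff _ _ _).1 (key ρ)).1, fun ρ => ((S.hat_iff _ _ _).1 (key ρ)).2⟩

lemma Sys.K2 (S : Sys n w x A B a b d) (hfl : dN (A * B) + 4 = d) {v : V} (hv : v ∈ supp (hat (A * B))) :
    ∃ σ τ ρ, v = (a + b) σ τ ρ ∧ HP w x (a + b) σ τ := by
  rw [mem_supp_hat] at hv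
  rw [← hv.2] at hfl
  obtain ⟨σ, τ, ρ, h1, h2, h3⟩ := S.gp.g2 v hv.1 hfl
  exact ⟨σ, τ, ρ, h1, h2, h3⟩

lemma Sys.K2' (S : Sys n w x A B a b d) {σ τ} (h : HP w x (a + b) σ τ) (ρ) :
    (a + b) σ τ ρ ∈ supp (hat (A * B)) := by
  rw [S.hat_iff]; exact ⟨(S.K1 h).1 ρ, (S.K1 h).2 ρ⟩

lemma Sys.nP (S : Sys n w x A B a b d) (τ ρ τ' ρ') : n ((a + b) false τ ρ) < n ((a + b) true τ' ρ') := by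
  rw [S.cp.n_eq false τ ρ true true, S.cp.n_eq true τ' ρ' true true]
  have := S.nA
  have := S.nB
  simp; linarith

lemma Sys.sep (S : Sys n w x A B a b d) {σ τ ρ σ' τ' ρ'} (h : 0 < wd w (a + b) σ')
    (hn : n ((a + b) σ τ ρ) = n ((a + b) σ' τ' ρ')) (hw : w ((a + b) σ τ ρ) = w ((a + b) σ' τ' ρ')) :
    σ = σ' ∧ τ = τ' := by
  have h1 : σ = σ' := by
    cases σ <;> cases σ' <;> try rfl
    · exact absurd hn (S.nP _ _ _ _).ne
    · exact absurd hn (S.nP _ _ _ _).ne'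
  subst h1
  refine ⟨rfl, ?_⟩
  rw [S.cp.w_eq σ τ ρ true, S.cp.w_eq σ τ' ρ' true] at hw
  unfold wd at h
  cases τ <;> cases τ' <;> first | rfl | (exfalso; linarith)

lemma Sys.K4 (S : Sys n w x A B a b d) (hfl : dN (A * B) + 4 = d) {σ τ} (h1 : hv A a σ τ) (h2 : hv B b σ τ) :
    HP w x (a + b) σ τ := by
  obtain ⟨σ', τ', ρ', h3, h4⟩ := S.K2 hfl ((S.hat_iff σ τ true).2 ⟨h1 true, h2 true⟩)
  obtain ⟨rfl, rfl⟩ := S.sep h4.1 (congrArg n h3) (congrArg w h3)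
  exact h4

lemma Sys.K3 (S : Sys n w x A B a b d) {σ τ} (h : HP w x (a + b) σ (!τ)) (h' : ¬ HP w x (a + b) σ τ) :
    ln x a σ τ = 0 ∧ ln x b σ τ = 0 ∧ (hv A a σ τ ∨ hv B b σ τ) := by
  have h0 : ¬ 0 < ln x (a + b) σ τ := fun hc => h' ⟨h.1, hc⟩
  rw [ln_add] at h0
  have ha := S.ca.ln_nonneg σ τ
  have hb := S.cb.ln_nonneg σ τ
  have ha0 : ln x a σ τ = 0 := by linarith
  have hb0 : ln x b σ τ = 0 := by linarith
  refine ⟨ha0, hb0, ?_⟩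
  have h5 := S.gp.l2 σ τ true h.1 h.2
  rw [S.deg, ← S.flag h, dN_mul S.A0 S.B0] at h5
  have h6 := le_dN A (a σ τ true)
  have h7 := le_dN B (b σ τ true)
  have : (A.coeff (a σ τ true)).natDegree = dN A ∨ (B.coeff (b σ τ true)).natDegree = dN B := by omega
  rcases this with h8 | h8
  · left; intro ρ
    rw [S.ca.eq_of_ln S.fr σ τ ha0 ρ true, mem_supp_hat]
    exact ⟨S.ca.mem _ _ _, h8⟩
  · right; intro ρ
    rw [S.cb.eq_of_ln S.fr σ τ hb0 ρ true, mem_supp_hat]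
    exact ⟨S.cb.mem _ _ _, h8⟩

lemma Sys.K5 (S : Sys n w x A B a b d) (hfl : dN (A * B) + 4 = d) (σ) : ∃ τ, HP w x (a + b) σ τ := by
  by_contra hcon
  push Not at hcon
  have hl : ∀ v ∈ supp (hat (A * B)), n v = n ((a + b) (!σ) true true) := by
    intro v hv
    obtain ⟨σ', τ', ρ', rfl, h4⟩ := S.K2 hfl hv
    have : σ' = !σ := by
      cases σ <;> cases σ' <;> simp <;> exact absurd h4 (hcon _)
    rw [this]; exact S.cp.n_eq _ _ _ _ _
  have hAh := hat_ne_zero S.A0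
  have hBh := hat_ne_zero S.B0
  obtain ⟨u, hu⟩ := supp_nonempty hAh
  obtain ⟨v, hv⟩ := supp_nonempty hBh
  have e := hat_mul S.A0 S.B0
  have fA : ∀ u' ∈ supp (hat A), n u' = n u := fun u' hu' => by
    refine flat_of_mul hAh hBh ?_ u' hu' u hu
    rw [← e]; intro p hp q hq; rw [hl p hp, hl q hq]
  have fB : ∀ u' ∈ supp (hat B), n u' = n v := fun u' hu' => by
    refine flat_of_mul hBh hAh ?_ u' hu' v hv
    rw [mul_comm, ← e]; intro p hp q hq; rw [hl p hp, hl q hq]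
  obtain ⟨y, hy⟩ := supp_nonempty (mul_ne_zero hAh hBh)
  have hy' := hl y (by rw [e]; exact hy)
  obtain ⟨u1, hu1, v1, hv1, rfl⟩ := supp_mul hy
  rw [map_add, fA _ hu1, fB _ hv1] at hy'
  have S' := S.flip
  have e' := hat_mul S.A0 (st_ne_zero S.B0)
  obtain ⟨z, hz⟩ := supp_nonempty (mul_ne_zero hAh (hat_ne_zero (st_ne_zero S.B0)))
  obtain ⟨σ', τ', ρ', hz', h4⟩ := S'.K2 (by rw [S.dN_flip]; exact hfl) (by rw [e']; exact hz)
  obtain ⟨u2, hu2, v2, hv2, rfl⟩ := supp_mul hz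
  rw [hat_st, mem_supp_st] at hv2
  have h5 := congrArg n hz'
  have h6 := fB _ hv2
  rw [map_neg] at h6
  rw [map_add, fA _ hu2, Pi.add_apply, Pi.add_apply, Pi.add_apply, map_add, cneg, map_neg,
    S.ca.n_eq _ _ _ true true, S.cb.n_eq _ _ _ true true] at h5
  rw [Pi.add_apply, Pi.add_apply, Pi.add_apply, map_add] at hy'
  have q1 := S.nA
  have q2 := S.nB
  have q3 := S.ca.n_le true true (mem_supp_hat.1 hu).1
  have q4 := S.ca.le_n true true (mem_supp_hat.1 hu).1
  have q5 := S.cb.n_le true true (mem_supp_hat.1 hv).1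
  have q6 := S.cb.le_n true true (mem_supp_hat.1 hv).1
  cases σ <;> cases σ' <;> simp at h5 hy' <;> linarith

lemma Sys.K6 (S : Sys n w x A B a b d) {σ τ} (h : HP w x (a + b) σ τ) (h1 : hv A a σ (!τ))
    (h2 : ¬ hv B b σ (!τ)) : wd w a σ = 0 := by
  have hfl := S.flag h
  have hAh := hat_ne_zero S.A0
  have hBh := hat_ne_zero S.B0
  have e := hat_mul S.A0 S.B0
  have hlev : ∀ v ∈ supp (inn (sg σ n) (hat (A * B))), w v = w ((a + b) σ τ true) := by
    intro v hv
    rw [supp_inn, mem_face] at hv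
    have hvn := hv.2 _ (S.K2' h true)
    obtain ⟨σ', τ', ρ', rfl, h4⟩ := S.K2 hfl hv.1
    have hσ : σ' = σ := by
      have h5 := S.nP τ' ρ' τ true
      have h6 := S.nP τ true τ' ρ'
      cases σ <;> cases σ' <;> try rfl
      · rw [sg_false, LinearMap.neg_apply, LinearMap.neg_apply] at hvn; linarith
      · rw [sg_true] at hvn; linarith
    subst hσ
    have hτ : τ' = τ := by
      by_contra hne
      have : τ' = !τ := by cases τ <;> cases τ' <;> simp_all
      subst this
      exact h2 (S.K1 h4).2
    subst hτ
    exact S.cp.w_eq _ _ _ _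
  rw [e, inn_mul _ hAh hBh] at hlev
  have hmem : ∀ τ', hv A a σ τ' → a σ τ' true ∈ supp (inn (sg σ n) (hat A)) := by
    intro τ' h'
    rw [supp_inn, mem_face]
    refine ⟨h' true, fun u hu => ?_⟩
    cases σ
    · simpa using S.ca.le_n τ' true (mem_supp_hat.1 hu).1
    · simpa using S.ca.n_le τ' true (mem_supp_hat.1 hu).1
  have := flat_of_mul (φ := w) (inn_ne_zero hAh) (inn_ne_zero hBh)
    (fun u hu v hv => by rw [hlev u hu, hlev v hv]) _ (hmem _ h1) _ (hmem _ (S.K1 h).1)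
  unfold wd
  cases τ <;> simp at this <;> linarith

lemma Sys.C1 (S : Sys n w x A B a b d) (hfl : dN (A * B) + 4 = d) {σ τ} (h : ¬ hv B b σ τ) :
    wd w a σ = 0 ∧ ∀ τ', ln x a σ τ' = 0 := by
  have h0 : ¬ HP w x (a + b) σ τ := fun hc => h (S.K1 hc).2
  have h1 : HP w x (a + b) σ (!τ) := by
    obtain ⟨τ', h'⟩ := S.K5 hfl σ
    have : τ' = !τ := by cases τ <;> cases τ' <;> simp_all
    rwa [this] at h'
  obtain ⟨k1, k2, k3⟩ := S.K3 h1 h0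
  have k4 := k3.resolve_right h
  have k5 := S.K6 h1 (by simpa using k4) (by simpa using h)
  exact ⟨k5, fun τ' => by rw [S.ca.ln_eq_of_wd σ k5 τ' τ, k1]⟩

lemma hv_st {σ τ} : hv (st B) (cneg b) σ τ ↔ hv B b (!σ) (!τ) := by
  unfold hv
  rw [hat_st]
  constructor
  · intro h ρ
    have := h (!ρ)
    rw [mem_supp_st] at this
    simpa [cneg] using this
  · intro h ρ
    rw [mem_supp_st]
    simpa [cneg] using h (!ρ)

end FL

section FL
variable {V : Type*} [AddCommGroup V] [Module ℝ V]
open Polynomial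
variable {n w x : V →ₗ[ℝ] ℝ} {A B : AddMonoidAlgebra ℝ[X] V} {a b : C3 V} {d : ℕ}

lemma Cor.lin_eq {s : Finset V} {c : C3 V} (h : Cor n w x s c) (α β : ℝ) (σ τ ρ ρ') :
    (α • n + β • w) (c σ τ ρ) = (α • n + β • w) (c σ τ ρ') := by
  simp only [LinearMap.add_apply, LinearMap.smul_apply]
  rw [h.n_eq σ τ ρ τ ρ', h.w_eq σ τ ρ ρ']

lemma Sys.face_iff (S : Sys n w x A B a b d) {σ1 τ1 : Bool} (h1 : HP w x (a + b) σ1 τ1)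
    {α β : ℝ} (hm : ∀ σ τ, HP w x (a + b) σ τ →
      (α • n + β • w) ((a + b) σ τ true) ≤ (α • n + β • w) ((a + b) σ1 τ1 true)) (v : V) :
    v ∈ face (α • n + β • w) (supp (hat A * hat B)) ↔ ∃ σ τ ρ, HP w x (a + b) σ τ ∧ v = (a + b) σ τ ρ ∧
      (α • n + β • w) ((a + b) σ τ true) = (α • n + β • w) ((a + b) σ1 τ1 true) := by
  rw [← hat_mul S.A0 S.B0]
  set φ := α • n + β • w with hφ
  have hfl := S.flag h1
  constructor
  · intro hv
    rw [mem_face] at hv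
    obtain ⟨σ, τ, ρ, rfl, h4⟩ := S.K2 hfl hv.1
    refine ⟨σ, τ, ρ, h4, rfl, le_antisymm (hm _ _ h4) ?_⟩
    have := hv.2 _ (S.K2' h1 true)
    rwa [hφ, S.cp.lin_eq α β σ τ ρ true] at this
  · rintro ⟨σ, τ, ρ, h4, rfl, h5⟩
    rw [mem_face]
    refine ⟨S.K2' h4 ρ, fun u hu => ?_⟩
    obtain ⟨σ', τ', ρ', rfl, h6⟩ := S.K2 hfl hu
    rw [hφ, S.cp.lin_eq α β σ τ ρ true, S.cp.lin_eq α β σ' τ' ρ' true, ← hφ, h5]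
    exact hm _ _ h6

lemma Sys.edge (S : Sys n w x A B a b d) {σ1 τ1 σ2 τ2 : Bool} (h1 : HP w x (a + b) σ1 τ1)
    (h2 : HP w x (a + b) σ2 τ2) {α β γ δ : ℝ} (F : Frame (α • n + β • w) (γ • n + δ • w) x)
    (he : (α • n + β • w) ((a + b) σ1 τ1 true) = (α • n + β • w) ((a + b) σ2 τ2 true))
    (hm : ∀ σ τ, HP w x (a + b) σ τ → ¬ (σ = σ1 ∧ τ = τ1) → ¬ (σ = σ2 ∧ τ = τ2) →
      (α • n + β • w) ((a + b) σ τ true) < (α • n + β • w) ((a + b) σ1 τ1 true))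
    (ha : (γ • n + δ • w) (a σ2 τ2 true) < (γ • n + δ • w) (a σ1 τ1 true))
    (hb : (γ • n + δ • w) (b σ2 τ2 true) < (γ • n + δ • w) (b σ1 τ1 true)) :
    ln x a σ1 τ1 = ln x a σ2 τ2 := by
  obtain ⟨A1, B1⟩ := S.K1 h1
  obtain ⟨A2, B2⟩ := S.K1 h2
  have hm' : ∀ σ τ, HP w x (a + b) σ τ →
      (α • n + β • w) ((a + b) σ τ true) ≤ (α • n + β • w) ((a + b) σ1 τ1 true) := by
    intro σ τ h
    by_cases c1 : σ = σ1 ∧ τ = τ1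
    · rw [c1.1, c1.2]
    by_cases c2 : σ = σ2 ∧ τ = τ2
    · rw [c2.1, c2.2, he]
    exact (hm σ τ h c1 c2).le
  have g1 := S.cp.lin_eq γ δ σ1 τ1 true false
  have g2 := S.cp.lin_eq γ δ σ2 τ2 true false
  have l1 := h1.2
  have l2 := h2.2
  unfold ln at l1 l2
  refine Edge F (A1 true) (A1 false) (A2 true) (A2 false) (B1 true) (B1 false) (B2 true) (B2 false)
    ?_ g1 g2 (by simpa using l1) (by simpa using l2) ha hb
  intro v
  rw [S.face_iff h1 hm']
  constructor
  · rintro ⟨σ, τ, ρ, h, rfl, h5⟩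
    by_cases c1 : σ = σ1 ∧ τ = τ1
    · rw [c1.1, c1.2]
      cases ρ <;> simp
    by_cases c2 : σ = σ2 ∧ τ = τ2
    · rw [c2.1, c2.2]
      cases ρ <;> simp
    exact absurd h5 (hm σ τ h c1 c2).ne
  · rintro (rfl | rfl | rfl | rfl)
    · exact ⟨σ1, τ1, true, h1, rfl, rfl⟩
    · exact ⟨σ1, τ1, false, h1, rfl, rfl⟩
    · exact ⟨σ2, τ2, true, h2, rfl, he.symm⟩
    · exact ⟨σ2, τ2, false, h2, rfl, he.symm⟩

lemma Sys.edgeN (S : Sys n w x A B a b d) {τ1 τ2 : Bool} (h1 : HP w x (a + b) true τ1)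
    (h2 : HP w x (a + b) false τ2) {α β : ℝ} (hβ : β ≠ 0)
    (he : (α • n + β • w) ((a + b) true τ1 true) = (α • n + β • w) ((a + b) false τ2 true))
    (hm : ∀ σ τ, HP w x (a + b) σ τ → ¬ (σ = true ∧ τ = τ1) → ¬ (σ = false ∧ τ = τ2) →
      (α • n + β • w) ((a + b) σ τ true) < (α • n + β • w) ((a + b) true τ1 true)) :
    ln x a true τ1 = ln x a false τ2 := by
  refine S.edge h1 h2 (γ := 1) (δ := 0) ?_ he hm ?_ ?_
  · intro v h1 h2 h3
    have hn : n v = 0 := by simpa using h2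
    have hw : w v = 0 := by simpa [hn, hβ] using h1
    exact S.fr v hn hw h3
  · have := S.nA
    rw [S.ca.n_eq false true true τ2 true, S.ca.n_eq true true true τ1 true] at this
    simpa using this
  · have := S.nB
    rw [S.cb.n_eq false true true τ2 true, S.cb.n_eq true true true τ1 true] at this
    simpa using this

lemma exists_slope {p q r s : ℝ} (h : p ≠ q) : ∃ μ : ℝ, r + μ * p = s + μ * q := by
  refine ⟨(s - r) / (p - q), ?_⟩
  have := sub_ne_zero.2 h
  field_simp
  ring

lemma Sys.nP' (S : Sys n w x A B a b d) (σ τ ρ τ' ρ') : n ((a + b) σ τ ρ) ≠ n ((a + b) (!σ) τ' ρ') := by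
  cases σ
  · exact (S.nP _ _ _ _).ne
  · exact (S.nP _ _ _ _).ne'

lemma Sys.tri (S : Sys n w x A B a b d) {σ τ} (h0 : ¬ HP w x (a + b) σ τ) (hwb : wd w b (!σ) = 0)
    (h1 : HP w x (a + b) (!σ) true) (h2 : HP w x (a + b) (!σ) false) : False := by
  have hfl := S.flag h1
  have h3 : HP w x (a + b) σ (!τ) := by
    obtain ⟨τ', h'⟩ := S.K5 hfl σ
    have : τ' = !τ := by cases τ <;> cases τ' <;> simp_all
    rwa [this] at h'
  have hw := h1.1
  unfold wd at hw hwb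
  have key : ∀ (τ' : Bool) (μ ε : ℝ), w ((a + b) σ (!τ) true) + μ * n ((a + b) σ (!τ) true) =
      w ((a + b) (!σ) τ' true) + μ * n ((a + b) (!σ) τ' true) →
      ε * w ((a + b) (!σ) (!τ') true) < ε * w ((a + b) (!σ) τ' true) → ε ≠ 0 →
      HP w x (a + b) (!σ) τ' →
      w (b σ (!τ) true) + μ * n (b σ (!τ) true) = w (b (!σ) τ' true) + μ * n (b (!σ) τ' true) := by
    intro τ' μ ε he hlt hε hP
    have hn := S.cp.n_eq (!σ) τ' true (!τ') true
    have hm : ∀ σ'' τ'', HP w x (a + b) σ'' τ'' → ((ε * μ) • n + ε • w) ((a + b) σ'' τ'' true) ≤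
        ((ε * μ) • n + ε • w) ((a + b) σ (!τ) true) := by
      intro σ'' τ'' h''
      have : (σ'' = σ ∧ τ'' = !τ) ∨ (σ'' = !σ ∧ τ'' = τ') ∨ (σ'' = !σ ∧ τ'' = !τ') := by
        clear he hlt hn hP hw hwb h1 h2 h3
        cases σ <;> cases σ'' <;> cases τ <;> cases τ'' <;> cases τ' <;> simp_all
      simp only [LinearMap.add_apply, LinearMap.smul_apply, smul_eq_mul]
      rcases this with ⟨rfl, rfl⟩ | ⟨rfl, rfl⟩ | ⟨rfl, rfl⟩
      · rfl
      · linear_combination (-ε) * he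
      · rw [← hn]; linarith [congrArg (fun t => ε * t) he]
    have f1 := (S.face_iff h3 hm ((a + b) σ (!τ) true)).2 ⟨_, _, _, h3, rfl, rfl⟩
    have f2 := (S.face_iff h3 hm ((a + b) (!σ) τ' true)).2 ⟨_, _, _, hP, rfl, by
      simp only [LinearMap.add_apply, LinearMap.smul_apply, smul_eq_mul]
      linear_combination (-ε) * he⟩
    have g1 := (face_of_add ((S.K1 h3).1 true) ((S.K1 h3).2 true) f1).2
    have g2 := (face_of_add ((S.K1 hP).1 true) ((S.K1 hP).2 true) f2).2
    have := face_eq g1 g2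
    simp only [LinearMap.add_apply, LinearMap.smul_apply, smul_eq_mul] at this
    apply mul_left_cancel₀ hε
    linear_combination this
  obtain ⟨μ1, e1⟩ := exists_slope (S.nP' σ (!τ) true true true)
    (r := w ((a + b) σ (!τ) true)) (s := w ((a + b) (!σ) true true))
  obtain ⟨μ2, e2⟩ := exists_slope (S.nP' σ (!τ) true false true)
    (r := w ((a + b) σ (!τ) true)) (s := w ((a + b) (!σ) false true))
  have k1 := key true μ1 1 e1 (by simp only [Bool.not_true]; linarith) one_ne_zero h1
  have k2 := key false μ2 (-1) e2 (by simp only [Bool.not_false]; linarith) (by norm_num) h2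
  have nb := S.cb.n_eq (!σ) true true false true
  have nb' := S.cp.n_eq (!σ) true true false true
  have hne : n (b σ (!τ) true) ≠ n (b (!σ) true true) := by
    have q := S.nB
    cases σ
    · rw [S.cb.n_eq false true true (!τ) true] at q; exact q.ne
    · rw [S.cb.n_eq true true true (!τ) true] at q; exact q.ne'
  have hμ : μ1 = μ2 := by
    have : (μ1 - μ2) * (n (b σ (!τ) true) - n (b (!σ) true true)) = 0 := by
      rw [← nb] at k2
      linear_combination k1 - k2 + hwb
    rcases mul_eq_zero.1 this with h | h
    · linarith
    · exact absurd (by linarith) hne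
  subst hμ
  rw [← nb'] at e2
  linarith

lemma Sys.C2 (S : Sys n w x A B a b d) (hfl : dN (A * B) + 4 = d) (hB : ∀ σ τ, hv B b σ τ) {σ τ}
    (h : ¬ hv A a σ τ) : (∀ σ, wd w b σ = 0) ∧
      |ln x a true true - ln x a false false| = |ln x a true false - ln x a false true| := by
  have hwb : ∀ σ, wd w b σ = 0 := by
    have h1 := (S.swap.C1 (by rw [mul_comm]; exact hfl) h).1
    have h2 := (S.flip.swap.C1 (by rw [mul_comm, S.dN_flip]; exact hfl) h).1
    rw [S.cb.wd_neg'] at h2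
    intro σ'
    cases σ <;> cases σ' <;> simp_all
  refine ⟨hwb, ?_⟩
  have iff : ∀ σ τ, HP w x (a + b) σ τ ↔ hv A a σ τ := fun σ τ =>
    ⟨fun h => (S.K1 h).1, fun h => S.K4 hfl h (hB _ _)⟩
  have hnP : ¬ HP w x (a + b) σ τ := by rw [iff]; exact h
  have hz : ∀ σ τ, ¬ HP w x (a + b) σ τ → ln x a σ τ = 0 := by
    intro σ τ hn
    obtain ⟨τ', h'⟩ := S.K5 hfl σ
    have : τ' = !τ := by cases τ <;> cases τ' <;> simp_all
    rw [this] at h'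
    exact (S.K3 h' hn).1
  have hlev : ∀ σ, ∃ τ, ¬ HP w x (a + b) σ τ := by
    intro σ'
    by_cases hs : σ' = σ
    · exact ⟨τ, hs ▸ hnP⟩
    · have : σ' = !σ := by cases σ <;> cases σ' <;> simp_all
      subst this
      by_contra hc
      push Not at hc
      exact S.tri hnP (hwb _) (hc true) (hc false)
  obtain ⟨t1, n1⟩ := hlev true
  obtain ⟨t2, n2⟩ := hlev false
  have flipH : ∀ σ t, ¬ HP w x (a + b) σ t → HP w x (a + b) σ (!t) := by
    intro σ t hn
    obtain ⟨τ', h'⟩ := S.K5 hfl σ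
    have : τ' = !t := by cases t <;> cases τ' <;> simp_all
    rwa [this] at h'
  have p1 := flipH _ _ n1
  have p2 := flipH _ _ n2
  obtain ⟨μ, e⟩ := exists_slope (S.nP (!t2) true (!t1) true).ne'
    (r := w ((a + b) true (!t1) true)) (s := w ((a + b) false (!t2) true))
  have key := S.edgeN p1 p2 (α := μ) (β := 1) one_ne_zero
    (by simp only [LinearMap.add_apply, LinearMap.smul_apply, smul_eq_mul]; linarith)
    (by
      intro σ' τ' h' q1 q2
      exfalso
      cases σ' <;> cases τ' <;> cases t1 <;> cases t2 <;> simp_all)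
  have z1 := hz _ _ n1
  have z2 := hz _ _ n2
  cases t1 <;> cases t2 <;> simp only [Bool.not_true, Bool.not_false] at key <;>
    rw [z1, z2, key] <;> simp

lemma Sys.case3 (S : Sys n w x A B a b d) (hfl : dN (A * B) + 4 = d) (hA : ∀ σ τ, hv A a σ τ)
    (hB : ∀ σ τ, hv B b σ τ) : (∀ τ, ln x a true τ = ln x a false τ) ∧
      ∀ σ, 0 < wd w b σ → ln x a σ true = ln x a σ false := by
  have H : ∀ σ τ, HP w x (a + b) σ τ := fun σ τ => S.K4 hfl (hA _ _) (hB _ _)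
  constructor
  · intro τ
    obtain ⟨μ, e⟩ := exists_slope (S.nP τ true τ true).ne'
      (r := w ((a + b) true τ true)) (s := w ((a + b) false τ true))
    have w1 := (H true true).1
    have w2 := (H false true).1
    unfold wd at w1 w2
    have n1 := S.cp.n_eq true true true false true
    have n2 := S.cp.n_eq false true true false true
    cases τ
    · refine S.edgeN (H _ _) (H _ _) (α := -μ) (β := -1) (by norm_num) ?_ ?_
      · simp only [LinearMap.add_apply, LinearMap.smul_apply, smul_eq_mul]; linarith
      · intro σ' τ' h' q1 q2
        simp only [LinearMap.add_apply, LinearMap.smul_apply, smul_eq_mul]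
        cases σ' <;> cases τ' <;> simp at q1 q2
        · rw [n2]; linarith
        · rw [n1]; linarith
    · refine S.edgeN (H _ _) (H _ _) (α := μ) (β := 1) (by norm_num) ?_ ?_
      · simp only [LinearMap.add_apply, LinearMap.smul_apply, smul_eq_mul]; linarith
      · intro σ' τ' h' q1 q2
        simp only [LinearMap.add_apply, LinearMap.smul_apply, smul_eq_mul]
        cases σ' <;> cases τ' <;> simp at q1 q2
        · rw [← n2]; linarith
        · rw [← n1]; linarith
  · intro σ hb
    rcases (S.ca.wd_nonneg σ).eq_or_lt with h0 | h0
    · exact S.ca.ln_eq_of_wd σ h0.symm _ _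
    · unfold wd at h0 hb
      cases σ
      · refine S.edge (H _ _) (H _ _) (α := -1) (β := 0) (γ := 0) (δ := 1) ?_ ?_ ?_ ?_ ?_
        · intro v h1 h2 h3
          exact S.fr v (by simpa using h1) (by simpa using h2) h3
        · have := S.cp.n_eq false true true false true
          simp only [LinearMap.add_apply, LinearMap.smul_apply, smul_eq_mul]; linarith
        · intro σ' τ' _ q1 q2
          cases σ' <;> cases τ' <;> simp at q1 q2
          · have := S.nP true true false true
            simp only [LinearMap.add_apply, LinearMap.smul_apply, smul_eq_mul]; linarith
          · have := S.nP true true true true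
            simp only [LinearMap.add_apply, LinearMap.smul_apply, smul_eq_mul]; linarith
        · simpa using h0
        · simpa using hb
      · refine S.edge (H _ _) (H _ _) (α := 1) (β := 0) (γ := 0) (δ := 1) ?_ ?_ ?_ ?_ ?_
        · intro v h1 h2 h3
          exact S.fr v (by simpa using h1) (by simpa using h2) h3
        · simpa using S.cp.n_eq true true true false true
        · intro σ' τ' _ q1 q2
          cases σ' <;> cases τ' <;> simp at q1 q2
          · simpa using S.nP false true true true
          · simpa using S.nP true true true true
        · simpa using h0
        · simpa using hb

theorem Sys.FL (S : Sys n w x A B a b d) :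
    |ln x a true true - ln x a false false| = |ln x a true false - ln x a false true| ∧
    ((0 < wd w b true ∨ 0 < wd w b false) →
      ln x a true true = ln x a false false ∧ ln x a true false = ln x a false true) := by
  by_cases hfl : dN (A * B) + 4 = d
  · by_cases hB : ∀ σ τ, hv B b σ τ
    · by_cases hA : ∀ σ τ, hv A a σ τ
      · obtain ⟨h1, h2⟩ := S.case3 hfl hA hB
        have e1 := h1 true
        have e2 := h1 false
        refine ⟨?_, ?_⟩
        · rw [e1, e2, abs_sub_comm]
        · rintro (h | h)
          · have := h2 _ h
            constructor <;> linarith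
          · have := h2 _ h
            constructor <;> linarith
      · push Not at hA
        obtain ⟨σ, τ, hA⟩ := hA
        obtain ⟨h1, h2⟩ := S.C2 hfl hB hA
        refine ⟨h2, ?_⟩
        rintro (h | h) <;> exact absurd (h1 _) h.ne'
    · push Not at hB
      obtain ⟨σ, τ, hB⟩ := hB
      have h1 := (S.C1 hfl hB).2
      have h2 := (S.flip.C1 (by rw [S.dN_flip]; exact hfl) (σ := !σ) (τ := !τ)
        (by rw [hv_st]; simpa using hB)).2
      have : ∀ σ τ, ln x a σ τ = 0 := by
        intro σ' τ'
        cases σ <;> cases σ' <;> first | exact h1 τ' | exact h2 τ'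
      simp [this]
  · have np : ∀ σ τ, 0 < wd w (a + b) σ → ln x (a + b) σ τ = 0 := by
      intro σ τ h
      by_contra hc
      have : HP w x (a + b) σ τ := ⟨h, lt_of_le_of_ne (S.cp.ln_nonneg _ _) (Ne.symm hc)⟩
      exact hfl (S.flag this)
    have nq : ∀ σ τ, 0 < wd w (a + cneg b) σ → ln x (a + cneg b) σ τ = 0 := by
      intro σ τ h
      by_contra hc
      have : HP w x (a + cneg b) σ τ := ⟨h, lt_of_le_of_ne (S.flip.cp.ln_nonneg _ _) (Ne.symm hc)⟩
      exact hfl (S.dN_flip ▸ S.flip.flag this)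
    simp only [wd_add, ln_add] at np nq
    have q1 := fun σ τ => S.ca.ln_nonneg σ τ
    have q2 := fun σ τ => S.cb.ln_nonneg σ τ
    have q2' := fun σ τ => S.cb.st.ln_nonneg σ τ
    have q3 := fun σ => S.ca.wd_nonneg σ
    have q4 := fun σ => S.cb.wd_nonneg σ
    have q4' := fun σ => S.cb.st.wd_nonneg σ
    have e : ∀ σ, ln x a σ true = ln x a σ false := by
      intro σ
      rcases (S.ca.wd_nonneg σ).eq_or_lt with h0 | h0
      · exact S.ca.ln_eq_of_wd σ h0.symm _ _
      · have := np σ true (by linarith [q4 σ])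
        have := np σ false (by linarith [q4 σ])
        linarith [q1 σ true, q1 σ false, q2 σ true, q2 σ false]
    refine ⟨?_, ?_⟩
    · rw [e true, e false]
    · intro h
      have z : ∀ σ τ, 0 < wd w b σ → ln x a σ τ = 0 ∧ ln x a (!σ) τ = 0 := by
        intro σ τ h
        have h1 := np σ τ (by linarith [q3 σ])
        have h2 := nq (!σ) τ (by
          rw [S.cb.wd_neg', Bool.not_not]; linarith [q3 (!σ)])
        constructor
        · linarith [q1 σ τ, q2 σ τ]
        · linarith [q1 (!σ) τ, q2' (!σ) τ]
      rcases h with h | h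
      · have h1 := z _ true h
        have h2 := z _ false h
        simp only [Bool.not_true] at h1 h2
        constructor <;> linarith
      · have h1 := z _ true h
        have h2 := z _ false h
        simp only [Bool.not_false] at h1 h2
        constructor <;> linarith

end FL

section KL
variable {V : Type*} [AddCommGroup V] [Module ℝ V]
open Filter Topology

def Cst (φ : V →ₗ[ℝ] ℝ) (s : Finset V) : Prop := ∀ u ∈ s, ∀ v ∈ s, φ u = φ v

lemma lexpert (n w : V →ₗ[ℝ] ℝ) (s : Finset V) :
    ∀ᶠ ε in 𝓝[>] (0:ℝ), face (n + ε • w) s = face w (face n s) := by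
  have h1 : ∀ u ∈ s, ∀ v ∈ s, ∀ᶠ ε in 𝓝[>] (0:ℝ), n u < n v → n u + ε * w u < n v + ε * w v := by
    intro u hu v hv
    by_cases h : n u < n v
    · have : Tendsto (fun ε : ℝ => (n v + ε * w v) - (n u + ε * w u)) (𝓝[>] 0) (𝓝 ((n v + 0 * w v) - (n u + 0 * w u))) := by
        apply Tendsto.mono_left _ nhdsWithin_le_nhds
        apply Continuous.tendsto (by fun_prop) (0:ℝ)
      have := this.eventually (lt_mem_nhds (a := 0) (by simpa using h))
      filter_upwards [this] with ε hε _
      linarith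
    · exact Eventually.of_forall fun _ hc => absurd hc h
  have h2 : ∀ᶠ ε in 𝓝[>] (0:ℝ), ∀ u ∈ s, ∀ v ∈ s, n u < n v → n u + ε * w u < n v + ε * w v := by
    rw [Filter.eventually_all_finset]
    intro u hu
    rw [Filter.eventually_all_finset]
    intro v hv
    exact h1 u hu v hv
  filter_upwards [h2, self_mem_nhdsWithin] with ε hε hpos
  have hpos : 0 < ε := hpos
  ext v
  rw [mem_face, mem_face, mem_face]
  simp only [LinearMap.add_apply, LinearMap.smul_apply, smul_eq_mul]
  constructor
  · rintro ⟨hv, hm⟩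
    have hn : ∀ u ∈ s, n u ≤ n v := by
      intro u hu
      by_contra hc
      push Not at hc
      linarith [hm u hu, hε v hv u hu hc]
    refine ⟨⟨hv, hn⟩, fun u hu => ?_⟩
    rw [mem_face] at hu
    have e : n u = n v := le_antisymm (hn u hu.1) (hu.2 v hv)
    have := hm u hu.1
    rw [e] at this
    nlinarith
  · rintro ⟨⟨hv, hn⟩, hw⟩
    refine ⟨hv, fun u hu => ?_⟩
    rcases (hn u hu).lt_or_eq with h | h
    · exact (hε u hu v hv h).le
    · have := hw u (mem_face.2 ⟨hu, fun z hz => by rw [h]; exact hn z hz⟩)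
      rw [h]
      nlinarith

lemma face_flat {φ : V →ₗ[ℝ] ℝ} {s : Finset V} (h : Cst φ s) : face φ s = s := by
  ext v; rw [mem_face]
  exact ⟨fun h => h.1, fun hv => ⟨hv, fun u hu => (h u hu v hv).le⟩⟩

lemma face_sg_face (τ τ' : Bool) (w : V →ₗ[ℝ] ℝ) (s : Finset V) :
    face (sg τ w) (face (sg τ' w) s) = face (sg τ' w) s := by
  apply face_flat
  intro u hu v hv
  have := face_eq hu hv
  cases τ <;> cases τ' <;> simpa using this

lemma eventually_line (f : ℝ → Prop) (t : ℝ) (h1 : ∀ᶠ ε in 𝓝[>] (0:ℝ), f (t + ε))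
    (h2 : ∀ᶠ ε in 𝓝[>] (0:ℝ), f (t - ε)) (h0 : f t) : ∀ᶠ s in 𝓝 t, f s := by
  have a1 : ∀ᶠ s in 𝓝[>] t, f s := by
    have : Tendsto (fun s => s - t) (𝓝[>] t) (𝓝[>] 0) := by
      apply tendsto_nhdsWithin_of_tendsto_nhds_of_eventually_within
      · apply Tendsto.mono_left _ nhdsWithin_le_nhds
        have : Tendsto (fun s : ℝ => s - t) (𝓝 t) (𝓝 (t - t)) := Continuous.tendsto (by fun_prop) t
        simpa using this
      · filter_upwards [self_mem_nhdsWithin] with s hs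
        have : t < s := hs
        simpa using this
    filter_upwards [this.eventually h1] with s hs
    simpa using hs
  have a2 : ∀ᶠ s in 𝓝[<] t, f s := by
    have : Tendsto (fun s => t - s) (𝓝[<] t) (𝓝[>] 0) := by
      apply tendsto_nhdsWithin_of_tendsto_nhds_of_eventually_within
      · apply Tendsto.mono_left _ nhdsWithin_le_nhds
        have : Tendsto (fun s : ℝ => t - s) (𝓝 t) (𝓝 (t - t)) := Continuous.tendsto (by fun_prop) t
        simpa using this
      · filter_upwards [self_mem_nhdsWithin] with s hs
        have : s < t := hs
        simpa using this
    filter_upwards [this.eventually h2] with s hs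
    simpa using hs
  rw [← nhdsNE_sup_pure, ← nhdsLT_sup_nhdsGT]
  simp only [Filter.eventually_sup]
  exact ⟨⟨a2, a1⟩, by simpa using h0⟩

lemma const_of_local {X : Type*} (f : ℝ → X) (h1 : ∀ t, ∀ᶠ ε in 𝓝[>] (0:ℝ), f (t + ε) = f t)
    (h2 : ∀ t, ∀ᶠ ε in 𝓝[>] (0:ℝ), f (t - ε) = f t) (s t : ℝ) : f s = f t := by
  have : IsLocallyConstant f := by
    rw [IsLocallyConstant.iff_eventually_eq]
    intro t
    exact eventually_line (fun s => f s = f t) t (h1 t) (h2 t) rfl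
  exact this.apply_eq_of_preconnectedSpace s t

def FLP (s r : Finset V) : Prop := ∀ (n w x : V →ₗ[ℝ] ℝ) (a b : C3 V), Frame n w x → Cor n w x s a →
  Cor n w x r b → ¬ Cst n s → ¬ Cst n r →
    |ln x a true true - ln x a false false| = |ln x a true false - ln x a false true| ∧
    ((0 < wd w b true ∨ 0 < wd w b false) →
      ln x a true true = ln x a false false ∧ ln x a true false = ln x a false true)

lemma frame_shear {g m x : V →ₗ[ℝ] ℝ} (F : Frame g m x) (t : ℝ) : Frame (g + t • m) m x := by
  intro v h1 h2 h3
  exact F v (by simpa [h2] using h1) h2 h3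

lemma shear_pos {g m x : V →ₗ[ℝ] ℝ} (F : Frame g m x) (s : Finset V) (t : ℝ) :
    ∀ᶠ ε in 𝓝[>] (0:ℝ), ∀ a a', Cor (g + t • m) m x s a → Cor (g + (t + ε) • m) m x s a' →
      ∀ σ τ ρ, a' σ τ ρ = a σ σ ρ := by
  filter_upwards [lexpert (g + t • m) m s, lexpert (-(g + t • m)) (-m) s] with ε h1 h2 a a' ha ha' σ τ ρ
  have k1 := ha σ σ ρ
  have k2 := ha' σ τ ρ
  apply face3_unique ((frame_shear F t).sg σ σ ρ) _ k1
  have e : face (sg σ (g + (t + ε) • m)) s = face (sg σ m) (face (sg σ (g + t • m)) s) := by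
    cases σ
    · rw [sg_false, sg_false, sg_false, ← h2]; congr 1; module
    · rw [sg_true, sg_true, sg_true, ← h1]; congr 1; module
  unfold face3 at k2 ⊢
  rwa [e, face_sg_face] at k2

lemma shear_neg {g m x : V →ₗ[ℝ] ℝ} (F : Frame g m x) (s : Finset V) (t : ℝ) :
    ∀ᶠ ε in 𝓝[>] (0:ℝ), ∀ a a', Cor (g + t • m) m x s a → Cor (g + (t - ε) • m) m x s a' →
      ∀ σ τ ρ, a' σ τ ρ = a σ (!σ) ρ := by
  filter_upwards [lexpert (g + t • m) (-m) s, lexpert (-(g + t • m)) (m) s] with ε h1 h2 a a' ha ha' σ τ ρ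
  have k1 := ha σ (!σ) ρ
  have k2 := ha' σ τ ρ
  apply face3_unique ((frame_shear F t).sg σ (!σ) ρ) _ k1
  have e : face (sg σ (g + (t - ε) • m)) s = face (sg (!σ) m) (face (sg σ (g + t • m)) s) := by
    cases σ
    · simp only [Bool.not_false]
      rw [sg_false, sg_false, sg_true, ← h2]; congr 1; module
    · simp only [Bool.not_true]
      rw [sg_true, sg_true, sg_false, ← h1]; congr 1; module
  unfold face3 at k2 ⊢
  rwa [e, face_sg_face] at k2

lemma KL0 {s r : Finset V} (hs : s.Nonempty) (hr : r.Nonempty) (H : FLP s r) {g m x : V →ₗ[ℝ] ℝ}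
    (F : Frame g m x) {c : C3 V} (hc : Cor g m x s c) (hne : ln x c true true ≠ ln x c false false)
    (hA : ∀ t : ℝ, ¬ Cst (g + t • m) s) (hB : ∀ t : ℝ, ¬ Cst (g + t • m) r) : Cst m r := by
  choose a ha using fun t : ℝ => exists_cor (g + t • m) m x hs
  choose b hb using fun t : ℝ => exists_cor (g + t • m) m x hr
  have fl := fun t => H _ _ _ _ _ (frame_shear F t) (ha t) (hb t) (hA t) (hB t)
  have D := const_of_local (fun t => |ln x (a t) true true - ln x (a t) false false|) (by
      intro t
      filter_upwards [shear_pos F s t] with ε hε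
      have := hε _ _ (ha t) (ha (t + ε))
      simp only [ln, this]) (by
      intro t
      filter_upwards [shear_neg F s t] with ε hε
      have := hε _ _ (ha t) (ha (t - ε))
      rw [(fl t).1]
      simp only [ln, this, Bool.not_true, Bool.not_false])
  have h0 : ∀ σ τ ρ, a 0 σ τ ρ = c σ τ ρ := by
    intro σ τ ρ
    have := ha 0 σ τ ρ
    rw [zero_smul, add_zero] at this
    exact face3_unique (F.sg σ τ ρ) this (hc σ τ ρ)
  have D' : ∀ t, ln x (a t) true true ≠ ln x (a t) false false := by
    intro t he
    have := D 0 t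
    simp only [he, sub_self, abs_zero, abs_eq_zero, sub_eq_zero] at this
    apply hne
    simp only [ln, h0] at this ⊢
    exact this
  have W : ∀ t, wd m (b t) true = 0 := by
    intro t
    by_contra hw
    have : 0 < wd m (b t) true := lt_of_le_of_ne ((hb t).wd_nonneg _) (Ne.symm hw)
    exact D' t ((fl t).2 (Or.inl this)).1
  have M := const_of_local (fun t => (m (b t true true true))) (by
      intro t
      filter_upwards [shear_pos F r t] with ε hε
      rw [hε _ _ (hb t) (hb (t + ε))]) (by
      intro t
      filter_upwards [shear_neg F r t] with ε hε
      rw [hε _ _ (hb t) (hb (t - ε))]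
      have := W t
      unfold wd at this
      simp only [Bool.not_true]; linarith)
  have G := const_of_local (fun t => (g (b t true true true))) (by
      intro t
      filter_upwards [shear_pos F r t] with ε hε
      rw [hε _ _ (hb t) (hb (t + ε))]) (by
      intro t
      filter_upwards [shear_neg F r t] with ε hε
      rw [hε _ _ (hb t) (hb (t - ε))]
      have := W t
      unfold wd at this
      have h2 := (hb t).n_eq true true true false true
      simp only [LinearMap.add_apply, LinearMap.smul_apply, smul_eq_mul] at h2
      have h3 : m (b t true true true) = m (b t true false true) := by linarith
      rw [h3] at h2
      simp only [Bool.not_true]; linarith)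
  have key : ∀ v ∈ r, m v = m (b 0 true true true) := by
    intro v hv
    by_contra hcon
    have hle : ∀ t : ℝ, g v + t * m v ≤ g (b 0 true true true) + t * m (b 0 true true true) := by
      intro t
      have := (hb t).n_le true true hv
      simp only [LinearMap.add_apply, LinearMap.smul_apply, smul_eq_mul] at this
      have e1 := M t 0
      have e2 := G t 0
      rwa [e1, e2] at this
    have hne : m v - m (b 0 true true true) ≠ 0 := sub_ne_zero.2 hcon
    have := hle ((g (b 0 true true true) - g v + 1) / (m v - m (b 0 true true true)))
    have e : (g (b 0 true true true) - g v + 1) / (m v - m (b 0 true true true)) *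
      (m v - m (b 0 true true true)) = g (b 0 true true true) - g v + 1 := div_mul_cancel₀ _ hne
    linarith
  intro u hu v hv
  rw [key u hu, key v hv]

lemma ln_eq_of_cst {s : Finset V} {n w x : V →ₗ[ℝ] ℝ} {c : C3 V} (hc : Cor n w x s c) (h1 : Cst n s) (h2 : Cst w s) :
    ln x c true true = ln x c false false := by
  have k : ∀ σ τ σ' τ' ρ, sg ρ x (c σ τ ρ) ≤ sg ρ x (c σ' τ' ρ) := fun σ τ σ' τ' ρ =>
    hc.x_le σ' τ' ρ ρ (hc.mem _ _ _) (h1 _ (hc.mem _ _ _) _ (hc.mem _ _ _)) (h2 _ (hc.mem _ _ _) _ (hc.mem _ _ _))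
  have a1 := k true true false false true
  have a2 := k false false true true true
  have a3 := k true true false false false
  have a4 := k false false true true false
  simp at a1 a2 a3 a4
  unfold ln; linarith

theorem KL {s r : Finset V} (hs : s.Nonempty) (hr : r.Nonempty) (H : FLP s r) {n w x : V →ₗ[ℝ] ℝ}
    (F : Frame n w x) {c : C3 V} (hc : Cor n w x s c) (hne : ln x c true true ≠ ln x c false false) :
    ∃ α β : ℝ, (α ≠ 0 ∨ β ≠ 0) ∧ Cst (α • n + β • w) r := by
  have hnot : ¬ (Cst n s ∧ Cst w s) := fun h => hne (ln_eq_of_cst hc h.1 h.2)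
  by_cases hn : Cst n s
  · have hF : Frame w n x := fun v h1 h2 h3 => F v h2 h1 h3
    have hflat : ∀ σ, face (sg σ n) s = s := by
      intro σ
      apply face_flat
      intro u hu v hv
      cases σ <;> simp [hn u hu v hv]
    have hc' : Cor w n x s (fun σ τ ρ => c τ σ ρ) := by
      intro σ τ ρ
      have := hc τ σ ρ
      unfold face3 at this ⊢
      rw [hflat] at this
      rw [face_flat (φ := sg τ n)]
      · exact this
      · intro u hu v hv
        have hnn := hn u (face_subset hu) v (face_subset hv)
        cases τ <;> simp [hnn]
    by_contra hcon
    push Not at hcon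
    refine hcon 1 0 (by simp) ?_
    have := KL0 hs hr H hF hc' hne (fun t ht => hnot ⟨hn, ?_⟩) (fun t ht => hcon t 1 (by simp) ?_)
    · simpa using this
    · intro u hu v hv
      have e := ht u hu v hv
      have e2 := hn u hu v hv
      simp only [LinearMap.add_apply, LinearMap.smul_apply, smul_eq_mul, e2] at e
      linarith
    · convert ht using 1; module
  ·
    have : ∃ α : ℝ, ∀ t : ℝ, ¬ Cst (n + t • (w + α • n)) s := by
      by_cases hex : ∃ α : ℝ, Cst (w + α • n) s
      · obtain ⟨α, hα⟩ := hex
        refine ⟨α, fun t ht => hn ?_⟩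
        intro u hu v hv
        have e1 := hα u hu v hv
        have e2 := ht u hu v hv
        rw [LinearMap.add_apply, LinearMap.add_apply, LinearMap.smul_apply, LinearMap.smul_apply, e1] at e2
        linarith
      · push Not at hex
        refine ⟨0, fun t ht => ?_⟩
        rw [zero_smul, add_zero] at ht
        by_cases h0 : t = 0
        · rw [h0, zero_smul, add_zero] at ht; exact hn ht
        · apply hex t⁻¹
          intro u hu v hv
          have e := ht u hu v hv
          simp only [LinearMap.add_apply, LinearMap.smul_apply, smul_eq_mul] at e ⊢
          field_simp
          linarith
    obtain ⟨α, hα⟩ := this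
    have hF : Frame n (w + α • n) x := fun v h1 h2 h3 => F v h1 (by simpa [h1] using h2) h3
    have hc' : Cor n (w + α • n) x s c := by
      intro σ τ ρ
      have := hc σ τ ρ
      unfold face3 at this ⊢
      have e : face (sg τ (w + α • n)) (face (sg σ n) s) = face (sg τ w) (face (sg σ n) s) := by
        ext v
        rw [mem_face (φ := sg τ (w + α • n)), mem_face (φ := sg τ w)]
        refine and_congr_right fun hv => forall₂_congr fun u hu => ?_
        have := face_eq hu hv
        have e : n u = n v := by cases σ <;> simpa using this
        cases τ <;> simp only [sg_true, sg_false, LinearMap.neg_apply, LinearMap.add_apply, LinearMap.smul_apply,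
          smul_eq_mul, e] <;> constructor <;> intro h <;> linarith
      rw [e]; exact this
    by_contra hcon
    push Not at hcon
    refine hcon α 1 (by simp) ?_
    have := KL0 hs hr H hF hc' hne hα (fun t ht => ?_)
    · convert this using 1; module
    · by_cases h0 : 1 + t * α ≠ 0 ∨ t ≠ 0
      · refine hcon (1 + t * α) t h0 ?_
        convert ht using 1; module
      · push Not at h0
        rw [h0.2] at h0; simp at h0
end KL

section SYM
variable {V : Type*} [AddCommGroup V] [Module ℝ V]
open Filter Topology

def Sm (s : Finset V) (c : V) (u : V →ₗ[ℝ] ℝ) : Prop := ∀ a ∈ face u s, ∀ b ∈ face (-u) s, u a + u b = u c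

def Sym (s : Finset V) : Prop := ∃ c, ∀ u, Sm s c u

lemma face_smul {u : V →ₗ[ℝ] ℝ} {s : Finset V} {l : ℝ} (hl : 0 < l) : face (l • u) s = face u s := by
  ext v
  simp only [mem_face, LinearMap.smul_apply, smul_eq_mul, mul_le_mul_iff_right₀ hl]

lemma Sm.of_smul {s : Finset V} {c : V} {u : V →ₗ[ℝ] ℝ} {l : ℝ} (hl : l ≠ 0) (h : Sm s c (l • u)) : Sm s c u := by
  intro a ha b hb
  rcases lt_or_gt_of_ne hl with h0 | h0
  · have h1 := h b (by
      rw [show l • u = (-l) • (-u) by module, face_smul (by linarith)]; exact hb) a (by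
      rw [show -(l • u) = (-l) • u by module, face_smul (by linarith)]; exact ha)
    simp only [LinearMap.smul_apply, smul_eq_mul] at h1
    apply mul_left_cancel₀ hl; linarith
  · have h1 := h a (by rw [face_smul h0]; exact ha) b (by
      rw [show -(l • u) = l • (-u) by module, face_smul h0]; exact hb)
    simp only [LinearMap.smul_apply, smul_eq_mul] at h1
    apply mul_left_cancel₀ hl; linarith

variable [FiniteDimensional ℝ V]

lemma exists_frame (h3 : Module.finrank ℝ V = 3) {u m : V →ₗ[ℝ] ℝ} {e e1 : V} (h1 : u e = 0) (h2 : m e ≠ 0)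
    (h4 : u e1 ≠ 0) (h5 : m e1 = 0) : ∃ w : V →ₗ[ℝ] ℝ, Frame u w m ∧ w e = 0 := by
  have hsurj : Function.Surjective (u.prod m) := by
    rintro ⟨x, y⟩
    refine ⟨(x / u e1) • e1 + (y / m e) • e, ?_⟩
    simp [h1, h5, h2, h4]
  have hk : Module.finrank ℝ (LinearMap.ker (u.prod m)) = 1 := by
    have := (u.prod m).finrank_range_add_finrank_ker
    rw [LinearMap.range_eq_top.2 hsurj, finrank_top, h3] at this
    simp at this
    omega
  obtain ⟨⟨k, hkm⟩, hk0, hk1⟩ := finrank_eq_one_iff'.1 hk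
  have hkm' : u k = 0 ∧ m k = 0 := by simpa using hkm
  have hk0' : k ≠ 0 := fun h => hk0 (by simp [h])
  obtain ⟨w0, hw0⟩ : ∃ w0 : V →ₗ[ℝ] ℝ, w0 k ≠ 0 := by
    by_contra hc
    push Not at hc
    exact hk0' ((Module.forall_dual_apply_eq_zero_iff ℝ k).1 hc)
  refine ⟨w0 - (w0 e / m e) • m, ?_, by simp [h2]⟩
  intro v hv1 hv2 hv3
  obtain ⟨c, hc⟩ := hk1 ⟨v, by simp [hv1, hv3]⟩
  have hc : c • k = v := by simpa using congrArg Subtype.val hc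
  rw [← hc] at hv2 ⊢
  simp [hkm'.2, hw0] at hv2
  simp [hv2]

lemma cor_of_flat {n w x : V →ₗ[ℝ] ℝ} {s : Finset V} {c : C3 V} (hc : Cor n w x s c) {σ τ ρ : Bool}
    (h : Cst w (face (sg σ n) s)) : c σ τ ρ ∈ face (sg ρ x) (face (sg σ n) s) := by
  have := hc σ τ ρ
  unfold face3 at this
  rwa [face_flat (φ := sg τ w)] at this
  intro u hu v hv
  cases τ <;> simp [h u hu v hv]

lemma exists_gen (D : Finset V) (hD : ∀ d ∈ D, d ≠ 0) : ∃ u : V →ₗ[ℝ] ℝ, ∀ d ∈ D, u d ≠ 0 := by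
  obtain ⟨u1, hu1⟩ := Module.exists_dual_forall_apply_ne_zero (K := ℝ) (fun d : D => (d : V)) (fun d => hD _ d.2)
  exact ⟨u1, fun d hd => hu1 ⟨d, hd⟩⟩

theorem SYM (h3 : Module.finrank ℝ V = 3) {s : Finset V} (hs : s.Nonempty) {e1 : V} (he1 : e1 ≠ 0)
    (H : ∀ (n w x : V →ₗ[ℝ] ℝ) (c : C3 V) (e : V), Frame n w x → Cor n w x s c → n e = 0 → w e = 0 → x e ≠ 0 →
      n e1 ≠ 0 → ln x c true true = ln x c false false) : Sym s := by
  classical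
  let D : Finset V := ((s - s).erase 0) ∪ {e1}
  have hD0 : ∀ d ∈ D, d ≠ 0 := by
    intro d hd
    simp only [D, Finset.mem_union, Finset.mem_erase, Finset.mem_singleton] at hd
    rcases hd with h | h
    · exact h.1
    · rw [h]; exact he1
  have hdD : ∀ p ∈ s, ∀ q ∈ s, p - q ≠ 0 → p - q ∈ D := fun p hp q hq h => by
    simp only [D, Finset.mem_union, Finset.mem_erase]
    exact Or.inl ⟨h, Finset.sub_mem_sub hp hq⟩
  obtain ⟨u1, hu1'⟩ := exists_gen D hD0
  have hu1e : u1 e1 ≠ 0 := hu1' _ (by simp [D])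
  let Y : Finset V := ((D ×ˢ D).image fun q => u1 q.1 • q.2 - u1 q.2 • q.1).erase 0
  have hY0 : ∀ y ∈ Y, y ≠ 0 := fun y hy => (Finset.mem_erase.1 hy).1
  have inj1 : ∀ p ∈ s, ∀ q ∈ s, u1 (p - q) = 0 → p - q = 0 := by
    intro p hp q hq h
    by_contra hc
    exact hu1' _ (hdD p hp q hq hc) h
  obtain ⟨a0, ha0⟩ := face_nonempty (φ := u1) hs
  obtain ⟨b0, hb0⟩ := face_nonempty (φ := -u1) hs
  have step : ∀ u2 : V →ₗ[ℝ] ℝ, u2 e1 = u1 e1 → (∀ d ∈ D, u2 d ≠ 0) → (∀ y ∈ Y, u2 y ≠ 0) →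
      Sm s (a0 + b0) u2 := by
    intro u2 h2e h2D h2Y
    set m := u2 - u1 with hm
    have hme : m e1 = 0 := by simp [hm, h2e]
    have hmd : ∀ (t : ℝ) v, (u1 + t • m) v = 0 → m v = 0 → u1 v = 0 := by
      intro t v h1 h2
      simpa [h2] using h1
    have inj : ∀ t : ℝ, ∀ p ∈ s, ∀ q ∈ s, (u1 + t • m) (p - q) = 0 → m (p - q) = 0 → p = q :=
      fun t p hp q hq h1 h2 => sub_eq_zero.1 (inj1 p hp q hq (hmd t _ h1 h2))
    have par : ∀ t : ℝ, ∀ p ∈ s, ∀ q ∈ s, ∀ p' ∈ s, ∀ q' ∈ s, (u1 + t • m) (p - q) = 0 →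
        (u1 + t • m) (p' - q') = 0 → u1 (p - q) • (p' - q') = u1 (p' - q') • (p - q) := by
      intro t p hp q hq p' hp' q' hq' h1 h2
      by_cases e1 : p - q = 0
      · simp [e1]
      by_cases e2 : p' - q' = 0
      · simp [e2]
      by_contra hc
      have hy : u1 (p - q) • (p' - q') - u1 (p' - q') • (p - q) ∈ Y := by
        refine Finset.mem_erase.2 ⟨sub_ne_zero.2 hc, Finset.mem_image.2 ⟨(p - q, p' - q'), ?_, rfl⟩⟩
        exact Finset.mem_product.2 ⟨hdD p hp q hq e1, hdD p' hp' q' hq' e2⟩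
      have k1 : u1 (u1 (p - q) • (p' - q') - u1 (p' - q') • (p - q)) = 0 := by
        simp only [map_sub, map_smul, smul_eq_mul]; ring
      have k2 : (u1 + t • m) (u1 (p - q) • (p' - q') - u1 (p' - q') • (p - q)) = 0 := by
        rw [map_sub, map_smul, map_smul, h1, h2]; simp
      rw [LinearMap.add_apply, k1, zero_add, LinearMap.smul_apply, smul_eq_mul] at k2
      rcases mul_eq_zero.1 k2 with h | h
      · rw [h, zero_smul, add_zero] at h1
        exact e1 (inj1 p hp q hq h1)
      · apply h2Y _ hy
        rw [hm, LinearMap.sub_apply, k1, sub_zero] at h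
        exact h
    choose a ha using fun t : ℝ => face_nonempty (φ := m) (face_nonempty (φ := u1 + t • m) hs)
    choose b hb using fun t : ℝ => face_nonempty (φ := -m) (face_nonempty (φ := -(u1 + t • m)) hs)
    have uniq : ∀ t : ℝ, ∀ p q, p ∈ face m (face (u1 + t • m) s) → q ∈ face m (face (u1 + t • m) s) → p = q := by
      intro t p q hp hq
      refine inj t p (face_subset (face_subset hp)) q (face_subset (face_subset hq)) ?_ ?_
      · rw [map_sub, face_eq (face_subset hp) (face_subset hq), sub_self]
      · rw [map_sub, face_eq hp hq, sub_self]
    have uniq' : ∀ t : ℝ, ∀ p q, p ∈ face (-m) (face (-(u1 + t • m)) s) → q ∈ face (-m) (face (-(u1 + t • m)) s) → p = q := by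
      intro t p q hp hq
      refine inj t p (face_subset (face_subset hp)) q (face_subset (face_subset hq)) ?_ ?_
      · have := face_eq (face_subset hp) (face_subset hq)
        rw [LinearMap.neg_apply, LinearMap.neg_apply, neg_inj] at this
        rw [map_sub, this, sub_self]
      · have := face_eq hp hq
        rw [LinearMap.neg_apply, LinearMap.neg_apply, neg_inj] at this
        rw [map_sub, this, sub_self]
    have cross : ∀ (t : ℝ) p p', p ∈ face (-m) (face (u1 + t • m) s) → p' ∈ face m (face (-(u1 + t • m)) s) →
        p + p' = a t + b t := by
      intro t p p' hp hp'
      have sa := face_subset (face_subset (ha t))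
      have sb := face_subset (face_subset (hb t))
      have sp := face_subset (face_subset hp)
      have sp' := face_subset (face_subset hp')
      have d1 : (u1 + t • m) (a t - p) = 0 := by
        rw [map_sub, face_eq (face_subset (ha t)) (face_subset hp), sub_self]
      have d2 : (u1 + t • m) (p' - b t) = 0 := by
        have := face_eq (face_subset hp') (face_subset (hb t))
        rw [LinearMap.neg_apply, LinearMap.neg_apply, neg_inj] at this
        rw [map_sub, this, sub_self]
      have hpar := par t _ sa _ sp _ sp' _ sb d1 d2
      suffices h : m (a t - p) = m (p' - b t) by
        have k : u1 (a t - p) = u1 (p' - b t) := by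
          have := hmd t (a t - p - (p' - b t)) (by rw [map_sub, d1, d2, sub_zero]) (by rw [map_sub, h, sub_self])
          rw [map_sub] at this; linarith
        have e : a t - p = p' - b t := by
          by_cases h0 : u1 (a t - p) = 0
          · rw [inj1 _ sa _ sp h0, inj1 _ sp' _ sb (k ▸ h0)]
          · rw [k] at hpar h0
            exact (smul_right_injective V h0 hpar).symm
        have : p + p' = a t + b t - ((a t - p) - (p' - b t)) := by abel
        rw [this, e, sub_self, sub_zero]
      have main : ∀ e : V, e ≠ 0 → (∃ p ∈ s, ∃ q ∈ s, e = p - q) → (u1 + t • m) e = 0 → m (a t - p) = m (p' - b t) := by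
        rintro e he ⟨p0, hp0, q0, hq0, rfl⟩ hue
        have hme' : m (p0 - q0) ≠ 0 := fun h => he (inj1 _ hp0 _ hq0 (hmd t _ hue h))
        have hu1e' : u1 (p0 - q0) ≠ 0 := fun h => he (inj1 _ hp0 _ hq0 h)
        have hte : (u1 + t • m) e1 ≠ 0 := by simpa [hme] using hu1e
        obtain ⟨w, F, hw⟩ := exists_frame h3 hue hme' hte hme
        obtain ⟨c, hc⟩ := exists_cor (u1 + t • m) w m hs
        have hl := H _ _ _ c (p0 - q0) F hc hue hw hme' hte
        have flat : ∀ σ, Cst w (face (sg σ (u1 + t • m)) s) := by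
          intro σ p hp q hq
          have hz : (u1 + t • m) (p - q) = 0 := by
            rw [map_sub, sub_eq_zero]
            have := face_eq hp hq
            cases σ <;> simpa only [sg_true, sg_false, LinearMap.neg_apply, neg_inj] using this
          have := congrArg w (par t _ hp0 _ hq0 _ (face_subset hp) _ (face_subset hq) hue hz)
          rw [map_smul, map_smul, hw, smul_zero, smul_eq_mul] at this
          have := (mul_eq_zero.1 this).resolve_left hu1e'
          rwa [map_sub, sub_eq_zero] at this
        have f1 := cor_of_flat hc (σ := true) (τ := true) (ρ := true) (flat true)
        have f2 := cor_of_flat hc (σ := true) (τ := true) (ρ := false) (flat true)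
        have f3 := cor_of_flat hc (σ := false) (τ := false) (ρ := true) (flat false)
        have f4 := cor_of_flat hc (σ := false) (τ := false) (ρ := false) (flat false)
        simp only [sg_true, sg_false] at f1 f2 f3 f4
        have g1 := face_eq f1 (ha t)
        have g2 := face_eq f2 hp
        have g3 := face_eq f3 hp'
        have g4 := face_eq f4 (hb t)
        simp only [LinearMap.neg_apply, neg_inj] at g2 g4
        unfold ln at hl
        rw [map_sub, map_sub]; linarith
      by_cases h1 : a t - p = 0
      · by_cases h2 : p' - b t = 0
        · rw [h1, h2]
        · exact main _ h2 ⟨_, sp', _, sb, rfl⟩ d2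
      · exact main _ h1 ⟨_, sa, _, sp, rfl⟩ d1
    have const := const_of_local (fun t => a t + b t) (by
        intro t
        filter_upwards [lexpert (u1 + t • m) m s, lexpert (-(u1 + t • m)) (-m) s] with ε k1 k2
        have e1 : a (t + ε) = a t := by
          apply uniq t _ _ _ (ha t)
          rw [← k1, show u1 + t • m + ε • m = u1 + (t + ε) • m by module]
          exact face_subset (ha (t + ε))
        have e2 : b (t + ε) = b t := by
          apply uniq' t _ _ _ (hb t)
          rw [← k2, show -(u1 + t • m) + ε • -m = -(u1 + (t + ε) • m) by module]
          exact face_subset (hb (t + ε))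
        rw [e1, e2]) (by
        intro t
        filter_upwards [lexpert (u1 + t • m) (-m) s, lexpert (-(u1 + t • m)) m s] with ε k1 k2
        apply cross t
        · rw [← k1, show u1 + t • m + ε • -m = u1 + (t - ε) • m by module]
          exact face_subset (ha (t - ε))
        · rw [← k2, show -(u1 + t • m) + ε • m = -(u1 + (t - ε) • m) by module]
          exact face_subset (hb (t - ε)))
    have c10 := const 1 0
    have A1 := face_subset (ha 1)
    have B1 := face_subset (hb 1)
    have A0 := face_subset (ha 0)
    have B0 := face_subset (hb 0)
    rw [show u1 + (1:ℝ) • m = u2 by rw [hm]; module] at A1 B1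
    rw [zero_smul, add_zero] at A0 B0
    have i1 : a 0 = a0 := by
      rw [← sub_eq_zero]
      exact inj1 _ (face_subset A0) _ (face_subset ha0) (by rw [map_sub, face_eq A0 ha0, sub_self])
    have i2 : b 0 = b0 := by
      rw [← sub_eq_zero]
      refine inj1 _ (face_subset B0) _ (face_subset hb0) ?_
      have := face_eq B0 hb0
      rw [LinearMap.neg_apply, LinearMap.neg_apply, neg_inj] at this
      rw [map_sub, this, sub_self]
    intro p hp q hq
    have j1 := face_eq hp A1
    have j2 := face_eq hq B1
    rw [LinearMap.neg_apply, LinearMap.neg_apply, neg_inj] at j2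
    rw [j1, j2, ← map_add, c10, i1, i2]
  refine ⟨a0 + b0, fun u p hp q hq => ?_⟩
  obtain ⟨r, hr'⟩ := exists_gen (D ∪ Y) (fun d hd => (Finset.mem_union.1 hd).elim (hD0 _) (hY0 _))
  have hev : ∀ᶠ ε in 𝓝[>] (0:ℝ), ∀ d ∈ D ∪ Y, (u + ε • r) d ≠ 0 := by
    rw [Filter.eventually_all_finset]
    intro d hd
    have h1 := hr' d hd
    have : ∀ᶠ ε in 𝓝[≠] (0:ℝ), (u + ε • r) d ≠ 0 := by
      by_cases h0 : u d = 0
      · filter_upwards [self_mem_nhdsWithin] with ε hε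
        have : ε ≠ 0 := hε
        simp [h0, h1, this]
      · apply Filter.Eventually.filter_mono nhdsWithin_le_nhds
        have : Tendsto (fun ε : ℝ => (u + ε • r) d) (𝓝 0) (𝓝 (u d)) := by
          have : Continuous (fun ε : ℝ => u d + ε * r d) := by fun_prop
          simpa using this.tendsto 0
        exact this.eventually_ne h0
    exact this.filter_mono (nhdsWithin_mono _ (fun x hx => ne_of_gt hx))
  obtain ⟨v, hv⟩ := face_nonempty (φ := r) (face_nonempty (φ := u) hs)
  obtain ⟨v', hv'⟩ := face_nonempty (φ := -r) (face_nonempty (φ := -u) hs)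
  have hE : ∀ᶠ ε in 𝓝[>] (0:ℝ), (u v + ε * r v) + (u v' + ε * r v') = u (a0 + b0) + ε * r (a0 + b0) := by
    filter_upwards [hev, lexpert u r s, lexpert (-u) (-r) s] with ε h1 h2 h3
    have he : (u + ε • r) e1 ≠ 0 := h1 e1 (by simp [D])
    have hne : u1 e1 / (u + ε • r) e1 ≠ 0 := div_ne_zero hu1e he
    have S := (step ((u1 e1 / (u + ε • r) e1) • (u + ε • r)) (by
      rw [LinearMap.smul_apply, smul_eq_mul]; field_simp) (fun d hd => by
      rw [LinearMap.smul_apply, smul_eq_mul]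
      exact mul_ne_zero hne (h1 d (Finset.mem_union_left _ hd))) (fun d hd => by
      rw [LinearMap.smul_apply, smul_eq_mul]
      exact mul_ne_zero hne (h1 d (Finset.mem_union_right _ hd)))).of_smul hne
    have := S v (by rw [h2]; exact hv) v' (by
      rw [show -(u + ε • r) = -u + ε • -r by module, h3]; exact hv')
    simpa using this
  have lim : u v + u v' = u (a0 + b0) := by
    have t1 : Tendsto (fun ε : ℝ => (u v + ε * r v) + (u v' + ε * r v')) (𝓝[>] 0) (𝓝 (u v + u v')) := by
      apply Tendsto.mono_left _ nhdsWithin_le_nhds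
      have : Continuous (fun ε : ℝ => (u v + ε * r v) + (u v' + ε * r v')) := by fun_prop
      simpa using this.tendsto 0
    have t2 : Tendsto (fun ε : ℝ => u (a0 + b0) + ε * r (a0 + b0)) (𝓝[>] 0) (𝓝 (u (a0 + b0))) := by
      apply Tendsto.mono_left _ nhdsWithin_le_nhds
      have : Continuous (fun ε : ℝ => u (a0 + b0) + ε * r (a0 + b0)) := by fun_prop
      simpa using this.tendsto 0
    exact tendsto_nhds_unique_of_eventuallyEq t1 t2 hE
  have j1 := face_eq hp (face_subset hv)
  have j2 := face_eq hq (face_subset hv')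
  rw [LinearMap.neg_apply, LinearMap.neg_apply, neg_inj] at j2
  rw [j1, j2, lim]

lemma Frame.surj (h3 : Module.finrank ℝ V = 3) {n w x : V →ₗ[ℝ] ℝ} (F : Frame n w x) (a b c : ℝ) :
    ∃ v, n v = a ∧ w v = b ∧ x v = c := by
  have hinj : Function.Injective (n.prod (w.prod x)) := by
    rw [← LinearMap.ker_eq_bot, LinearMap.ker_eq_bot']
    intro v hv
    simp only [LinearMap.prod_apply, Function.prod_apply, Prod.mk_eq_zero] at hv
    exact F v hv.1 hv.2.1 hv.2.2
  have hs := (LinearMap.injective_iff_surjective_of_finrank_eq_finrank (f := n.prod (w.prod x)) (by simp [h3])).1 hinj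
  obtain ⟨v, hv⟩ := hs (a, b, c)
  simp only [LinearMap.prod_apply, Function.prod_apply, Prod.mk.injEq] at hv
  exact ⟨v, hv⟩

lemma Frame.comb_ne (h3 : Module.finrank ℝ V = 3) {n w x : V →ₗ[ℝ] ℝ} (F : Frame n w x) {a b : ℝ}
    (h : a ≠ 0 ∨ b ≠ 0) : a • n + b • w ≠ 0 := by
  intro h0
  obtain ⟨v, v1, v2, -⟩ := F.surj h3 a b 0
  have := LinearMap.congr_fun h0 v
  simp [v1, v2] at this
  rcases h with h | h <;> have := mul_self_pos.2 h <;> nlinarith [mul_self_nonneg a, mul_self_nonneg b]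

lemma Frame.line (h3 : Module.finrank ℝ V = 3) {n w x : V →ₗ[ℝ] ℝ} (F : Frame n w x) {e v : V} (h1 : n e = 0)
    (h2 : w e = 0) (h4 : x e ≠ 0) (k1 : n v = 0) (k2 : w v = 0) : v = (x v / x e) • e := by
  rw [← sub_eq_zero]
  apply F
  · simp [h1, k1]
  · simp [h2, k2]
  · simp [h4]

lemma par_of_kill (h3 : Module.finrank ℝ V = 3) {n m m' : V →ₗ[ℝ] ℝ} {f1 f2 : V} (hn : n f1 ≠ 0) (hn2 : n f2 = 0)
    (hf2 : f2 ≠ 0) (hm : m ≠ 0) (k1 : m f1 = 0) (k2 : m f2 = 0) (k3 : m' f1 = 0) (k4 : m' f2 = 0) :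
    ∃ c : ℝ, m' = c • m := by
  obtain ⟨g, hg⟩ : ∃ g, m g ≠ 0 := by
    by_contra hc
    push Not at hc
    exact hm (LinearMap.ext hc)
  obtain ⟨w, F, hw⟩ := exists_frame h3 (u := m) (m := n) (e := f1) (e1 := g - (n g / n f1) • f1) k1 hn
    (by simpa [k1] using hg) (by simp [hn])
  have hwf : w f2 ≠ 0 := fun h => hf2 (F _ k2 h hn2)
  have key : ∀ v, m v = 0 → m' v = 0 := by
    intro v hv
    have : v - (w v / w f2) • f2 - (n v / n f1) • f1 = 0 := by
      apply F
      · simp [hv, k1, k2]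
      · simp [hw, hwf]
      · simp [hn2, hn]
    have := congrArg m' this
    simpa [k3, k4] using this
  refine ⟨m' g / m g, LinearMap.ext fun v => ?_⟩
  have := key (v - (m v / m g) • g) (by simp [hg])
  simp at this ⊢
  field_simp at this ⊢
  linarith

lemma bad_of_not_sym (h3 : Module.finrank ℝ V = 3) {s : Finset V} (hs : s.Nonempty) {e1 : V} (he1 : e1 ≠ 0)
    (h : ¬ Sym s) : ∃ (n w x : V →ₗ[ℝ] ℝ) (c : C3 V) (e : V), Frame n w x ∧ Cor n w x s c ∧ n e = 0 ∧ w e = 0 ∧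
      x e ≠ 0 ∧ n e1 ≠ 0 ∧ ln x c true true ≠ ln x c false false := by
  by_contra hc
  push Not at hc
  exact h (SYM h3 hs he1 hc)

lemma bad_kill (h3 : Module.finrank ℝ V = 3) {s : Finset V} {n w x m : V →ₗ[ℝ] ℝ} {c : C3 V} {e : V}
    (F : Frame n w x) (hc : Cor n w x s c) (h1 : n e = 0) (h2 : w e = 0) (h4 : x e ≠ 0)
    (hm : Cst m s) (hne : ln x c true true ≠ ln x c false false) : m e = 0 := by
  by_contra hme
  have : ∀ σ, ln x c σ σ = 0 := by
    intro σ
    have a1 : n (c σ σ true - c σ σ false) = 0 := by rw [map_sub, hc.n_eq σ σ true σ false, sub_self]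
    have a2 : w (c σ σ true - c σ σ false) = 0 := by rw [map_sub, hc.w_eq σ σ true false, sub_self]
    have a3 := F.line h3 h1 h2 h4 a1 a2
    have a4 : m (c σ σ true - c σ σ false) = 0 := by
      rw [map_sub, hm _ (hc.mem _ _ _) _ (hc.mem _ _ _), sub_self]
    rw [a3, map_smul, smul_eq_mul] at a4
    have := (mul_eq_zero.1 a4).resolve_right hme
    have := (div_eq_zero_iff.1 this).resolve_right h4
    rw [map_sub] at this
    exact this
  rw [this, this] at hne
  exact hne rfl

theorem closing (h3 : Module.finrank ℝ V = 3) {s r : Finset V} (hs : s.Nonempty) (hr : r.Nonempty)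
    (H1 : FLP s r) (H2 : FLP r s) (hno : ∀ m : V →ₗ[ℝ] ℝ, m ≠ 0 → ¬ (Cst m s ∧ Cst m r)) : Sym s ∨ Sym r := by
  by_contra hcon
  push Not at hcon
  obtain ⟨hA, hB⟩ := hcon
  obtain ⟨e0, he0⟩ : ∃ e0 : V, e0 ≠ 0 := by
    have : Nontrivial V := Module.nontrivial_of_finrank_pos (R := ℝ) (by omega)
    exact exists_ne 0
  obtain ⟨n, w, x, c, e, F, hc, -, -, -, -, hne⟩ := bad_of_not_sym h3 hs he0 hA
  obtain ⟨α, β, hab, hmr⟩ := KL hs hr H1 F hc hne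
  have hm0 := F.comb_ne h3 hab
  set m := α • n + β • w with hm
  obtain ⟨n1, w1, x1, c1, f1, F1, hc1, p1, p2, p3, -, hne1⟩ := bad_of_not_sym h3 hr he0 hB
  have hf1 : f1 ≠ 0 := fun h => p3 (by simp [h])
  obtain ⟨n2, w2, x2, c2, f2, F2, hc2, q1, q2, q3, q4, hne2⟩ := bad_of_not_sym h3 hr hf1 hB
  have hf2 : f2 ≠ 0 := fun h => q3 (by simp [h])
  have mf1 := bad_kill h3 F1 hc1 p1 p2 p3 hmr hne1
  have mf2 := bad_kill h3 F2 hc2 q1 q2 q3 hmr hne2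
  obtain ⟨α1, β1, hab1, hm1⟩ := KL hr hs H2 F1 hc1 hne1
  obtain ⟨α2, β2, hab2, hm2⟩ := KL hr hs H2 F2 hc2 hne2
  have m10 := F1.comb_ne h3 hab1
  have m20 := F2.comb_ne h3 hab2
  have k1 : (α1 • n1 + β1 • w1) f1 = 0 := by simp [p1, p2]
  have k2 : (α2 • n2 + β2 • w2) f2 = 0 := by simp [q1, q2]
  set m1 := α1 • n1 + β1 • w1 with hm1d
  set m2 := α2 • n2 + β2 • w2 with hm2d
  have nk : ∀ m' : V →ₗ[ℝ] ℝ, m' ≠ 0 → Cst m' s → m' f1 = 0 → m' f2 = 0 → False := by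
    intro m' h0 hs' a b
    obtain ⟨t, ht⟩ := par_of_kill h3 q4 q1 hf2 hm0 mf1 mf2 a b
    apply hno m' h0 ⟨hs', ?_⟩
    intro u hu v hv
    rw [ht]; simp [hmr u hu v hv]
  have l1 : m1 f2 ≠ 0 := fun h => nk m1 m10 hm1 k1 h
  have l2 : m2 f1 ≠ 0 := fun h => nk m2 m20 hm2 h k2
  obtain ⟨z, Fz, hz⟩ := exists_frame h3 (u := m1) (m := m2) (e := f1) (e1 := f2) k1 l2 l1 k2
  obtain ⟨g, g1, g2, g3⟩ := Fz.surj h3 0 1 0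
  apply hA
  have hg' : ∃ g, m1 g = 0 ∧ m2 g = 0 ∧ z g ≠ 0 := by
    obtain ⟨g, g1, g2, g3⟩ := Fz.surj h3 0 1 0
    exact ⟨g, g1, g3, by simp [g2]⟩
  obtain ⟨g, g1, g2, g3⟩ := hg'
  have hg0 : g ≠ 0 := fun h => g3 (by simp [h])
  refine SYM h3 hs hg0 ?_
  intro n w x c e F hc _ _ _ hng
  have : ∀ σ, ln x c σ σ = 0 := by
    intro σ
    have a0 : n (c σ σ true - c σ σ false) = 0 := by rw [map_sub, hc.n_eq σ σ true σ false, sub_self]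
    have a1 : m1 (c σ σ true - c σ σ false) = 0 := by
      rw [map_sub, hm1 _ (hc.mem _ _ _) _ (hc.mem _ _ _), sub_self]
    have a2 : m2 (c σ σ true - c σ σ false) = 0 := by
      rw [map_sub, hm2 _ (hc.mem _ _ _) _ (hc.mem _ _ _), sub_self]
    have Fz' : Frame m1 m2 z := fun v h1 h2 h3 => Fz v h1 h3 h2
    have a3 := Fz'.line h3 g1 g2 g3 a1 a2
    rw [a3, map_smul, smul_eq_mul] at a0
    have := (mul_eq_zero.1 a0).resolve_right hng
    rw [this, zero_smul, sub_eq_zero] at a3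
    unfold ln; rw [a3, sub_self]
  rw [this, this]

end SYM

section TRI
variable {V : Type*} [AddCommGroup V] [Module ℝ V]

def good (T : Finset V) : Prop := T.card = 4 ∧ ∀ m : V →ₗ[ℝ] ℝ, Cst m T → m = 0

noncomputable def bm (T : Finset V) : (T → ℝ) →ₗ[ℝ] ℝ × V where
  toFun μ := (∑ t : T, μ t, ∑ t : T, μ t • (t : V))
  map_add' a b := by simp [Finset.sum_add_distrib, add_smul]
  map_smul' a b := by simp [Finset.mul_sum, Finset.smul_sum, mul_smul]

open Classical in
noncomputable def mu (T : Finset V) (x : V) (t : V) : ℝ :=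
  if h : t ∈ T then Function.invFun (bm T) (1, x) ⟨t, h⟩ else 0

noncomputable def Dl (c : V → ℝ) (T : Finset V) (s : V) : ℝ := c s - ∑ t ∈ T, mu T s t * c t

def Low (S : Finset V) (c : V → ℝ) (T : Finset V) : Prop :=
  T ⊆ S ∧ good T ∧ ∀ s ∈ S, s ∉ T → 0 < Dl c T s

def Gen (S : Finset V) (c : V → ℝ) : Prop := ∀ T ⊆ S, good T → ∀ s ∈ S, s ∉ T → Dl c T s ≠ 0

lemma sum_pivot [DecidableEq V] {M : Type*} [AddCommGroup M] {T : Finset V} {s t0 : V} (hs : s ∉ T.erase t0) {ν μ : V → ℝ} {θ : ℝ}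
    (h0 : ν t0 = 0) (h1 : μ s = θ) (h2 : ∀ t ∈ T.erase t0, μ t = ν t) (f : ℝ → V → M) (hf0 : ∀ v, f 0 v = 0) :
    ∑ t ∈ insert s (T.erase t0), f (μ t) t = f θ s + ∑ t ∈ T, f (ν t) t := by
  rw [Finset.sum_insert hs, h1]
  congr 1
  rw [← Finset.sum_erase (s := T) (a := t0) (f := fun t => f (ν t) t) (by rw [h0, hf0])]
  exact Finset.sum_congr rfl fun t ht => by rw [h2 t ht]

lemma bm_apply (T : Finset V) (μ : V → ℝ) : bm T (fun t => μ t) = (∑ t ∈ T, μ t, ∑ t ∈ T, μ t • t) := by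
  exact Prod.ext (Finset.sum_coe_sort T μ) (Finset.sum_coe_sort T (fun t => μ t • t))

variable [FiniteDimensional ℝ V] (h3 : Module.finrank ℝ V = 3)
include h3

lemma bm_bij {T : Finset V} (hT : good T) : Function.Bijective (bm T) := by
  have hd : Module.finrank ℝ (T → ℝ) = Module.finrank ℝ (ℝ × V) := by
    simp [h3, hT.1]
  have hsurj : Function.Surjective (bm T) := by
    rw [← LinearMap.range_eq_top]
    by_contra hne
    obtain ⟨f, hf0, hf⟩ := Submodule.exists_le_ker_of_lt_top _ (lt_top_iff_ne_top.2 hne)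
    have key : ∀ t ∈ T, f (1, t) = 0 := by
      intro t ht
      classical
      have := hf (LinearMap.mem_range_self (bm T) (Pi.single ⟨t, ht⟩ 1))
      rw [LinearMap.mem_ker] at this
      rw [← this]; congr 1
      simp [bm, Pi.single_apply, ite_smul]
    have hsplit : ∀ (a : ℝ) (v : V), f (a, v) = a * f (1, 0) + f (0, v) := by
      intro a v
      rw [← smul_eq_mul, ← map_smul, ← map_add]; simp
    have hm : f ∘ₗ LinearMap.inr ℝ ℝ V = 0 := by
      apply hT.2
      intro u hu v hv
      have a1 := key u hu
      have a2 := key v hv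
      rw [hsplit] at a1 a2
      simp; linarith
    have hm' : ∀ v, f (0, v) = 0 := fun v => by simpa using LinearMap.congr_fun hm v
    obtain ⟨t, ht⟩ : T.Nonempty := by rw [← Finset.card_pos, hT.1]; norm_num
    have a1 := key t ht
    rw [hsplit, hm'] at a1
    apply hf0
    refine LinearMap.ext fun ⟨a, v⟩ => ?_
    rw [hsplit, hm']
    have : f (1, 0) = 0 := by linarith
    simp [this]
  exact ⟨(LinearMap.injective_iff_surjective_of_finrank_eq_finrank hd).2 hsurj, hsurj⟩

lemma mu_spec {T : Finset V} (hT : good T) (x : V) :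
    ∑ t ∈ T, mu T x t = 1 ∧ ∑ t ∈ T, mu T x t • t = x := by
  have h1 := Function.rightInverse_invFun (bm_bij h3 hT).2 (1, x)
  have h2 := bm_apply T (mu T x)
  have h4 : (fun t : T => mu T x t) = Function.invFun (bm T) (1, x) := by
    ext t; simp [mu]
  rw [h4, h1] at h2
  rw [Prod.mk.injEq] at h2
  exact ⟨h2.1.symm, h2.2.symm⟩

lemma mu_unique {T : Finset V} (hT : good T) {x : V} {μ : V → ℝ} (h1 : ∑ t ∈ T, μ t = 1)
    (h2 : ∑ t ∈ T, μ t • t = x) : ∀ t ∈ T, mu T x t = μ t := by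
  have k := mu_spec h3 hT x
  have : bm T (fun t => mu T x t) = bm T (fun t => μ t) := by
    rw [bm_apply, bm_apply, h1, h2, k.1, k.2]
  have := (bm_bij h3 hT).1 this
  intro t ht
  exact congrFun this ⟨t, ht⟩

lemma mu_affine {T : Finset V} (hT : good T) (x : V) (m : V →ₗ[ℝ] ℝ) (a : ℝ) :
    ∑ t ∈ T, mu T x t * (m t + a) = m x + a := by
  have k := mu_spec h3 hT x
  have := congrArg m k.2
  simp only [map_sum, map_smul, smul_eq_mul] at this
  simp only [mul_add, Finset.sum_add_distrib, ← Finset.sum_mul, k.1, this]; ring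

lemma mu_comb {T U : Finset V} (hT : good T) {l : V → ℝ} {x : V} (h1 : ∑ u ∈ U, l u = 1)
    (h2 : ∑ u ∈ U, l u • u = x) : ∀ t ∈ T, mu T x t = ∑ u ∈ U, l u * mu T u t := by
  apply mu_unique h3 hT
  · rw [Finset.sum_comm]
    rw [← h1]
    refine Finset.sum_congr rfl fun u _ => ?_
    rw [← Finset.mul_sum, (mu_spec h3 hT u).1, mul_one]
  · simp only [Finset.sum_smul]
    rw [Finset.sum_comm, ← h2]
    refine Finset.sum_congr rfl fun u _ => ?_
    simp only [mul_smul]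
    rw [← Finset.smul_sum, (mu_spec h3 hT u).2]

lemma mem_hull_iff {T : Finset V} (hT : good T) (x : V) :
    x ∈ convexHull ℝ (T : Set V) ↔ ∀ t ∈ T, 0 ≤ mu T x t := by
  rw [Finset.mem_convexHull']
  constructor
  · rintro ⟨w, h0, h1, h2⟩ t ht
    rw [mu_unique h3 hT h1 h2 t ht]; exact h0 t ht
  · intro h
    exact ⟨mu T x, h, mu_spec h3 hT x⟩

lemma mu_pos {S T : Finset V} (hTS : T ⊆ S) (hT : good T) {x : V}
    (hx : ∀ U ⊆ S, U.card ≤ 3 → x ∉ convexHull ℝ (U : Set V)) (h : x ∈ convexHull ℝ (T : Set V)) :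
    ∀ t ∈ T, 0 < mu T x t := by
  classical
  intro t ht
  refine lt_of_le_of_ne ((mem_hull_iff h3 hT x).1 h t ht) fun h0 => ?_
  apply hx (T.erase t) ((Finset.erase_subset _ _).trans hTS) (by rw [Finset.card_erase_of_mem ht, hT.1])
  rw [Finset.mem_convexHull']
  have k := mu_spec h3 hT x
  refine ⟨mu T x, fun y hy => (mem_hull_iff h3 hT x).1 h y (Finset.mem_of_mem_erase hy), ?_, ?_⟩
  · rw [Finset.sum_erase _ h0.symm, k.1]
  · rw [Finset.sum_erase _ (by rw [← h0, zero_smul]), k.2]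

lemma good_of_card {S T : Finset V} (hTS : T ⊆ S) (hc : T.card = 4) {x : V}
    (hx : ∀ U ⊆ S, U.card ≤ 3 → x ∉ convexHull ℝ (U : Set V)) (h : x ∈ convexHull ℝ (T : Set V)) : good T := by
  classical
  refine ⟨hc, fun m hm => ?_⟩
  have hai : AffineIndependent ℝ ((↑) : T → V) := by
    by_contra hn
    obtain ⟨y, hy⟩ := Caratheodory.mem_convexHull_erase hn h
    exact hx (T.erase y) ((Finset.erase_subset _ _).trans hTS) (by rw [Finset.card_erase_of_mem y.2, hc]) hy
  have hv := hai.vectorSpan_eq_top_of_card_eq_finrank_add_one (by simp [hc, h3])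
  have : vectorSpan ℝ (Set.range ((↑) : T → V)) ≤ LinearMap.ker m := by
    unfold vectorSpan
    rw [Submodule.span_le]
    rintro _ ⟨_, ⟨a, rfl⟩, _, ⟨b, rfl⟩, rfl⟩
    simp [hm a a.2 b b.2]
  rw [hv, top_le_iff, LinearMap.ker_eq_top] at this
  exact this

lemma exists_good {S : Finset V} {x : V}
    (hx : ∀ U ⊆ S, U.card ≤ 3 → x ∉ convexHull ℝ (U : Set V)) (h : x ∈ convexHull ℝ (S : Set V)) :
    ∃ T ⊆ S, good T ∧ x ∈ convexHull ℝ (T : Set V) := by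
  rw [convexHull_eq_union] at h
  simp only [Set.mem_iUnion] at h
  obtain ⟨T, hTS, hai, hxT⟩ := h
  have hTS : T ⊆ S := by exact_mod_cast hTS
  have hle : T.card ≤ 4 := by
    have := hai.card_le_finrank_succ
    have h5 := Submodule.finrank_le (vectorSpan ℝ (Set.range ((↑) : T → V)))
    simp at this h5
    omega
  have hge : ¬ T.card ≤ 3 := fun h => hx T hTS h hxT
  exact ⟨T, hTS, good_of_card h3 hTS (by omega) hx hxT, hxT⟩

theorem tri_unique {S : Finset V} {c : V → ℝ} {x : V}
    (hx : ∀ U ⊆ S, U.card ≤ 3 → x ∉ convexHull ℝ (U : Set V)) {T T' : Finset V} (hT : Low S c T) (hT' : Low S c T')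
    (h : x ∈ convexHull ℝ (T : Set V)) (h' : x ∈ convexHull ℝ (T' : Set V)) : T = T' := by
  have main : ∀ T T' : Finset V, Low S c T → Low S c T' → x ∈ convexHull ℝ (T : Set V) →
      ∑ t ∈ T', mu T' x t * c t ≤ ∑ t ∈ T, mu T x t * c t ∧
      (∑ t ∈ T, mu T x t * c t ≤ ∑ t ∈ T', mu T' x t * c t → T ⊆ T') := by
    intro T T' hT hT' h
    have hp := mu_pos h3 hT.1 hT.2.1 hx h
    have k := mu_spec h3 hT.2.1 x
    have e : ∑ t ∈ T', mu T' x t * c t = ∑ u ∈ T, mu T x u * ∑ t ∈ T', mu T' u t * c t := by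
      simp only [Finset.mul_sum]
      rw [Finset.sum_comm]
      refine Finset.sum_congr rfl fun t ht => ?_
      rw [mu_comb h3 hT'.2.1 k.1 k.2 t ht, Finset.sum_mul]
      simp only [mul_assoc]
    have hle : ∀ u ∈ T, ∑ t ∈ T', mu T' u t * c t ≤ c u := by
      intro u hu
      by_cases hu' : u ∈ T'
      · classical
        apply le_of_eq
        have := mu_unique h3 hT'.2.1 (x := u) (μ := Pi.single u 1) (by simp [hu'])
          (by simp [Pi.single_apply, hu', ite_smul])
        rw [Finset.sum_congr rfl fun t ht => by rw [this t ht]]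
        simp [Pi.single_apply, hu']
      · have := hT'.2.2 u (hT.1 hu) hu'
        unfold Dl at this; linarith
    rw [e]
    refine ⟨Finset.sum_le_sum fun u hu => mul_le_mul_of_nonneg_left (hle u hu) (hp u hu).le, fun hge u hu => ?_⟩
    by_contra hu'
    have : ∑ u ∈ T, mu T x u * ∑ t ∈ T', mu T' u t * c t < ∑ u ∈ T, mu T x u * c u := by
      refine Finset.sum_lt_sum (fun u hu => mul_le_mul_of_nonneg_left (hle u hu) (hp u hu).le) ⟨u, hu, ?_⟩
      have := hT'.2.2 u (hT.1 hu) hu'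
      unfold Dl at this
      exact mul_lt_mul_of_pos_left (by linarith) (hp u hu)
    linarith
  have m1 := main T T' hT hT' h
  have m2 := main T' T hT' hT h'
  exact Finset.Subset.antisymm (m1.2 m2.1) (m2.2 m1.1)

theorem tri_exists {S : Finset V} {c : V → ℝ} (hg : Gen S c) {x : V}
    (hx : ∀ U ⊆ S, U.card ≤ 3 → x ∉ convexHull ℝ (U : Set V)) (h : x ∈ convexHull ℝ (S : Set V)) :
    ∃ T, Low S c T ∧ x ∈ convexHull ℝ (T : Set V) := by
  classical
  obtain ⟨T0, hT0S, hT0, hxT0⟩ := exists_good h3 hx h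
  obtain ⟨T, hT, hmin⟩ := Finset.exists_min_image
    (S.powerset.filter fun T => good T ∧ x ∈ convexHull ℝ (T : Set V)) (fun T => ∑ t ∈ T, mu T x t * c t)
    ⟨T0, by simp [hT0S, hT0, hxT0]⟩
  simp only [Finset.mem_filter, Finset.mem_powerset] at hT hmin
  obtain ⟨hTS, hTg, hxT⟩ := hT
  refine ⟨T, ⟨hTS, hTg, fun s hs hsT => ?_⟩, hxT⟩
  by_contra hneg
  have hneg : Dl c T s < 0 := lt_of_le_of_ne (not_lt.1 hneg) (hg T hTS hTg s hs hsT)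
  have hp := mu_pos h3 hTS hTg hx hxT
  have kx := mu_spec h3 hTg x
  have ks := mu_spec h3 hTg s
  obtain ⟨t0, ht0, hmin0⟩ := Finset.exists_min_image (T.filter fun t => 0 < mu T s t)
    (fun t => mu T x t / mu T s t) (by
      by_contra hne
      rw [Finset.not_nonempty_iff_eq_empty, Finset.filter_eq_empty_iff] at hne
      have : ∑ t ∈ T, mu T s t ≤ 0 := Finset.sum_nonpos fun t ht => not_lt.1 (hne ht)
      linarith [ks.1])
  simp only [Finset.mem_filter] at ht0 hmin0
  set θ := mu T x t0 / mu T s t0 with hθ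
  have hθ0 : 0 < θ := div_pos (hp t0 ht0.1) ht0.2
  have hz : mu T x t0 - θ * mu T s t0 = 0 := by rw [hθ]; field_simp [ht0.2.ne']; ring
  let T' := insert s (T.erase t0)
  have hsT' : s ∉ T.erase t0 := fun h => hsT (Finset.mem_of_mem_erase h)
  have hT'S : T' ⊆ S := Finset.insert_subset hs ((Finset.erase_subset _ _).trans hTS)
  have hT'c : T'.card = 4 := by
    rw [Finset.card_insert_of_notMem hsT', Finset.card_erase_of_mem ht0.1, hTg.1]
  let μ : V → ℝ := fun t => if t = s then θ else mu T x t - θ * mu T s t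
  have hμ1 : μ s = θ := by simp [μ]
  have hμ2 : ∀ t ∈ T.erase t0, μ t = mu T x t - θ * mu T s t := by
    intro t ht
    have : t ≠ s := fun h => hsT' (h ▸ ht)
    simp [μ, this]
  have m1 : ∑ t ∈ T', μ t = 1 := by
    rw [sum_pivot hsT' hz hμ1 hμ2 (fun a _ => a) (by simp), Finset.sum_sub_distrib, ← Finset.mul_sum, kx.1, ks.1]; ring
  have m2 : ∑ t ∈ T', μ t • t = x := by
    rw [sum_pivot hsT' hz hμ1 hμ2 (fun a v => a • v) (by simp)]
    simp only [sub_smul, mul_smul, Finset.sum_sub_distrib, ← Finset.smul_sum, kx.2, ks.2]; abel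
  have m0 : ∀ t ∈ T', 0 ≤ μ t := by
    intro t ht
    rcases Finset.mem_insert.1 ht with h | h
    · simp [μ, h, hθ0.le]
    · have h1 : t ≠ s := fun h' => hsT' (h' ▸ h)
      have h2 := Finset.mem_of_mem_erase h
      simp only [μ, h1, if_false]
      by_cases h5 : 0 < mu T s t
      · have := hmin0 t ⟨h2, h5⟩
        rw [le_div_iff₀ h5] at this
        linarith
      · have := hp t h2
        nlinarith [not_lt.1 h5]
  have hxT' : x ∈ convexHull ℝ (T' : Set V) := by
    rw [Finset.mem_convexHull']; exact ⟨μ, m0, m1, m2⟩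
  have hgT' := good_of_card h3 hT'S hT'c hx hxT'
  have := hmin T' ⟨hT'S, hgT', hxT'⟩
  have e : ∑ t ∈ T', mu T' x t * c t = ∑ t ∈ T', μ t * c t :=
    Finset.sum_congr rfl fun t ht => by rw [mu_unique h3 hgT' m1 m2 t ht]
  rw [e, sum_pivot hsT' hz hμ1 hμ2 (fun a v => a * c v) (by simp)] at this
  simp only [sub_mul, Finset.sum_sub_distrib, mul_assoc, ← Finset.mul_sum] at this
  unfold Dl at hneg
  nlinarith

end TRI

section COST
variable {V : Type*} [AddCommGroup V] [Module ℝ V]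
open Filter Topology

lemma Dl_add (c c' : V → ℝ) (T : Finset V) (s : V) : Dl (c + c') T s = Dl c T s + Dl c' T s := by
  simp only [Dl, Pi.add_apply, mul_add, Finset.sum_add_distrib]; ring

lemma Dl_smul (a : ℝ) (c : V → ℝ) (T : Finset V) (s : V) : Dl (a • c) T s = a * Dl c T s := by
  simp only [Dl, Pi.smul_apply, smul_eq_mul, mul_sub, Finset.mul_sum]
  congr 1
  exact Finset.sum_congr rfl fun t _ => by ring

lemma exists_gen_cost (S : Finset V) : ∃ g : V → ℝ, ∀ T ∈ S.powerset, ∀ s ∈ S, s ∉ T → Dl g T s ≠ 0 := by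
  classical
  let y : Finset V × V → (V →₀ ℝ) := fun q => Finsupp.single q.2 1 - ∑ t ∈ q.1, Finsupp.single t (mu q.1 q.2 t)
  let I := (S.powerset ×ˢ S).filter fun q => q.2 ∉ q.1
  obtain ⟨G, hG⟩ := Module.exists_dual_forall_apply_ne_zero (K := ℝ) (fun q : I => y q) (by
    rintro ⟨⟨T, s⟩, hq⟩ h0
    have hs : s ∉ T := (Finset.mem_filter.1 hq).2
    have := DFunLike.congr_fun h0 s
    simp only [y, Finsupp.sub_apply, Finsupp.finset_sum_apply, Finsupp.single_eq_same, Finsupp.coe_zero,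
      Pi.zero_apply] at this
    rw [Finset.sum_eq_zero] at this
    · norm_num at this
    · intro t ht
      rw [Finsupp.single_eq_of_ne]
      rintro rfl; exact hs ht)
  refine ⟨fun v => G (Finsupp.single v 1), fun T hT s hs hsT => ?_⟩
  have := hG ⟨(T, s), Finset.mem_filter.2 ⟨Finset.mem_product.2 ⟨hT, hs⟩, hsT⟩⟩
  convert this using 1
  simp only [Dl, y, map_sub, map_sum]
  congr 1
  refine Finset.sum_congr rfl fun t _ => ?_
  rw [← smul_eq_mul, ← map_smul]; simp

lemma ev_quad (a b g : ℝ) (hg : g ≠ 0) : ∀ᶠ N : ℝ in atTop, (N ^ 2 * a + N * b + g ≠ 0) ∧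
    (0 < N ^ 2 * a + N * b + g → 0 ≤ a ∧ (a = 0 → 0 ≤ b)) ∧ (0 < a → 0 < N ^ 2 * a + N * b + g) := by
  have t0 : Tendsto (fun N : ℝ => N⁻¹) atTop (𝓝 0) := tendsto_inv_atTop_zero
  have t1 : Tendsto (fun N : ℝ => a + b * N⁻¹ + g * (N⁻¹) ^ 2) atTop (𝓝 a) := by
    simpa using (tendsto_const_nhds.add (t0.const_mul b)).add ((t0.pow 2).const_mul g)
  have t2 : Tendsto (fun N : ℝ => b + g * N⁻¹) atTop (𝓝 b) := by
    simpa using tendsto_const_nhds.add (t0.const_mul g)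
  have e1 : ∀ N : ℝ, 0 < N → N ^ 2 * a + N * b + g = N ^ 2 * (a + b * N⁻¹ + g * (N⁻¹) ^ 2) := by
    intro N hN; field_simp
  have e2 : ∀ N : ℝ, 0 < N → N * b + g = N * (b + g * N⁻¹) := by
    intro N hN; field_simp
  rcases lt_trichotomy a 0 with ha | ha | ha
  · filter_upwards [t1.eventually (gt_mem_nhds ha), eventually_gt_atTop 0] with N h1 h2
    have : N ^ 2 * a + N * b + g < 0 := by rw [e1 N h2]; exact mul_neg_of_pos_of_neg (by positivity) h1
    exact ⟨this.ne, fun h => by linarith, fun h => by linarith⟩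
  · subst ha
    rcases lt_trichotomy b 0 with hb | hb | hb
    · filter_upwards [t2.eventually (gt_mem_nhds hb), eventually_gt_atTop 0] with N h1 h2
      have : N * b + g < 0 := by rw [e2 N h2]; exact mul_neg_of_pos_of_neg (by positivity) h1
      rw [mul_zero, zero_add]
      exact ⟨this.ne, fun h => by linarith, fun h => by linarith⟩
    · subst hb
      exact Eventually.of_forall fun N => by simp [hg]
    · filter_upwards [t2.eventually (lt_mem_nhds hb), eventually_gt_atTop 0] with N h1 h2
      have : 0 < N * b + g := by rw [e2 N h2]; exact mul_pos (by positivity) h1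
      rw [mul_zero, zero_add]
      exact ⟨this.ne', fun h => ⟨le_rfl, fun _ => hb.le⟩, fun h => by linarith⟩
  · filter_upwards [t1.eventually (lt_mem_nhds ha), eventually_gt_atTop 0] with N h1 h2
    have : 0 < N ^ 2 * a + N * b + g := by rw [e1 N h2]; exact mul_pos (by positivity) h1
    exact ⟨this.ne', fun h => ⟨ha.le, fun h => by linarith⟩, fun h => this⟩

lemma exists_cost (S : Finset V) (k1 k2 : V → ℝ) : ∃ c, Gen S c ∧
    (∀ T, Low S c T → ∀ s ∈ S, s ∉ T → 0 ≤ Dl k1 T s ∧ (Dl k1 T s = 0 → 0 ≤ Dl k2 T s)) ∧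
    (∀ T ⊆ S, good T → (∀ s ∈ S, s ∉ T → 0 < Dl k1 T s) → Low S c T) := by
  classical
  obtain ⟨g, hg⟩ := exists_gen_cost S
  have hev : ∀ᶠ N : ℝ in atTop, ∀ T ∈ S.powerset, ∀ s ∈ S, s ∉ T →
      (N ^ 2 * Dl k1 T s + N * Dl k2 T s + Dl g T s ≠ 0) ∧
      (0 < N ^ 2 * Dl k1 T s + N * Dl k2 T s + Dl g T s → 0 ≤ Dl k1 T s ∧ (Dl k1 T s = 0 → 0 ≤ Dl k2 T s)) ∧
      (0 < Dl k1 T s → 0 < N ^ 2 * Dl k1 T s + N * Dl k2 T s + Dl g T s) := by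
    rw [Filter.eventually_all_finset]
    intro T hT
    rw [Filter.eventually_all_finset]
    intro s hs
    by_cases hsT : s ∈ T
    · exact Eventually.of_forall fun N h => absurd hsT h
    · filter_upwards [ev_quad (Dl k1 T s) (Dl k2 T s) (Dl g T s) (hg T hT s hs hsT)] with N h _ using h
  obtain ⟨N, hN⟩ := hev.exists
  have e : ∀ T s, Dl (N ^ 2 • k1 + N • k2 + g) T s = N ^ 2 * Dl k1 T s + N * Dl k2 T s + Dl g T s := by
    intro T s; rw [Dl_add, Dl_add, Dl_smul, Dl_smul]
  refine ⟨N ^ 2 • k1 + N • k2 + g, ?_, ?_, ?_⟩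
  · intro T hT _ s hs hsT
    rw [e]; exact (hN T (Finset.mem_powerset.2 hT) s hs hsT).1
  · intro T hT s hs hsT
    have := hT.2.2 s hs hsT
    rw [e] at this
    exact (hN T (Finset.mem_powerset.2 hT.1) s hs hsT).2.1 this
  · intro T hT hg' h
    refine ⟨hT, hg', fun s hs hsT => ?_⟩
    rw [e]
    exact (hN T (Finset.mem_powerset.2 hT) s hs hsT).2.2 (h s hs hsT)

end COST

section DEG
variable {V : Type*} [AddCommGroup V] [Module ℝ V]
open Polynomial Classical

noncomputable def Lp (n w x : V →ₗ[ℝ] ℝ) (d : V) : ℝ[X] := C (n d) * X ^ 3 + C (w d) * X + C (x d)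

noncomputable def dg (n w : V →ₗ[ℝ] ℝ) (d : V) : ℕ := if n d ≠ 0 then 3 else if w d ≠ 0 then 1 else 0

noncomputable def lc (n w x : V →ₗ[ℝ] ℝ) (d : V) : ℝ := if n d ≠ 0 then n d else if w d ≠ 0 then w d else x d

lemma Lp_deg {n w x : V →ₗ[ℝ] ℝ} (F : Frame n w x) {d : V} (hd : d ≠ 0) :
    Lp n w x d ≠ 0 ∧ (Lp n w x d).natDegree = dg n w d ∧ (Lp n w x d).leadingCoeff = lc n w x d := by
  have key : (Lp n w x d).natDegree = dg n w d ∧ (Lp n w x d).coeff (dg n w d) = lc n w x d ∧ lc n w x d ≠ 0 := by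
    unfold Lp dg lc
    by_cases h1 : n d = 0
    · by_cases h2 : w d = 0
      · have h4 : x d ≠ 0 := fun h => hd (F d h1 h2 h)
        simp [h1, h2, h4]
      · simp only [h1, h2, ne_eq, not_true_eq_false, not_false_eq_true, if_true, if_false]
        refine ⟨?_, by simp [coeff_X, coeff_C], trivial⟩
        rw [C_0, zero_mul, zero_add]; exact natDegree_linear h2
    · simp only [h1, ne_eq, not_false_eq_true, if_true]
      refine ⟨?_, by simp [coeff_X, coeff_C], trivial⟩
      have := natDegree_cubic (a := n d) (b := 0) (c := w d) (d := x d) h1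
      simpa using this
  have hlc : (Lp n w x d).leadingCoeff = lc n w x d := by rw [leadingCoeff, key.1, key.2.1]
  refine ⟨fun h => key.2.2 ?_, key.1, hlc⟩
  rw [← hlc, h, leadingCoeff_zero]

noncomputable def DT {K : Type*} [CommRing K] (l : V → K) (Q : Finset V) (T : Finset V) (v : V) : K :=
  ∏ q ∈ Q.offDiag \ (T.erase v).image (fun y => (v, y)), l (q.1 - q.2)

noncomputable def DD {K : Type*} [CommRing K] (l : V → K) (Q : Finset V) : K := ∏ q ∈ Q.offDiag, l (q.1 - q.2)

lemma DT_mul {K : Type*} [CommRing K] (l : V → K) {Q T : Finset V} (hT : T ⊆ Q) {v : V} (hv : v ∈ T) :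
    DT l Q T v * ∏ y ∈ T.erase v, l (v - y) = DD l Q := by
  have hsub : (T.erase v).image (fun y => (v, y)) ⊆ Q.offDiag := by
    intro q hq
    obtain ⟨y, hy, rfl⟩ := Finset.mem_image.1 hq
    rw [Finset.mem_erase] at hy
    exact Finset.mem_offDiag.2 ⟨hT hv, hT hy.2, fun h => hy.1 h.symm⟩
  unfold DT DD
  rw [← Finset.prod_sdiff hsub, Finset.prod_image (fun a _ b _ h => (Prod.mk.inj h).2)]

def Rep {K : Type*} [CommRing K] [Algebra ℝ K] (S Q : Finset V) (l : V → K) (C : Finset V → ℝ)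
    (f : AddMonoidAlgebra K V) : Prop :=
  ∀ c, Gen S c → ∀ v, f.coeff v = ∑ T ∈ S.powerset with (Low S c T ∧ v ∈ T), C T • DT l Q T v

lemma Rep.map {K K' : Type*} [CommRing K] [Algebra ℝ K] [CommRing K'] [Algebra ℝ K'] {S Q : Finset V} {l : V → K}
    {C : Finset V → ℝ} {f : AddMonoidAlgebra K V} (h : Rep S Q l C f) (φ : K →ₐ[ℝ] K') :
    Rep S Q (fun v => φ (l v)) C (AddMonoidAlgebra.mapRingHom V φ.toRingHom f) := by
  intro c hc v
  rw [AddMonoidAlgebra.coeff_mapRingHom]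
  simp only [Finsupp.mapRange_apply, h c hc v]
  simp [DT, map_sum, map_prod]

noncomputable def ds (n w : V →ₗ[ℝ] ℝ) (T : Finset V) (v : V) : ℕ := ∑ y ∈ T.erase v, dg n w (v - y)

lemma prod_deg {n w x : V →ₗ[ℝ] ℝ} (F : Frame n w x) {ι : Type*} (I : Finset ι) (f : ι → V) (hf : ∀ i ∈ I, f i ≠ 0) :
    (∏ i ∈ I, Lp n w x (f i)) ≠ 0 ∧ (∏ i ∈ I, Lp n w x (f i)).natDegree = ∑ i ∈ I, dg n w (f i) ∧
    (∏ i ∈ I, Lp n w x (f i)).leadingCoeff = ∏ i ∈ I, lc n w x (f i) := by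
  refine ⟨Finset.prod_ne_zero_iff.2 fun i hi => (Lp_deg F (hf i hi)).1, ?_, ?_⟩
  · rw [natDegree_prod _ _ fun i hi => (Lp_deg F (hf i hi)).1]
    exact Finset.sum_congr rfl fun i hi => (Lp_deg F (hf i hi)).2.1
  · rw [leadingCoeff_prod]
    exact Finset.prod_congr rfl fun i hi => (Lp_deg F (hf i hi)).2.2

lemma DT_deg {n w x : V →ₗ[ℝ] ℝ} (F : Frame n w x) {Q T : Finset V} (hT : T ⊆ Q) {v : V} (hv : v ∈ T) :
    DT (Lp n w x) Q T v ≠ 0 ∧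
    (DT (Lp n w x) Q T v).natDegree + ds n w T v = (DD (Lp n w x) Q).natDegree ∧
    (DT (Lp n w x) Q T v).leadingCoeff * ∏ y ∈ T.erase v, lc n w x (v - y) = (DD (Lp n w x) Q).leadingCoeff := by
  have h1 := prod_deg F (T.erase v) (fun y => v - y)
    (fun y hy => sub_ne_zero.2 (Finset.ne_of_mem_erase hy).symm)
  have h2 := DT_mul (Lp n w x) hT hv
  have h4 : DD (Lp n w x) Q ≠ 0 := (prod_deg F Q.offDiag (fun q => q.1 - q.2)
    (fun q hq => sub_ne_zero.2 (Finset.mem_offDiag.1 hq).2.2)).1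
  have h5 : DT (Lp n w x) Q T v ≠ 0 := fun h => h4 (by rw [← h2, h, zero_mul])
  refine ⟨h5, ?_, ?_⟩
  · rw [← h2, natDegree_mul h5 h1.1, h1.2.1]; rfl
  · rw [← h2, leadingCoeff_mul, h1.2.2]

variable [FiniteDimensional ℝ V] (h3 : Module.finrank ℝ V = 3)
include h3

lemma good_split {n w x : V →ₗ[ℝ] ℝ} (F : Frame n w x) {T : Finset V} (hT : good T) {v : V} (hv : v ∈ T) :
    ∃ y1 y2 y3, T.erase v = {y1, y2, y3} ∧ y1 ≠ y2 ∧ y1 ≠ y3 ∧ y2 ≠ y3 ∧ dg n w (v - y3) = 3 ∧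
      dg n w (v - y1) ≤ dg n w (v - y2) ∧ dg n w (v - y2) ≠ 0 := by
  have hc : (T.erase v).card = 3 := by rw [Finset.card_erase_of_mem hv, hT.1]
  obtain ⟨y3, hy3, hn3⟩ : ∃ y3 ∈ T.erase v, n (v - y3) ≠ 0 := by
    by_contra hcon
    push Not at hcon
    have h0 : n = 0 := by
      apply hT.2
      have : ∀ u ∈ T, n u = n v := by
        intro u hu
        by_cases h : u = v
        · rw [h]
        · have := hcon u (Finset.mem_erase.2 ⟨h, hu⟩)
          rw [map_sub] at this; linarith
      intro u hu u' hu'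
      rw [this u hu, this u' hu']
    apply F.comb_ne h3 (a := 1) (b := 0) (by simp)
    simp [h0]
  have hc2 : ((T.erase v).erase y3).card = 2 := by rw [Finset.card_erase_of_mem hy3, hc]
  obtain ⟨a, b, hab, hE⟩ := Finset.card_eq_two.1 hc2
  have hT3 : T.erase v = {a, b, y3} := by
    rw [← Finset.insert_erase hy3, hE]
    ext z; simp; tauto
  have ha3 : a ≠ y3 := Finset.ne_of_mem_erase (s := T.erase v) (by rw [hE]; simp)
  have hb3 : b ≠ y3 := Finset.ne_of_mem_erase (s := T.erase v) (by rw [hE]; simp)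
  have h33 : dg n w (v - y3) = 3 := by unfold dg; rw [if_pos hn3]
  have hnot : ¬ (dg n w (v - a) = 0 ∧ dg n w (v - b) = 0) := by
    rintro ⟨q1, q2⟩
    have z : ∀ y, dg n w (v - y) = 0 → n y = n v ∧ w y = w v := by
      intro y hy
      unfold dg at hy
      split_ifs at hy with k1 k2
      · push Not at k1 k2
        rw [map_sub] at k1 k2
        exact ⟨by linarith, by linarith⟩
    have hm := hT.2 (w (v - y3) • n + (- n (v - y3)) • w) (by
      have : ∀ u ∈ T, (w (v - y3) • n + (- n (v - y3)) • w) u = (w (v - y3) • n + (- n (v - y3)) • w) v := by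
        intro u hu
        by_cases h : u = v
        · rw [h]
        · have : u ∈ T.erase v := Finset.mem_erase.2 ⟨h, hu⟩
          rw [hT3] at this
          simp only [Finset.mem_insert, Finset.mem_singleton] at this
          rcases this with h | h | h
          · subst h; simp [z _ q1]
          · subst h; simp [z _ q2]
          · subst h; simp; ring
      intro u hu u' hu'
      rw [this u hu, this u' hu'])
    exact F.comb_ne h3 (Or.inr (neg_ne_zero.2 hn3)) hm
  rcases le_total (dg n w (v - a)) (dg n w (v - b)) with h | h
  · exact ⟨a, b, y3, hT3, hab, ha3, hb3, h33, h, fun h0 => hnot ⟨by omega, h0⟩⟩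
  · exact ⟨b, a, y3, by rw [hT3]; exact Finset.insert_comm _ _ _, hab.symm, hb3, ha3, h33, h,
      fun h0 => hnot ⟨h0, by omega⟩⟩

omit h3 [FiniteDimensional ℝ V] in
lemma dg_cases (n w : V →ₗ[ℝ] ℝ) (d : V) : (dg n w d = 0 ∧ n d = 0 ∧ w d = 0) ∨ (dg n w d = 1 ∧ n d = 0 ∧ w d ≠ 0) ∨
    (dg n w d = 3 ∧ n d ≠ 0) := by
  unfold dg
  split_ifs <;> simp_all

lemma ds_ge {n w x : V →ₗ[ℝ] ℝ} (F : Frame n w x) {T : Finset V} (hT : good T) {v : V} (hv : v ∈ T) :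
    4 ≤ ds n w T v ∧ (ds n w T v = 4 → ∃ y1 y2 y3, T.erase v = {y1, y2, y3} ∧
      n y1 = n v ∧ w y1 = w v ∧ n y2 = n v ∧ w y2 ≠ w v ∧ n y3 ≠ n v) := by
  obtain ⟨y1, y2, y3, hE, h12, h13, h23, d3, d12, d2⟩ := good_split h3 F hT hv
  have hs : ds n w T v = dg n w (v - y1) + (dg n w (v - y2) + dg n w (v - y3)) := by
    rw [ds, hE, Finset.sum_insert (by simp [h12, h13]), Finset.sum_insert (by simp [h23]), Finset.sum_singleton]
  refine ⟨by omega, fun h4 => ⟨y1, y2, y3, hE, ?_⟩⟩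
  rcases dg_cases n w (v - y1) with k1 | k1 | k1
  · rcases dg_cases n w (v - y2) with k2 | k2 | k2
    · omega
    · rcases dg_cases n w (v - y3) with k5 | k5 | k5
      · omega
      · omega
      · simp only [map_sub, sub_eq_zero, ne_eq] at k1 k2 k5
        exact ⟨k1.2.1.symm, k1.2.2.symm, k2.2.1.symm, fun h => k2.2.2 h.symm, fun h => k5.2 h.symm⟩
    · omega
  · omega
  · omega

noncomputable def sb (b : Bool) : ℝ := if b then 1 else -1
noncomputable def sd (σ τ ρ : Bool) (k : ℕ) : ℝ := if k = 3 then sb σ else if k = 1 then sb τ else sb ρ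
noncomputable def EM (σ τ ρ : Bool) (m : ℕ) : ℝ :=
  if m = 4 then sb σ * sb τ * sb ρ else if m = 5 then sb σ else if m = 6 then sb ρ else if m = 7 then sb τ else sb σ

lemma sd_prod {n w x : V →ₗ[ℝ] ℝ} (F : Frame n w x) {T : Finset V} (hT : good T) {v : V} (hv : v ∈ T) (σ τ ρ : Bool) :
    ∏ y ∈ T.erase v, sd σ τ ρ (dg n w (v - y)) = EM σ τ ρ (ds n w T v) := by
  obtain ⟨y1, y2, y3, hE, h12, h13, h23, d3, d12, d2⟩ := good_split h3 F hT hv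
  have hs : ds n w T v = dg n w (v - y1) + (dg n w (v - y2) + dg n w (v - y3)) := by
    rw [ds, hE, Finset.sum_insert (by simp [h12, h13]), Finset.sum_insert (by simp [h23]), Finset.sum_singleton]
  rw [hs, hE, Finset.prod_insert (by simp [h12, h13]), Finset.prod_insert (by simp [h23]), Finset.prod_singleton, d3]
  rcases dg_cases n w (v - y1) with k1 | k1 | k1 <;> rcases dg_cases n w (v - y2) with k2 | k2 | k2 <;>
    first | omega | (rw [k1.1, k2.1]; cases σ <;> cases τ <;> cases ρ <;> norm_num [EM, sd, sb])

omit h3 [FiniteDimensional ℝ V] in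
lemma sd_lc {n w x : V →ₗ[ℝ] ℝ} (F : Frame n w x) {S : Finset V} {σ τ ρ : Bool} {v y : V}
    (hv : v ∈ face3 (sg σ n) (sg τ w) (sg ρ x) S) (hy : y ∈ S) (hne : v ≠ y) :
    0 < sd σ τ ρ (dg n w (v - y)) * lc n w x (v - y) := by
  unfold face3 at hv
  have p1 := mem_face.1 (face_subset (face_subset hv))
  have p2 := mem_face.1 (face_subset hv)
  have p4 := mem_face.1 hv
  have q1 := p1.2 y hy
  have hsb : ∀ b (φ : V →ₗ[ℝ] ℝ), φ (v - y) ≠ 0 → sg b φ y ≤ sg b φ v → 0 < sb b * φ (v - y) := by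
    intro b φ h0 hle
    rw [map_sub] at h0 ⊢
    cases b
    · simp at hle; simp only [sb, Bool.false_eq_true, if_false]
      have : φ v < φ y := lt_of_le_of_ne hle (fun h => h0 (by rw [h, sub_self]))
      linarith
    · simp at hle; simp only [sb, if_true]
      have : φ y < φ v := lt_of_le_of_ne hle (fun h => h0 (by rw [h, sub_self]))
      linarith
  have hsg : ∀ b (φ : V →ₗ[ℝ] ℝ), φ (v - y) = 0 → sg b φ y = sg b φ v := by
    intro b φ h0
    rw [map_sub, sub_eq_zero] at h0
    cases b <;> simp [h0]
  have memF : ∀ (φ : V →ₗ[ℝ] ℝ) (s : Finset V), v ∈ face φ s → y ∈ s → φ y = φ v → y ∈ face φ s := by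
    intro φ s h1 h2 h4
    rw [mem_face] at h1 ⊢
    exact ⟨h2, fun u hu => by rw [h4]; exact h1.2 u hu⟩
  by_cases hn : n (v - y) = 0
  · have y1 := memF _ _ (face_subset (face_subset hv)) hy (hsg σ n hn)
    by_cases hw : w (v - y) = 0
    · have y2 := memF _ _ (face_subset hv) y1 (hsg τ w hw)
      have hx : x (v - y) ≠ 0 := fun h => hne (sub_eq_zero.1 (F _ hn hw h))
      have := hsb ρ x hx (p4.2 y y2)
      simpa [dg, lc, sd, hn, hw] using this
    · have := hsb τ w hw (p2.2 y y1)
      have e1 : dg n w (v - y) = 1 := by unfold dg; rw [if_neg (not_not.2 hn), if_pos hw]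
      have e2 : lc n w x (v - y) = w (v - y) := by unfold lc; rw [if_neg (not_not.2 hn), if_pos hw]
      rw [e1, e2]; exact this
  · have := hsb σ n hn q1
    have e1 : dg n w (v - y) = 3 := by unfold dg; rw [if_pos hn]
    have e2 : lc n w x (v - y) = n (v - y) := by unfold lc; rw [if_pos hn]
    rw [e1, e2]; exact this

theorem GLow {n w x : V →ₗ[ℝ] ℝ} (F : Frame n w x) {S Q : Finset V} (hSQ : S ⊆ Q) {C : Finset V → ℝ}
    (hC : ∀ T, good T → 0 < C T) {f : AddMonoidAlgebra ℝ[X] V} (hf : Rep S Q (Lp n w x) C f) {σ τ ρ : Bool} {v : V}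
    (hv : v ∈ face3 (sg σ n) (sg τ w) (sg ρ x) S) {T0 : Finset V} (hT0S : T0 ⊆ S) (hT0 : good T0) (hvT0 : v ∈ T0) :
    f.coeff v ≠ 0 ∧ (DD (Lp n w x) Q).natDegree ≤ (f.coeff v).natDegree + ds n w T0 v := by
  obtain ⟨c, hgen, -, hlow⟩ := exists_cost S (fun s => if s ∈ T0 then 0 else 1) 0
  have hL0 : Low S c T0 := hlow T0 hT0S hT0 (fun s hs hsT => by
    unfold Dl
    rw [Finset.sum_eq_zero (fun t ht => by simp [ht])]
    simp [hsT])
  obtain ⟨T1, hT1, hmin⟩ := Finset.exists_min_image (S.powerset.filter fun T => Low S c T ∧ v ∈ T)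
    (fun T => ds n w T v) ⟨T0, by simp [hT0S, hL0, hvT0]⟩
  have hm0 := hmin T0 (by simp [hT0S, hL0, hvT0])
  have hT1' := Finset.mem_filter.1 hT1
  set d := (DD (Lp n w x) Q).natDegree with hd
  set k := (DT (Lp n w x) Q T1 v).natDegree with hk
  have hk1 : k + ds n w T1 v = d := (DT_deg F (hT1'.2.1.1.trans hSQ) hT1'.2.2).2.1
  set Z := EM σ τ ρ (ds n w T1 v) * (DD (Lp n w x) Q).leadingCoeff with hZ
  have hpos : ∀ T, Low S c T → v ∈ T → (DT (Lp n w x) Q T v).natDegree = k →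
      0 < (DT (Lp n w x) Q T v).coeff k * Z := by
    intro T hT hvT hdeg
    have a := DT_deg F (hT.1.trans hSQ) hvT
    have hdd : ds n w T v = ds n w T1 v := by omega
    have hl : (DT (Lp n w x) Q T v).coeff k = (DT (Lp n w x) Q T v).leadingCoeff := by rw [← hdeg]; rfl
    rw [hl, hZ, ← hdd, ← sd_prod h3 F hT.2.1 hvT, ← a.2.2]
    have hp : 0 < ∏ y ∈ T.erase v, (sd σ τ ρ (dg n w (v - y)) * lc n w x (v - y)) := by
      refine Finset.prod_pos fun y hy => ?_
      rw [Finset.mem_erase] at hy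
      exact sd_lc F hv (hT.1 hy.2) hy.1.symm
    rw [Finset.prod_mul_distrib] at hp
    have h0 : (DT (Lp n w x) Q T v).leadingCoeff ≠ 0 := leadingCoeff_ne_zero.2 a.1
    have := mul_pos (mul_self_pos.2 h0) hp
    linarith
  have hnn : ∀ T ∈ S.powerset.filter (fun T => Low S c T ∧ v ∈ T),
      0 ≤ C T * ((DT (Lp n w x) Q T v).coeff k * Z) := by
    intro T hT
    have hT' := Finset.mem_filter.1 hT
    have a := DT_deg F (hT'.2.1.1.trans hSQ) hT'.2.2
    have := hmin T hT
    rcases lt_or_eq_of_le (show (DT (Lp n w x) Q T v).natDegree ≤ k by omega) with h | h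
    · rw [coeff_eq_zero_of_natDegree_lt h]; simp
    · exact mul_nonneg (hC T hT'.2.1.2.1).le (hpos T hT'.2.1 hT'.2.2 h).le
  have hco : (f.coeff v).coeff k * Z = ∑ T ∈ S.powerset with (Low S c T ∧ v ∈ T),
      C T * ((DT (Lp n w x) Q T v).coeff k * Z) := by
    rw [hf c hgen v, finset_sum_coeff, Finset.sum_mul]
    exact Finset.sum_congr rfl fun T _ => by rw [coeff_smul, smul_eq_mul, mul_assoc]
  have hlt : 0 < (f.coeff v).coeff k * Z := by
    rw [hco]
    exact Finset.sum_pos' hnn ⟨T1, hT1, mul_pos (hC _ hT1'.2.1.2.1) (hpos T1 hT1'.2.1 hT1'.2.2 rfl)⟩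
  have hne : (f.coeff v).coeff k ≠ 0 := fun h => by rw [h, zero_mul] at hlt; exact lt_irrefl _ hlt
  refine ⟨fun h => hne (by rw [h, coeff_zero]), ?_⟩
  have := le_natDegree_of_ne_zero hne
  omega

end DEG

section GFF
variable {V : Type*} [AddCommGroup V] [Module ℝ V]
open Polynomial Classical

lemma frame_zero {n w x m : V →ₗ[ℝ] ℝ} (F : Frame n w x) {f g h : V} (f1 : n f = 0) (f2 : w f = 0) (f3 : x f ≠ 0)
    (g1 : n g = 0) (g2 : w g ≠ 0) (h1 : n h ≠ 0) (mf : m f = 0) (mg : m g = 0) (mh : m h = 0) : m = 0 := by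
  ext z
  set a := n z / n h
  set b := (w z - a * w h) / w g
  set c := (x z - a * x h - b * x g) / x f
  have ha : a * n h = n z := div_mul_cancel₀ _ h1
  have hb : b * w g = w z - a * w h := div_mul_cancel₀ _ g2
  have hc : c * x f = x z - a * x h - b * x g := div_mul_cancel₀ _ f3
  have : z - a • h - b • g - c • f = 0 := by
    apply F
    · simp [f1, g1, ha]
    · simp [f2]; linarith
    · simp; linarith
  have h5 := congrArg m this
  simp [mf, mg, mh] at h5
  simpa using h5

lemma mk_good {n w x : V →ₗ[ℝ] ℝ} (F : Frame n w x) {v y1 y2 y3 : V} (h1 : n y1 = n v) (h2 : n y2 = n v) (h3 : n y3 ≠ n v)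
    (h4 : w y2 ≠ w v) (h5 : (w y1 = w v ∧ x y1 ≠ x v) ∨ (w y1 = w y2 ∧ x y1 ≠ x y2)) :
    good {v, y1, y2, y3} ∧ ({v, y1, y2, y3} : Finset V).erase v = {y1, y2, y3} ∧ y1 ≠ y2 ∧ y1 ≠ y3 ∧ y2 ≠ y3 := by
  have e1 : v ≠ y2 := fun h => h4 (by rw [h])
  have e2 : v ≠ y3 := fun h => h3 (by rw [h])
  have e3 : y1 ≠ y3 := fun h => h3 (by rw [← h, h1])
  have e4 : y2 ≠ y3 := fun h => h3 (by rw [← h, h2])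
  have e5 : v ≠ y1 := by
    rintro rfl
    rcases h5 with h | h
    · exact h.2 rfl
    · exact h4 h.1.symm
  have e6 : y1 ≠ y2 := by
    rintro rfl
    rcases h5 with h | h
    · exact h4 h.1
    · exact h.2 rfl
  refine ⟨⟨?_, fun m hm => ?_⟩, ?_, e6, e3, e4⟩
  · rw [Finset.card_insert_of_notMem (by simp [e1, e2, e5]), Finset.card_insert_of_notMem (by simp [e6, e3]),
      Finset.card_pair e4]
  · have m1 := hm y1 (by simp) v (by simp)
    have m2 := hm y2 (by simp) v (by simp)
    have m3 := hm y3 (by simp) v (by simp)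
    rcases h5 with h | h
    · exact frame_zero F (f := y1 - v) (g := y2 - v) (h := y3 - v) (by simp [h1]) (by simp [h.1])
        (by rw [map_sub, sub_ne_zero]; exact h.2) (by simp [h2]) (by rw [map_sub, sub_ne_zero]; exact h4)
        (by rw [map_sub, sub_ne_zero]; exact h3) (by simp [m1]) (by simp [m2]) (by simp [m3])
    · exact frame_zero F (f := y1 - y2) (g := y2 - v) (h := y3 - v) (by simp [h1, h2]) (by simp [h.1])
        (by rw [map_sub, sub_ne_zero]; exact h.2) (by simp [h2]) (by rw [map_sub, sub_ne_zero]; exact h4)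
        (by rw [map_sub, sub_ne_zero]; exact h3) (by simp [m1, m2]) (by simp [m2]) (by simp [m3])
  · rw [Finset.erase_insert (by simp [e1, e2, e5])]

lemma good_at [FiniteDimensional ℝ V] (h3 : Module.finrank ℝ V = 3) {S : Finset V} (hpl : ∀ m : V →ₗ[ℝ] ℝ, Cst m S → m = 0)
    {v : V} (hv : v ∈ S) : ∃ T ⊆ S, good T ∧ v ∈ T := by
  obtain ⟨b, hb1, hb2, hb3⟩ := exists_linearIndependent ℝ ((S.image (fun s => s - v) : Finset V) : Set V)
  have hfin : b.Finite := (Finset.finite_toSet _).subset hb1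
  have htop : Submodule.span ℝ b = ⊤ := by
    by_contra hne
    obtain ⟨m, hm0, hm⟩ := Submodule.exists_le_ker_of_lt_top _ (lt_top_iff_ne_top.2 hne)
    apply hm0
    apply hpl
    have : ∀ u ∈ S, m u = m v := by
      intro u hu
      have : u - v ∈ Submodule.span ℝ b := by
        rw [hb2]; exact Submodule.subset_span (by simpa using hu)
      have := hm this
      rw [LinearMap.mem_ker, map_sub] at this; linarith
    intro u hu u' hu'
    rw [this u hu, this u' hu']
  lift b to Finset V using hfin
  have hBc : b.card = 3 := by
    have := finrank_span_finset_eq_card (R := ℝ) (s := b) hb3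
    rw [htop, finrank_top, h3] at this
    exact this.symm
  have hv0 : v ∉ b.image (fun z => z + v) := by
    intro h
    obtain ⟨z, hz, hzv⟩ := Finset.mem_image.1 h
    have hz0 : z = 0 := by simpa using hzv
    have := hb3.ne_zero ⟨z, by exact_mod_cast hz⟩
    exact this hz0
  refine ⟨insert v (b.image (fun z => z + v)), ?_, ⟨?_, fun m hm => ?_⟩, Finset.mem_insert_self _ _⟩
  · intro u hu
    rcases Finset.mem_insert.1 hu with rfl | hu
    · exact hv
    · obtain ⟨z, hz, rfl⟩ := Finset.mem_image.1 hu
      have := hb1 (by exact_mod_cast hz : z ∈ b)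
      obtain ⟨s, hs, rfl⟩ := by simpa using this
      simpa using hs
  · rw [Finset.card_insert_of_notMem hv0, Finset.card_image_of_injective _ (add_left_injective v), hBc]
  · have : Submodule.span ℝ b ≤ LinearMap.ker m := by
      rw [Submodule.span_le]
      intro z hz
      have := hm (z + v) (Finset.mem_insert_of_mem (Finset.mem_image.2 ⟨z, by exact_mod_cast hz, rfl⟩)) v
        (Finset.mem_insert_self _ _)
      simpa using this
    rw [htop] at this
    ext z
    exact this (Submodule.mem_top : z ∈ ⊤)

structure Nice (S : Finset V) : Prop where
  ind : ∀ s ∈ S, s ∉ convexHull ℝ ((S.erase s : Finset V) : Set V)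
  pl : ∀ m : V →ₗ[ℝ] ℝ, Cst m S → m = 0

lemma face3_of {n w x : V →ₗ[ℝ] ℝ} {S : Finset V} {v : V} (hv : v ∈ S) (h1 : ∀ s ∈ S, n s ≤ n v)
    (h2 : ∀ s ∈ S, n s = n v → w s ≤ w v) (h3 : ∀ s ∈ S, n s = n v → w s = w v → x s ≤ x v) :
    v ∈ face3 n w x S := by
  have a1 : v ∈ face n S := mem_face.2 ⟨hv, h1⟩
  have a2 : v ∈ face w (face n S) := mem_face.2 ⟨a1, fun s hs => h2 s (face_subset hs) (face_eq hs a1)⟩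
  exact mem_face.2 ⟨a2, fun s hs => h3 s (face_subset (face_subset hs)) (face_eq (face_subset hs) a1) (face_eq hs a2)⟩

lemma ends_line {n w x : V →ₗ[ℝ] ℝ} (F : Frame n w x) {S : Finset V} (hS : Nice S) {v y u : V} (hv : v ∈ S) (hy : y ∈ S)
    (hu : u ∈ S) (n1 : n y = n v) (w1 : w y = w v) (n2 : n u = n v) (w2 : w u = w v) (hx : x y < x v) : x u ≤ x v := by
  by_contra hlt
  push Not at hlt
  apply hS.ind v hv
  have hp : 0 < x u - x y := by linarith
  set a := (x u - x v) / (x u - x y) with ha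
  set b := (x v - x y) / (x u - x y) with hb
  have hab : a + b = 1 := by rw [ha, hb, ← add_div]; rw [div_eq_one_iff_eq hp.ne']; ring
  have e : v = a • y + b • u := by
    rw [← sub_eq_zero]
    apply F
    · simp only [map_sub, map_add, map_smul, smul_eq_mul, n1, n2]; linear_combination (- n v) * hab
    · simp only [map_sub, map_add, map_smul, smul_eq_mul, w1, w2]; linear_combination (- w v) * hab
    · simp only [map_sub, map_add, map_smul, smul_eq_mul, ha, hb]; field_simp; ring
  have hyv : y ≠ v := fun h => by rw [h] at hx; exact lt_irrefl _ hx
  have huv : u ≠ v := fun h => by rw [h] at hlt; exact lt_irrefl _ hlt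
  have key := (convex_convexHull ℝ ((S.erase v : Finset V) : Set V))
    (subset_convexHull ℝ _ (by simp [hy, hyv] : y ∈ ((S.erase v : Finset V) : Set V)))
    (subset_convexHull ℝ _ (by simp [hu, huv] : u ∈ ((S.erase v : Finset V) : Set V)))
    (div_nonneg (by linarith) hp.le : 0 ≤ a) (div_nonneg (by linarith) hp.le : 0 ≤ b) hab
  rwa [← e] at key

lemma sb_sg (b : Bool) (φ : V →ₗ[ℝ] ℝ) (v : V) : sg b φ v = sb b * φ v := by cases b <;> simp [sb]

lemma of_face3 {n w x : V →ₗ[ℝ] ℝ} {S : Finset V} {v : V} (hv : v ∈ face3 n w x S) : v ∈ S ∧ (∀ s ∈ S, n s ≤ n v) ∧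
    (∀ s ∈ S, n s = n v → w s ≤ w v) ∧ (∀ s ∈ S, n s = n v → w s = w v → x s ≤ x v) := by
  have a2 := face_subset hv
  have a1 := face_subset a2
  have memF : ∀ (φ : V →ₗ[ℝ] ℝ) (s : Finset V) (y : V), v ∈ face φ s → y ∈ s → φ y = φ v → y ∈ face φ s := by
    intro φ s y h1 h2 h4
    rw [mem_face] at h1 ⊢
    exact ⟨h2, fun u hu => by rw [h4]; exact h1.2 u hu⟩
  exact ⟨face_subset a1, (mem_face.1 a1).2, fun s hs hn => (mem_face.1 a2).2 s (memF _ _ _ a1 hs hn),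
    fun s hs hn hw => (mem_face.1 hv).2 s (memF _ _ _ a2 (memF _ _ _ a1 hs hn) hw)⟩

lemma face3_mono {n w x : V →ₗ[ℝ] ℝ} {S s : Finset V} {v : V} (hv : v ∈ face3 n w x S) (hs : s ⊆ S) (hvs : v ∈ s) :
    v ∈ face3 n w x s := by
  obtain ⟨-, h1, h2, h3⟩ := of_face3 hv
  exact face3_of hvs (fun u hu => h1 u (hs hu)) (fun u hu => h2 u (hs hu)) (fun u hu => h3 u (hs hu))

lemma Dl_of {c : V → ℝ} [FiniteDimensional ℝ V] (h3 : Module.finrank ℝ V = 3) {T : Finset V} (hT : good T) (m : V →ₗ[ℝ] ℝ) (a : ℝ)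
    (h : ∀ t ∈ T, c t = m t + a) (s : V) : Dl c T s = c s - (m s + a) := by
  rw [Dl, ← mu_affine h3 hT s m a]
  congr 1
  exact Finset.sum_congr rfl fun t ht => by rw [h t ht]

lemma sign_ex {p q : ℝ} (h : q ≠ p) : ∃ σ : Bool, sb σ * q < sb σ * p := by
  rcases lt_or_gt_of_ne h with h | h
  · exact ⟨true, by simpa [sb] using h⟩
  · exact ⟨false, by simpa [sb] using h⟩

lemma sb_between {p q r : ℝ} {σ : Bool} (h : sb σ * q < sb σ * p) (h2 : 0 ≤ (r - p) * (q - r)) : sb σ * r ≤ sb σ * p := by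
  cases σ
  · simp only [sb, Bool.false_eq_true, if_false] at *
    by_contra hc
    nlinarith
  · simp only [sb, if_true] at *
    by_contra hc
    nlinarith

variable [FiniteDimensional ℝ V] (h3 : Module.finrank ℝ V = 3)
include h3

theorem GFg2 {n w x : V →ₗ[ℝ] ℝ} (F : Frame n w x) {S Q : Finset V} (hS : Nice S) (hSQ : S ⊆ Q) {C : Finset V → ℝ}
    {f : AddMonoidAlgebra ℝ[X] V} (hf : Rep S Q (Lp n w x) C f) {c : C3 V} (hc : Cor n w x S c)
    {v : V} (hv : f.coeff v ≠ 0) : v ∈ S ∧ (f.coeff v).natDegree + 4 ≤ (DD (Lp n w x) Q).natDegree ∧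
    ((f.coeff v).natDegree + 4 = (DD (Lp n w x) Q).natDegree → ∃ σ τ ρ, v = c σ τ ρ ∧ 0 < wd w c σ ∧ 0 < ln x c σ τ) := by
  obtain ⟨c0, hgen, hlow, -⟩ := exists_cost S (fun s => - n s ^ 2) (fun s => - w s ^ 2)
  have e := hf c0 hgen v
  set d := (DD (Lp n w x) Q).natDegree with hd
  set 𝒯 := S.powerset.filter (fun T => Low S c0 T ∧ v ∈ T) with h𝒯
  have hmem : ∀ T ∈ 𝒯, Low S c0 T ∧ v ∈ T := fun T hT => (Finset.mem_filter.1 hT).2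
  have hdeg : ∀ T ∈ 𝒯, (C T • DT (Lp n w x) Q T v).natDegree + ds n w T v ≤ d := by
    intro T hT
    have a := DT_deg F ((hmem T hT).1.1.trans hSQ) (hmem T hT).2
    have := natDegree_smul_le (C T) (DT (Lp n w x) Q T v)
    omega
  obtain ⟨T0, hT0⟩ : 𝒯.Nonempty := by
    rw [Finset.nonempty_iff_ne_empty]
    intro h; rw [h, Finset.sum_empty] at e; exact hv e
  have hbd : ∀ k, (∀ T ∈ 𝒯, k ≤ ds n w T v) → (f.coeff v).natDegree + k ≤ d := by
    intro k hk
    have h1 := hdeg T0 hT0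
    have h2 := hk T0 hT0
    have : (f.coeff v).natDegree ≤ d - k := by
      rw [e]
      refine natDegree_sum_le_of_forall_le _ _ fun T hT => ?_
      have := hdeg T hT
      have := hk T hT
      omega
    omega
  have hge : ∀ T ∈ 𝒯, 4 ≤ ds n w T v := fun T hT => (ds_ge h3 F (hmem T hT).1.2.1 (hmem T hT).2).1
  have hvS : v ∈ S := (hmem T0 hT0).1.1 (hmem T0 hT0).2
  refine ⟨hvS, hbd 4 hge, fun heq => ?_⟩
  obtain ⟨T, hT, hT4⟩ : ∃ T ∈ 𝒯, ds n w T v = 4 := by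
    by_contra hcon
    push Not at hcon
    have := hbd 5 (fun T hT => by have := hge T hT; have := hcon T hT; omega)
    omega
  obtain ⟨hL, hvT⟩ := hmem T hT
  obtain ⟨y1, y2, y3, hE, n1, w1, n2, w2, n3⟩ := (ds_ge h3 F hL.2.1 hvT).2 hT4
  have hTeq : T = {v, y1, y2, y3} := by rw [← Finset.insert_erase hvT, hE]
  have hy1v : y1 ≠ v := Finset.ne_of_mem_erase (s := T) (by rw [hE]; simp)
  have hy1 : y1 ∈ S := hL.1 (by rw [hTeq]; simp)
  have hy2 : y2 ∈ S := hL.1 (by rw [hTeq]; simp)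
  have hD1 : ∀ s, Dl (fun s => - n s ^ 2) T s = (n s - n v) * (n y3 - n s) := by
    intro s
    rw [Dl_of h3 hL.2.1 ((- (n v + n y3)) • n) (n v * n y3)]
    · simp; ring
    · intro t ht
      rw [hTeq] at ht
      simp only [Finset.mem_insert, Finset.mem_singleton] at ht
      rcases ht with rfl | rfl | rfl | rfl <;> simp [n1, n2] <;> ring
  have A1 : ∀ s ∈ S, 0 ≤ (n s - n v) * (n y3 - n s) := by
    intro s hs
    by_cases hsT : s ∈ T
    · rw [hTeq] at hsT
      simp only [Finset.mem_insert, Finset.mem_singleton] at hsT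
      rcases hsT with rfl | rfl | rfl | rfl <;> simp [n1, n2]
    · rw [← hD1]; exact (hlow T hL s hs hsT).1
  have A2 : ∀ s ∈ S, n s = n v → 0 ≤ (w s - w v) * (w y2 - w s) := by
    intro s hs hns
    by_cases hsT : s ∈ T
    · rw [hTeq] at hsT
      simp only [Finset.mem_insert, Finset.mem_singleton] at hsT
      rcases hsT with rfl | rfl | rfl | rfl
      · simp
      · simp [w1]
      · simp
      · exact absurd hns n3
    · have := (hlow T hL s hs hsT).2 (by rw [hD1, hns]; ring)
      set α := (- w y3 ^ 2 + (w v + w y2) * w y3 - w v * w y2) / (n y3 - n v) with hα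
      have hα' : α * (n y3 - n v) = - w y3 ^ 2 + (w v + w y2) * w y3 - w v * w y2 :=
        div_mul_cancel₀ _ (sub_ne_zero.2 n3)
      rw [Dl_of h3 hL.2.1 ((- (w v + w y2)) • w + α • n) (w v * w y2 - α * n v)] at this
      · simp [hns] at this; linarith
      · intro t ht
        rw [hTeq] at ht
        simp only [Finset.mem_insert, Finset.mem_singleton] at ht
        rcases ht with rfl | rfl | rfl | rfl
        · simp; ring
        · simp [n1, w1]; ring
        · simp [n2]; ring
        · simp; linarith
  have x1 : x y1 ≠ x v := fun h => hy1v (sub_eq_zero.1 (F _ (by simp [n1]) (by simp [w1]) (by simp [h])))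
  obtain ⟨σ, hσ⟩ := sign_ex n3
  obtain ⟨τ, hτ⟩ := sign_ex w2
  obtain ⟨ρ, hρ⟩ := sign_ex x1
  have iff : ∀ (b : Bool) (φ : V →ₗ[ℝ] ℝ) (s : V), sg b φ s = sg b φ v → φ s = φ v := by
    intro b φ s h; cases b <;> simpa using h
  have hv3 : v ∈ face3 (sg σ n) (sg τ w) (sg ρ x) S := by
    refine face3_of hvS (fun s hs => ?_) (fun s hs hn => ?_) (fun s hs hn hw => ?_)
    · rw [sb_sg, sb_sg]; exact sb_between hσ (A1 s hs)
    · rw [sb_sg, sb_sg]; exact sb_between hτ (A2 s hs (iff _ _ _ hn))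
    · have F' : Frame n w (sg ρ x) := fun z a b c => F z a b (by cases ρ <;> simpa using c)
      exact ends_line F' hS hvS hy1 hs n1 w1 (iff _ _ _ hn) (iff _ _ _ hw) (by rw [sb_sg, sb_sg]; exact hρ)
  have hvc : v = c σ τ ρ := face3_unique (F.sg σ τ ρ) hv3 (hc σ τ ρ)
  refine ⟨σ, τ, ρ, hvc, ?_, ?_⟩
  · have a1 := hc.w_le σ τ ρ true true hy2 (by rw [n2, hvc])
    have a2 := hc.w_le σ τ ρ false true hy2 (by rw [n2, hvc])
    have b1 := hc.w_le σ τ ρ true true hvS (by rw [hvc])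
    have b2 := hc.w_le σ τ ρ false true hvS (by rw [hvc])
    simp at a1 a2 b1 b2
    unfold wd
    rcases lt_or_gt_of_ne w2 with h | h <;> linarith
  · have a1 := hc.x_le σ τ ρ true hy1 (by rw [n1, hvc]) (by rw [w1, hvc])
    have a2 := hc.x_le σ τ ρ false hy1 (by rw [n1, hvc]) (by rw [w1, hvc])
    have b1 := hc.x_le σ τ ρ true hvS (by rw [hvc]) (by rw [hvc])
    have b2 := hc.x_le σ τ ρ false hvS (by rw [hvc]) (by rw [hvc])
    simp at a1 a2 b1 b2
    unfold ln
    rcases lt_or_gt_of_ne x1 with h | h <;> linarith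

theorem GFof {n w x : V →ₗ[ℝ] ℝ} (F : Frame n w x) {S Q : Finset V} (hS : Nice S) (hSQ : S ⊆ Q) {C : Finset V → ℝ}
    (hC : ∀ T, good T → 0 < C T)
    {f : AddMonoidAlgebra ℝ[X] V} (hf : Rep S Q (Lp n w x) C f) {c : C3 V} (hc : Cor n w x S c) :
    Cor n w x (supp f) c ∧ GF n w x f c (DD (Lp n w x) Q).natDegree ∧ n (c false true true) < n (c true true true) := by
  have hsub : supp f ⊆ S := fun v hv => (GFg2 h3 F hS hSQ hf hc (mem_supp.1 hv)).1
  have hn0 : n ≠ 0 := by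
    have := F.comb_ne h3 (a := 1) (b := 0) (by simp)
    simpa using this
  have hnn : n (c false true true) < n (c true true true) := by
    refine lt_of_le_of_ne (hc.n_le true true (hc.mem _ _ _)) fun h => hn0 (hS.pl n ?_)
    have : ∀ u ∈ S, n u = n (c true true true) := fun u hu =>
      le_antisymm (hc.n_le _ _ hu) (h ▸ hc.le_n true true hu)
    intro u hu u' hu'
    rw [this u hu, this u' hu']
  have hn' : ∀ σ τ ρ, n (c (!σ) true true) ≠ n (c σ τ ρ) := by
    intro σ τ ρ
    rw [hc.n_eq σ τ ρ true true]
    cases σ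
    · exact hnn.ne'
    · exact hnn.ne
  have hw' : ∀ σ τ ρ ρ', 0 < wd w c σ → w (c σ (!τ) ρ') ≠ w (c σ τ ρ) := by
    intro σ τ ρ ρ' h
    rw [hc.w_eq σ τ ρ true, hc.w_eq σ (!τ) ρ' true]
    unfold wd at h
    cases τ
    · exact (sub_pos.1 h).ne'
    · exact (sub_pos.1 h).ne
  have hcne : ∀ σ τ ρ, f.coeff (c σ τ ρ) ≠ 0 := by
    intro σ τ ρ
    obtain ⟨T, hTS, hT, hvT⟩ := good_at h3 hS.pl (hc.mem σ τ ρ)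
    exact (GLow h3 F hSQ hC hf (hc σ τ ρ) hTS hT hvT).1
  have hdg : ∀ v y1 y2 y3 : V, y1 ≠ y2 → y1 ≠ y3 → y2 ≠ y3 → ({v, y1, y2, y3} : Finset V).erase v = {y1, y2, y3} →
      ds n w {v, y1, y2, y3} v = dg n w (v - y1) + (dg n w (v - y2) + dg n w (v - y3)) := by
    intro v y1 y2 y3 h12 h13 h23 hE
    rw [ds, hE, Finset.sum_insert (by simp [h12, h13]), Finset.sum_insert (by simp [h23]), Finset.sum_singleton]
  have d1 : ∀ v y, n y = n v → dg n w (v - y) ≤ 1 := by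
    intro v y h; unfold dg; rw [if_neg (by simp [h])]; split_ifs <;> simp
  have d0 : ∀ v y, n y = n v → w y = w v → dg n w (v - y) = 0 := by
    intro v y h h'; unfold dg; rw [if_neg (by simp [h]), if_neg (by simp [h'])]
  have d3 : ∀ d, dg n w d ≤ 3 := by
    intro d; unfold dg; split_ifs <;> simp
  have hsubT : ∀ a b c' d, a ∈ S → b ∈ S → c' ∈ S → d ∈ S → ({a, b, c', d} : Finset V) ⊆ S := by
    intro a b c' d ha hb hc hd z hz
    simp only [Finset.mem_insert, Finset.mem_singleton] at hz
    rcases hz with rfl | rfl | rfl | rfl <;> assumption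
  refine ⟨fun σ τ ρ => face3_mono (hc σ τ ρ) hsub (mem_supp.2 (hcne σ τ ρ)),
    ⟨fun v hv => (GFg2 h3 F hS hSQ hf hc (mem_supp.1 hv)).2.1, fun v hv => (GFg2 h3 F hS hSQ hf hc (mem_supp.1 hv)).2.2,
      fun σ τ ρ h1 h2 => ?_, fun σ τ ρ h1 h2 => ?_⟩, hnn⟩
  · have e1 := hc.n_eq σ τ (!ρ) τ ρ
    have e2 := hc.w_eq σ τ (!ρ) ρ
    have e3 := hc.n_eq σ (!τ) true τ ρ
    have hx : x (c σ τ (!ρ)) ≠ x (c σ τ ρ) := by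
      unfold ln at h2
      cases ρ
      · exact (sub_pos.1 h2).ne'
      · exact (sub_pos.1 h2).ne
    obtain ⟨g, hE, h12, h13, h23⟩ := mk_good F e1 e3 (hn' σ τ ρ) (hw' σ τ ρ true h1) (Or.inl ⟨e2, hx⟩)
    have := (GLow h3 F hSQ hC hf (hc σ τ ρ) (hsubT _ _ _ _ (hc.mem _ _ _) (hc.mem _ _ _) (hc.mem _ _ _) (hc.mem _ _ _)) g
      (by simp)).2
    rw [hdg _ _ _ _ h12 h13 h23 hE, d0 _ _ e1 e2] at this
    have := d1 _ _ e3
    have := d3 (c σ τ ρ - c (!σ) true true)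
    omega
  · have e1 := hc.n_eq σ (!τ) false τ ρ
    have e3 := hc.n_eq σ (!τ) true τ ρ
    have hx : x (c σ (!τ) false) ≠ x (c σ (!τ) true) := by
      unfold ln at h2
      exact (sub_pos.1 h2).ne
    obtain ⟨g, hE, h12, h13, h23⟩ := mk_good F e1 e3 (hn' σ τ ρ) (hw' σ τ ρ true h1) (Or.inr ⟨hc.w_eq σ (!τ) false true, hx⟩)
    have := (GLow h3 F hSQ hC hf (hc σ τ ρ) (hsubT _ _ _ _ (hc.mem _ _ _) (hc.mem _ _ _) (hc.mem _ _ _) (hc.mem _ _ _)) g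
      (by simp)).2
    rw [hdg _ _ _ _ h12 h13 h23 hE] at this
    have := d1 _ _ e1
    have := d1 _ _ e3
    have := d3 (c σ τ ρ - c (!σ) true true)
    omega

end GFF

section INT
open Set

lemma I1 {κ : ℝ} (hκ : κ ≠ 0) {s : ℝ} (hs : 0 ≤ s) :
    ∫ c, (Icc 0 s).indicator (fun c => Real.exp (κ * c)) c = (Real.exp (κ * s) - 1) / κ := by
  rw [integral_indicator measurableSet_Icc, integral_Icc_eq_integral_Ioc, ← intervalIntegral.integral_of_le hs,
    intervalIntegral.integral_comp_mul_left (fun x => Real.exp x) hκ, integral_exp]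
  simp; field_simp

lemma I1i (κ s : ℝ) : Integrable ((Icc 0 s).indicator (fun c => Real.exp (κ * c))) := by
  rw [integrable_indicator_iff measurableSet_Icc]
  exact Continuous.integrableOn_Icc (by fun_prop)

lemma I2 {β γ : ℝ} (hβ : β ≠ 0) (hγ : γ ≠ 0) (hβγ : β - γ ≠ 0) {s : ℝ} (hs : 0 ≤ s) :
    ∫ y : ℝ × ℝ, (Icc 0 s).indicator (fun b => Real.exp (β * b)) y.1 *
      (Icc 0 (s - y.1)).indicator (fun c => Real.exp (γ * c)) y.2 =
      1 / (β * γ) + Real.exp (β * s) / (β * (β - γ)) - Real.exp (γ * s) / (γ * (β - γ)) := by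
  have hint : Integrable (fun y : ℝ × ℝ => (Icc 0 s).indicator (fun b => Real.exp (β * b)) y.1 *
      (Icc 0 (s - y.1)).indicator (fun c => Real.exp (γ * c)) y.2) := by
    have e : (fun y : ℝ × ℝ => (Icc 0 s).indicator (fun b => Real.exp (β * b)) y.1 *
      (Icc 0 (s - y.1)).indicator (fun c => Real.exp (γ * c)) y.2) =
      {y : ℝ × ℝ | 0 ≤ y.1 ∧ 0 ≤ y.2 ∧ y.1 + y.2 ≤ s}.indicator (fun y => Real.exp (β * y.1) * Real.exp (γ * y.2)) := by
      ext y
      simp only [indicator_apply, mem_Icc, mem_setOf_eq]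
      split_ifs <;> simp_all <;> (exfalso; linarith)
    rw [e, integrable_indicator_iff]
    · refine (Continuous.integrableOn_Icc (a := ((0 : ℝ), (0 : ℝ))) (b := (s, s)) (by fun_prop)).mono_set ?_
      rintro ⟨a, b⟩ ⟨h1, h2, h3⟩
      simp only at h1 h2 h3
      exact ⟨⟨h1, h2⟩, ⟨by simp; linarith, by simp; linarith⟩⟩
    · apply IsClosed.measurableSet
      simp only [setOf_and]
      repeat' apply IsClosed.inter
      all_goals exact isClosed_le (by fun_prop) (by fun_prop)
  rw [show (volume : Measure (ℝ × ℝ)) = (volume : Measure ℝ).prod volume from rfl] at hint ⊢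
  rw [integral_prod _ hint]
  have e : ∀ b, ∫ c, (Icc 0 s).indicator (fun b => Real.exp (β * b)) b *
      (Icc 0 (s - b)).indicator (fun c => Real.exp (γ * c)) c =
      (Real.exp (γ * s) / γ) * (Icc 0 s).indicator (fun b => Real.exp ((β - γ) * b)) b
       - (1 / γ) * (Icc 0 s).indicator (fun b => Real.exp (β * b)) b := by
    intro b
    rw [integral_const_mul]
    by_cases hb : b ∈ Icc 0 s
    · rw [I1 hγ (by linarith [hb.2])]
      simp only [indicator_of_mem hb]
      rw [mul_sub γ, sub_mul, Real.exp_sub, Real.exp_sub]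
      field_simp
    · simp [indicator_of_notMem hb]
  simp only [e]
  rw [integral_sub ((I1i _ _).const_mul _) ((I1i _ _).const_mul _), integral_const_mul, integral_const_mul,
    I1 hβγ hs, I1 hβ hs, sub_mul, Real.exp_sub]
  field_simp
  ring

lemma I3 {α β γ : ℝ} (hα : α ≠ 0) (hβ : β ≠ 0) (hγ : γ ≠ 0) (hβγ : β - γ ≠ 0) (hαβ : α - β ≠ 0) (hαγ : α - γ ≠ 0) :
    ∫ y : ℝ × ℝ × ℝ, {y : ℝ × ℝ × ℝ | 0 ≤ y.1 ∧ 0 ≤ y.2.1 ∧ 0 ≤ y.2.2 ∧ y.1 + y.2.1 + y.2.2 ≤ 1}.indicator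
      (fun y => Real.exp (α * y.1 + β * y.2.1 + γ * y.2.2)) y =
      - 1 / (α * β * γ) + Real.exp α / (α * (α - β) * (α - γ)) - Real.exp β / (β * (α - β) * (β - γ))
        + Real.exp γ / (γ * (α - γ) * (β - γ)) := by
  have hint : Integrable ({y : ℝ × ℝ × ℝ | 0 ≤ y.1 ∧ 0 ≤ y.2.1 ∧ 0 ≤ y.2.2 ∧ y.1 + y.2.1 + y.2.2 ≤ 1}.indicator
      (fun y => Real.exp (α * y.1 + β * y.2.1 + γ * y.2.2))) := by
    rw [integrable_indicator_iff]
    · refine (Continuous.integrableOn_Icc (a := ((0 : ℝ), (0 : ℝ), (0 : ℝ))) (b := (1, 1, 1)) (by fun_prop)).mono_set ?_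
      rintro ⟨a, b, c⟩ ⟨h1, h2, h3, h4⟩
      simp only at h1 h2 h3 h4
      exact ⟨⟨h1, h2, h3⟩, ⟨by simp; linarith, by simp; linarith, by simp; linarith⟩⟩
    · apply IsClosed.measurableSet
      simp only [setOf_and]
      repeat' apply IsClosed.inter
      all_goals exact isClosed_le (by fun_prop) (by fun_prop)
  rw [show (volume : Measure (ℝ × ℝ × ℝ)) = (volume : Measure ℝ).prod volume from rfl] at hint ⊢
  rw [integral_prod _ hint]
  have e : ∀ a, ∫ y : ℝ × ℝ, {y : ℝ × ℝ × ℝ | 0 ≤ y.1 ∧ 0 ≤ y.2.1 ∧ 0 ≤ y.2.2 ∧ y.1 + y.2.1 + y.2.2 ≤ 1}.indicator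
      (fun y => Real.exp (α * y.1 + β * y.2.1 + γ * y.2.2)) (a, y) =
      1 / (β * γ) * (Icc 0 1).indicator (fun a => Real.exp (α * a)) a +
      Real.exp β / (β * (β - γ)) * (Icc 0 1).indicator (fun a => Real.exp ((α - β) * a)) a
       - Real.exp γ / (γ * (β - γ)) * (Icc 0 1).indicator (fun a => Real.exp ((α - γ) * a)) a := by
    intro a
    have : ∀ y : ℝ × ℝ, {y : ℝ × ℝ × ℝ | 0 ≤ y.1 ∧ 0 ≤ y.2.1 ∧ 0 ≤ y.2.2 ∧ y.1 + y.2.1 + y.2.2 ≤ 1}.indicator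
      (fun y => Real.exp (α * y.1 + β * y.2.1 + γ * y.2.2)) (a, y) = (Icc 0 1).indicator (fun a => Real.exp (α * a)) a *
        ((Icc 0 (1 - a)).indicator (fun b => Real.exp (β * b)) y.1 *
      (Icc 0 (1 - a - y.1)).indicator (fun c => Real.exp (γ * c)) y.2) := by
      intro y
      simp only [indicator_apply, mem_Icc, mem_setOf_eq]
      by_cases h : 0 ≤ a ∧ 0 ≤ y.1 ∧ 0 ≤ y.2 ∧ a + y.1 + y.2 ≤ 1
      · obtain ⟨h1, h2, h3, h4⟩ := h
        rw [if_pos ⟨h1, h2, h3, h4⟩, if_pos ⟨h1, by linarith⟩, if_pos ⟨h2, by linarith⟩, if_pos ⟨h3, by linarith⟩,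
          Real.exp_add, Real.exp_add, mul_assoc]
      · rw [if_neg h]
        split_ifs with k1 k2 k3
        · exact absurd ⟨k1.1, k2.1, k3.1, by linarith [k3.2]⟩ h
        all_goals simp
    simp only [this]
    rw [integral_const_mul]
    by_cases ha : a ∈ Icc (0:ℝ) 1
    · rw [I2 hβ hγ hβγ (by linarith [ha.2])]
      simp only [indicator_of_mem ha]
      rw [mul_sub β, mul_sub γ, sub_mul, sub_mul, mul_one, mul_one, Real.exp_sub, Real.exp_sub, Real.exp_sub, Real.exp_sub]
      field_simp
    · simp [indicator_of_notMem ha]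
  simp only [e]
  rw [integral_sub (((I1i _ _).const_mul _).fun_add ((I1i _ _).const_mul _)) ((I1i _ _).const_mul _),
    integral_add ((I1i _ _).const_mul _) ((I1i _ _).const_mul _), integral_const_mul, integral_const_mul, integral_const_mul,
    I1 hα zero_le_one, I1 hαβ zero_le_one, I1 hαγ zero_le_one, mul_one, mul_one, mul_one, Real.exp_sub, Real.exp_sub]
  field_simp
  ring

end INT

section SIMP
abbrev E3 := EuclideanSpace ℝ (Fin 3)
open Classical

lemma h3E : Module.finrank ℝ E3 = 3 := by simp

set_option maxHeartbeats 2000000 in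
lemma simplex {T : Finset E3} (hT : good T) : ∃ C : ℝ, 0 < C ∧ ∀ ψ : E3 →ₗ[ℝ] ℝ,
    (∀ t ∈ T, ∀ t' ∈ T, t ≠ t' → ψ (t - t') ≠ 0) →
    ∫ x in convexHull ℝ (T : Set E3), Real.exp (ψ x) =
      C * ∑ t ∈ T, Real.exp (ψ t) / ∏ y ∈ T.erase t, ψ (t - y) := by
  obtain ⟨v0, v1, v2, v3, h01, h02, h03, h12, h13, h23, hTe⟩ := Finset.card_eq_four.1 hT.1
  set L0 : ℝ × ℝ × ℝ →ₗ[ℝ] E3 :=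
    { toFun := fun p => p.1 • (v1 - v0) + p.2.1 • (v2 - v0) + p.2.2 • (v3 - v0)
      map_add' := fun p q => by simp only [Prod.fst_add, Prod.snd_add, add_smul]; abel
      map_smul' := fun a p => by simp [mul_smul] } with hL0
  have hL : ∀ p, L0 p = p.1 • (v1 - v0) + p.2.1 • (v2 - v0) + p.2.2 • (v3 - v0) := fun p => rfl
  have hsurj : Function.Surjective L0 := by
    rw [← LinearMap.range_eq_top]
    by_contra hne
    obtain ⟨m, hm0, hm⟩ := Submodule.exists_le_ker_of_lt_top _ (lt_top_iff_ne_top.2 hne)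
    have k : ∀ p, m (L0 p) = 0 := fun p => hm ⟨p, rfl⟩
    have k1 := k (1, 0, 0)
    have k2 := k (0, 1, 0)
    have k3 := k (0, 0, 1)
    simp [hL, sub_eq_zero] at k1 k2 k3
    refine hm0 (hT.2 m ?_)
    have : ∀ u ∈ T, m u = m v0 := by
      intro u hu
      rw [hTe] at hu
      simp only [Finset.mem_insert, Finset.mem_singleton] at hu
      rcases hu with rfl | rfl | rfl | rfl <;> simp [*]
    intro u hu u' hu'
    rw [this u hu, this u' hu']
  have hinj : Function.Injective L0 := (LinearMap.injective_iff_surjective_of_finrank_eq_finrank (by simp)).2 hsurj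
  set L := (LinearEquiv.ofBijective L0 ⟨hinj, hsurj⟩).toContinuousLinearEquiv with hLdef
  have hLL : ∀ p, L p = L0 p := fun p => rfl
  have hp2 : (volume : Measure (ℝ × ℝ)).IsAddHaarMeasure :=
    inferInstanceAs (((volume : Measure ℝ).prod (volume : Measure ℝ)).IsAddHaarMeasure)
  have hp3 : (volume : Measure (ℝ × ℝ × ℝ)).IsAddHaarMeasure :=
    inferInstanceAs (((volume : Measure ℝ).prod (volume : Measure (ℝ × ℝ))).IsAddHaarMeasure)
  have hH : (Measure.map L (volume : Measure (ℝ × ℝ × ℝ))).IsAddHaarMeasure := L.isAddHaarMeasure_map _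
  set κ := Measure.addHaarScalarFactor (volume : Measure E3) (Measure.map L (volume : Measure (ℝ × ℝ × ℝ))) with hκ
  have hκ0 : 0 < κ := Measure.addHaarScalarFactor_pos_of_isAddHaarMeasure _ _
  have hvol : (volume : Measure E3) = κ • Measure.map L (volume : Measure (ℝ × ℝ × ℝ)) :=
    Measure.isAddLeftInvariant_eq_smul _ _
  refine ⟨κ, by exact_mod_cast hκ0, fun ψ hψ => ?_⟩
  have hΔ : ∀ p : ℝ × ℝ × ℝ, v0 + L p ∈ convexHull ℝ (T : Set E3) ↔
      p ∈ {y : ℝ × ℝ × ℝ | 0 ≤ y.1 ∧ 0 ≤ y.2.1 ∧ 0 ≤ y.2.2 ∧ y.1 + y.2.1 + y.2.2 ≤ 1} := by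
    intro p
    rw [mem_hull_iff h3E hT]
    have hu := mu_unique h3E hT (x := v0 + L p)
      (μ := fun t => if t = v1 then p.1 else if t = v2 then p.2.1 else if t = v3 then p.2.2 else 1 - p.1 - p.2.1 - p.2.2)
      (by rw [hTe]; simp [h01, h02, h03, h12, h13, h23, h01.symm, h02.symm, h03.symm, h12.symm, h13.symm, h23.symm]; ring)
      (by
        rw [hTe, hLL, hL]
        simp [h01, h02, h03, h12, h13, h23, h01.symm, h02.symm, h03.symm, h12.symm, h13.symm, h23.symm]
        module)
    rw [show (∀ t ∈ T, 0 ≤ mu T (v0 + L p) t) ↔ (∀ t ∈ T, 0 ≤ (if t = v1 then p.1 else if t = v2 then p.2.1 else if t = v3 then p.2.2 else 1 - p.1 - p.2.1 - p.2.2)) from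
      forall₂_congr fun t ht => by rw [hu t ht], hTe]
    simp [h01, h02, h03, h12, h13, h23, h01.symm, h02.symm, h03.symm, h12.symm, h13.symm, h23.symm]
    constructor
    · rintro ⟨a, b, c, d⟩; exact ⟨b, c, d, by linarith⟩
    · rintro ⟨a, b, c, d⟩; exact ⟨by linarith, a, b, c⟩
  have hd : ∀ a ∈ T, ∀ b ∈ T, a ≠ b → ψ a - ψ b ≠ 0 := fun a ha b hb h => by rw [← map_sub]; exact hψ a ha b hb h
  have m0 : v0 ∈ T := by simp [hTe]
  have m1 : v1 ∈ T := by simp [hTe]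
  have m2 : v2 ∈ T := by simp [hTe]
  have m3 : v3 ∈ T := by simp [hTe]
  have hms : MeasurableSet (convexHull ℝ (T : Set E3)) :=
    (Set.Finite.isCompact_convexHull (𝕜 := ℝ) T.finite_toSet).isClosed.measurableSet
  have i3 := I3 (α := ψ v1 - ψ v0) (β := ψ v2 - ψ v0) (γ := ψ v3 - ψ v0) (hd _ m1 _ m0 h01.symm) (hd _ m2 _ m0 h02.symm)
    (hd _ m3 _ m0 h03.symm) (by rw [sub_sub_sub_cancel_right]; exact hd _ m2 _ m3 h23)
    (by rw [sub_sub_sub_cancel_right]; exact hd _ m1 _ m2 h12) (by rw [sub_sub_sub_cancel_right]; exact hd _ m1 _ m3 h13)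
  rw [← integral_indicator hms, ← integral_add_left_eq_self _ v0]
  conv_lhs => rw [hvol]
  rw [integral_smul_nnreal_measure, (show MeasurableEmbedding L from L.toHomeomorph.measurableEmbedding).integral_map]
  have e : ∀ p : ℝ × ℝ × ℝ, (convexHull ℝ (T : Set E3)).indicator (fun x => Real.exp (ψ x)) (v0 + L p) =
      Real.exp (ψ v0) * {y : ℝ × ℝ × ℝ | 0 ≤ y.1 ∧ 0 ≤ y.2.1 ∧ 0 ≤ y.2.2 ∧ y.1 + y.2.1 + y.2.2 ≤ 1}.indicator
      (fun y => Real.exp ((ψ v1 - ψ v0) * y.1 + (ψ v2 - ψ v0) * y.2.1 + (ψ v3 - ψ v0) * y.2.2)) p := by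
    intro p
    by_cases hp : v0 + L p ∈ convexHull ℝ (T : Set E3)
    · rw [Set.indicator_of_mem hp, Set.indicator_of_mem ((hΔ p).1 hp), ← Real.exp_add, hLL, hL]
      congr 1
      simp; ring
    · rw [Set.indicator_of_notMem hp, Set.indicator_of_notMem (fun h => hp ((hΔ p).2 h)), mul_zero]
  simp only [e]
  rw [integral_const_mul, i3, hTe]
  have E0 : ({v0, v1, v2, v3} : Finset E3).erase v0 = {v1, v2, v3} := by ext; simp; grind
  have E1 : ({v0, v1, v2, v3} : Finset E3).erase v1 = {v0, v2, v3} := by ext; simp; grind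
  have E2 : ({v0, v1, v2, v3} : Finset E3).erase v2 = {v0, v1, v3} := by ext; simp; grind
  have E4 : ({v0, v1, v2, v3} : Finset E3).erase v3 = {v0, v1, v2} := by ext; simp; grind
  rw [Finset.sum_insert (by simp [h01, h02, h03]), Finset.sum_insert (by simp [h12, h13]), Finset.sum_insert (by simp [h23]),
    Finset.sum_singleton, E0, E1, E2, E4, Finset.prod_insert (by simp [h12, h13]), Finset.prod_insert (by simp [h23]),
    Finset.prod_singleton, Finset.prod_insert (by simp [h02, h03]), Finset.prod_insert (by simp [h23]),
    Finset.prod_singleton, Finset.prod_insert (by simp [h01, h03]), Finset.prod_insert (by simp [h13]),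
    Finset.prod_singleton, Finset.prod_insert (by simp [h01, h02]), Finset.prod_insert (by simp [h12]),
    Finset.prod_singleton]
  simp only [map_sub, sub_sub_sub_cancel_right, NNReal.smul_def, smul_eq_mul]
  congr 1
  have d10 := hd _ m1 _ m0 h01.symm
  have d20 := hd _ m2 _ m0 h02.symm
  have d30 := hd _ m3 _ m0 h03.symm
  have d12 := hd _ m1 _ m2 h12
  have d13 := hd _ m1 _ m3 h13
  have d23 := hd _ m2 _ m3 h23
  rw [← neg_sub (ψ v1) (ψ v0), ← neg_sub (ψ v2) (ψ v0), ← neg_sub (ψ v3) (ψ v0), ← neg_sub (ψ v1) (ψ v2),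
    ← neg_sub (ψ v1) (ψ v3), ← neg_sub (ψ v2) (ψ v3), Real.exp_sub, Real.exp_sub, Real.exp_sub]
  field_simp
  ring

end SIMP

section EV
open Classical

abbrev RR := MvPolynomial (Fin 3) ℝ

noncomputable def lin (d : E3) : RR := ∑ i, MvPolynomial.C (d i) * MvPolynomial.X i

noncomputable def pz (z : Fin 3 → ℝ) : E3 →ₗ[ℝ] ℝ where
  toFun d := ∑ i, d i * z i
  map_add' a b := by simp [add_mul, Finset.sum_add_distrib]
  map_smul' a b := by simp [Finset.mul_sum, mul_assoc]

lemma eval_lin (z : Fin 3 → ℝ) (d : E3) : MvPolynomial.eval z (lin d) = pz z d := by simp [lin, pz]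

lemma lin_ne {d : E3} (h : d ≠ 0) : lin d ≠ 0 := by
  intro h0
  apply h
  have := fun z => (eval_lin z d).symm.trans (congrArg (MvPolynomial.eval z) h0)
  have h1 := this d
  simp only [pz, map_zero, LinearMap.coe_mk, AddHom.coe_mk] at h1
  rw [Finset.sum_eq_zero_iff_of_nonneg (fun i _ => mul_self_nonneg _)] at h1
  ext i
  simpa using h1 i (Finset.mem_univ i)

noncomputable def evg (z : Fin 3 → ℝ) (k : ℝ) : Multiplicative E3 →* ℝ where
  toFun v := Real.exp (k * pz z v.toAdd)
  map_one' := by simp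
  map_mul' a b := by simp [mul_add, Real.exp_add]

noncomputable def ev (z : Fin 3 → ℝ) (k : ℝ) : AddMonoidAlgebra RR E3 →+* ℝ :=
  AddMonoidAlgebra.liftNCRingHom (MvPolynomial.eval z) (evg z k) (fun _ _ => Commute.all _ _)

lemma ev_single (z : Fin 3 → ℝ) (k : ℝ) (v : E3) (c : RR) :
    ev z k (AddMonoidAlgebra.single v c) = MvPolynomial.eval z c * Real.exp (k * pz z v) :=
  AddMonoidAlgebra.liftNC_single _ _ _ _

lemma ev_st (z : Fin 3 → ℝ) (k : ℝ) (f : AddMonoidAlgebra RR E3) : ev z k (st f) = ev z (-k) f := by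
  induction f using AddMonoidAlgebra.induction_linear with
  | zero => simp
  | add f g hf hg => simp [map_add, hf, hg]
  | single u c => rw [st_single, ev_single, ev_single]; simp

lemma ev_eq (z : Fin 3 → ℝ) (k : ℝ) (f : AddMonoidAlgebra RR E3) :
    ev z k f = ∑ v ∈ supp f, MvPolynomial.eval z (f.coeff v) * Real.exp (k * pz z v) := by
  conv_lhs => rw [← AddMonoidAlgebra.sum_coeff_single f, Finsupp.sum, map_sum]
  simp only [ev_single]; rfl

lemma IND {W : AddMonoidAlgebra RR E3} {D : RR} (hD : D ≠ 0)
    (h : ∀ z, MvPolynomial.eval z D ≠ 0 → ∀ k : ℕ, 0 < k → ev z k W = 0) : W = 0 := by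
  by_contra hW
  obtain ⟨v, hv⟩ := supp_nonempty hW
  have h1 : W.coeff v * D * ∏ q ∈ (supp W).offDiag, lin (q.1 - q.2) ≠ 0 := by
    refine mul_ne_zero (mul_ne_zero (mem_supp.1 hv) hD) (Finset.prod_ne_zero_iff.2 fun q hq => lin_ne ?_)
    exact sub_ne_zero.2 (Finset.mem_offDiag.1 hq).2.2
  obtain ⟨z, hz⟩ : ∃ z, MvPolynomial.eval z (W.coeff v * D * ∏ q ∈ (supp W).offDiag, lin (q.1 - q.2)) ≠ 0 := by
    by_contra hc
    push Not at hc
    exact h1 (MvPolynomial.funext fun z => by rw [hc z, map_zero])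
  rw [map_mul, map_mul, map_prod] at hz
  have hz1 := left_ne_zero_of_mul (left_ne_zero_of_mul hz)
  have hz2 := right_ne_zero_of_mul (left_ne_zero_of_mul hz)
  have hz3 := Finset.prod_ne_zero_iff.1 (right_ne_zero_of_mul hz)
  have := vand (supp W) (fun u => Real.exp (pz z u)) (fun u => MvPolynomial.eval z (W.coeff u) * Real.exp (pz z u)) ?_ ?_ v hv
  · exact mul_ne_zero hz1 (Real.exp_ne_zero _) this
  · intro a ha b hb hab
    by_contra hne
    have := hz3 (a, b) (Finset.mem_offDiag.2 ⟨ha, hb, hne⟩)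
    rw [eval_lin, map_sub] at this
    exact this (sub_eq_zero.2 (Real.exp_injective hab))
  · intro m
    rw [← h z hz2 (m + 1) (Nat.succ_pos m), ev_eq]
    refine Finset.sum_congr rfl fun u _ => ?_
    rw [mul_assoc, ← Real.exp_nat_mul, ← Real.exp_add]
    push_cast
    ring_nf

lemma null_hull {U : Finset E3} (hU : U.card ≤ 3) : volume (convexHull ℝ (U : Set E3)) = 0 := by
  refine measure_mono_null (convexHull_subset_affineSpan _) (Measure.addHaar_affineSubspace _ _ fun htop => ?_)
  have h1 := congrArg AffineSubspace.direction htop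
  rw [direction_affineSpan, AffineSubspace.direction_top] at h1
  have h2 : Module.finrank ℝ (vectorSpan ℝ (U : Set E3)) = 3 := by rw [h1, finrank_top, h3E]
  rcases Nat.eq_zero_or_pos U.card with h0 | h0
  · rw [Finset.card_eq_zero] at h0
    rw [h0, Finset.coe_empty, vectorSpan_empty, finrank_bot] at h2
    omega
  · have := finrank_vectorSpan_image_finset_le ℝ (id : E3 → E3) U (n := U.card - 1) (by omega)
    rw [Finset.coe_image, Set.image_id] at this
    omega

end EV

section PC
open Classical

lemma hull_ms (T : Finset E3) : MeasurableSet (convexHull ℝ (T : Set E3)) :=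
  (Set.Finite.isCompact_convexHull (𝕜 := ℝ) T.finite_toSet).isClosed.measurableSet

lemma hull_int {f : E3 → ℝ} (hf : Continuous f) (T : Finset E3) : IntegrableOn f (convexHull ℝ (T : Set E3)) :=
  hf.continuousOn.integrableOn_compact (Set.Finite.isCompact_convexHull (𝕜 := ℝ) T.finite_toSet)

lemma split_int {S : Finset E3} {c : E3 → ℝ} (hc : Gen S c) {f : E3 → ℝ} (hf : Continuous f) :
    ∫ x in convexHull ℝ (S : Set E3), f x =
      ∑ T ∈ S.powerset with Low S c T, ∫ x in convexHull ℝ (T : Set E3), f x := by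
  have hn : ∀ᵐ x : E3, ∀ U ∈ S.powerset, U.card ≤ 3 → x ∉ convexHull ℝ (U : Set E3) := by
    rw [Filter.eventually_all_finset]
    intro U _
    by_cases hU : U.card ≤ 3
    · filter_upwards [measure_eq_zero_iff_ae_notMem.1 (null_hull hU)] with x hx _ using hx
    · exact Filter.Eventually.of_forall fun x h => absurd h hU
  have e : ∀ T : Finset E3, ∫ x in convexHull ℝ (T : Set E3), f x = ∫ x, (convexHull ℝ (T : Set E3)).indicator f x :=
    fun T => (integral_indicator (hull_ms T)).symm
  simp only [e]
  rw [← integral_finset_sum _ fun T _ => (integrable_indicator_iff (hull_ms T)).2 (hull_int hf T)]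
  apply integral_congr_ae
  filter_upwards [hn] with x hx
  have hx' : ∀ U ⊆ S, U.card ≤ 3 → x ∉ convexHull ℝ (U : Set E3) := fun U hU => hx U (Finset.mem_powerset.2 hU)
  by_cases h : x ∈ convexHull ℝ (S : Set E3)
  · obtain ⟨T, hT, hxT⟩ := tri_exists h3E hc hx' h
    rw [Finset.sum_eq_single_of_mem T (by simp [hT, hT.1]), Set.indicator_of_mem h, Set.indicator_of_mem hxT]
    intro T' hT' hne
    apply Set.indicator_of_notMem
    intro hx2
    exact hne (tri_unique h3E hx' (Finset.mem_filter.1 hT').2 hT hx2 hxT)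
  · rw [Set.indicator_of_notMem h, Finset.sum_eq_zero]
    intro T hT
    apply Set.indicator_of_notMem
    exact fun h2 => h (convexHull_mono (Finset.coe_subset.2 (Finset.mem_filter.1 hT).2.1) h2)

noncomputable def CT (T : Finset E3) : ℝ := if h : good T then (simplex h).choose else 1

lemma CT_pos (T : Finset E3) (h : good T) : 0 < CT T := by
  rw [CT, dif_pos h]; exact (simplex h).choose_spec.1

noncomputable def pc (S Q : Finset E3) (c : E3 → ℝ) : AddMonoidAlgebra RR E3 :=
  ∑ T ∈ S.powerset with Low S c T, ∑ v ∈ T, AddMonoidAlgebra.single v (CT T • DT lin Q T v)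

lemma pc_coeff (S Q : Finset E3) (c : E3 → ℝ) (v : E3) :
    (pc S Q c).coeff v = ∑ T ∈ S.powerset with (Low S c T ∧ v ∈ T), CT T • DT lin Q T v := by
  rw [pc, ← Finset.filter_filter, Finset.sum_filter (fun T => v ∈ T)]
  simp only [AddMonoidAlgebra.coeff_sum, Finsupp.finset_sum_apply, AddMonoidAlgebra.coeff_single, Finsupp.single_apply, Finset.sum_ite_eq']

lemma ev_pc {S Q : Finset E3} (hSQ : S ⊆ Q) {c : E3 → ℝ} (hc : Gen S c) {z : Fin 3 → ℝ}
    (hz : MvPolynomial.eval z (DD lin Q) ≠ 0) {k : ℝ} (hk : k ≠ 0) :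
    ev z k (pc S Q c) = MvPolynomial.eval z (DD lin Q) * (k ^ 3 * ∫ x in convexHull ℝ (S : Set E3), Real.exp ((k • pz z) x)) := by
  have hne : ∀ a ∈ Q, ∀ b ∈ Q, a ≠ b → pz z (a - b) ≠ 0 := by
    intro a ha b hb hab
    rw [DD, map_prod] at hz
    have := Finset.prod_ne_zero_iff.1 hz (a, b) (Finset.mem_offDiag.2 ⟨ha, hb, hab⟩)
    rwa [eval_lin] at this
  rw [split_int hc (by fun_prop), pc, map_sum, Finset.mul_sum, Finset.mul_sum]
  refine Finset.sum_congr rfl fun T hT => ?_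
  have hT := (Finset.mem_filter.1 hT).2
  have hTQ := hT.1.trans hSQ
  have hsp := (simplex hT.2.1).choose_spec.2 (k • pz z) (fun t ht t' ht' h => by
    simpa [hk] using hne _ (hTQ ht) _ (hTQ ht') h)
  rw [hsp, map_sum]
  have hCT : CT T = (simplex hT.2.1).choose := by rw [CT, dif_pos hT.2.1]
  rw [← hCT, Finset.mul_sum, Finset.mul_sum, Finset.mul_sum]
  refine Finset.sum_congr rfl fun v hv => ?_
  have h1 := congrArg (MvPolynomial.eval z) (DT_mul lin hTQ hv)
  rw [map_mul, map_prod] at h1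
  simp only [eval_lin] at h1
  have h2 : ∏ y ∈ T.erase v, pz z (v - y) ≠ 0 := Finset.prod_ne_zero_iff.2 fun y hy =>
    hne _ (hTQ hv) _ (hTQ (Finset.mem_of_mem_erase hy)) (Finset.ne_of_mem_erase hy).symm
  rw [ev_single, ← h1, MvPolynomial.smul_eval]
  simp only [LinearMap.smul_apply, smul_eq_mul, Finset.prod_mul_distrib, Finset.prod_const, Finset.card_erase_of_mem hv, hT.2.1.1, show 4 - 1 = 3 from rfl]
  field_simp
  congr!

theorem exists_p {S Q : Finset E3} (hSQ : S ⊆ Q) : ∃ p : AddMonoidAlgebra RR E3, Rep S Q lin CT p ∧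
    ∀ z, MvPolynomial.eval z (DD lin Q) ≠ 0 → ∀ k : ℝ, k ≠ 0 → ev z k p =
      MvPolynomial.eval z (DD lin Q) * (k ^ 3 * ∫ x in convexHull ℝ (S : Set E3), Real.exp ((k • pz z) x)) := by
  obtain ⟨c0, hc0, -⟩ := exists_cost S 0 0
  refine ⟨pc S Q c0, fun c hc v => ?_, fun z hz k hk => ev_pc hSQ hc0 hz hk⟩
  suffices h : pc S Q c0 = pc S Q c by
    rw [h, pc_coeff]; convert rfl
  rw [← sub_eq_zero]
  refine IND (D := DD lin Q) (Finset.prod_ne_zero_iff.2 fun q hq => lin_ne (sub_ne_zero.2 (Finset.mem_offDiag.1 hq).2.2)) ?_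
  intro z hz k hk
  have hk' : (k : ℝ) ≠ 0 := by positivity
  rw [map_sub, ev_pc hSQ hc0 hz hk', ev_pc hSQ hc hz hk', sub_self]

lemma cov_int {P : Set E3} (hm : MeasurableSet P) (hP : IsCompact P) (ψ : E3 →ₗ[ℝ] ℝ) :
    ∫⁻ t, volume (P ∩ ((fun x => x + t) '' P)) * ENNReal.ofReal (Real.exp (ψ t)) =
      ENNReal.ofReal ((∫ x in P, Real.exp (ψ x)) * ∫ x in P, Real.exp ((-ψ) x)) := by
  have hψ : Continuous ψ := ψ.continuous_of_finiteDimensional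
  set i : E3 → ENNReal := P.indicator 1 with hi
  have him : Measurable i := measurable_one.indicator hm
  have e1 : ∀ t, volume (P ∩ ((fun x => x + t) '' P)) = ∫⁻ x, i x * i (x - t) := by
    intro t
    have hs : (fun x => x + t) '' P = (fun x => x - t) ⁻¹' P := by
      ext x; constructor
      · rintro ⟨y, hy, rfl⟩; simpa using hy
      · intro h; exact ⟨x - t, h, by simp⟩
    rw [hs, ← lintegral_indicator_one (hm.inter (hm.preimage (show Measurable fun x : E3 => x - t from measurable_id.sub_const t)))]
    congr 1; ext x
    simp only [hi, Set.indicator_apply, Set.mem_inter_iff, Set.mem_preimage, Pi.one_apply]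
    by_cases h1 : x ∈ P <;> by_cases h2 : x - t ∈ P <;> simp [h1, h2]
  have e2 : ∀ φ : E3 →ₗ[ℝ] ℝ, ENNReal.ofReal (∫ x in P, Real.exp (φ x)) = ∫⁻ x, i x * ENNReal.ofReal (Real.exp (φ x)) := by
    intro φ
    have hφ : Continuous φ := φ.continuous_of_finiteDimensional
    rw [ofReal_integral_eq_lintegral_ofReal (ContinuousOn.integrableOn_compact hP (by fun_prop)) (Filter.Eventually.of_forall fun x => (Real.exp_pos _).le),
      ← lintegral_indicator hm]
    congr 1; ext x
    by_cases h1 : x ∈ P <;> simp [hi, h1]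
  rw [ENNReal.ofReal_mul (integral_nonneg fun x => (Real.exp_pos _).le), e2, e2]
  simp only [e1]
  have m2 : ∀ φ : E3 →ₗ[ℝ] ℝ, Measurable fun x => ENNReal.ofReal (Real.exp (φ x)) := fun φ =>
    ENNReal.measurable_ofReal.comp (Real.continuous_exp.comp φ.continuous_of_finiteDimensional).measurable
  have hh : ∀ φ : E3 →ₗ[ℝ] ℝ, Measurable fun x => i x * ENNReal.ofReal (Real.exp (φ x)) := fun φ => him.mul (m2 φ)
  calc _ = ∫⁻ t, ∫⁻ x, i x * i (x - t) * ENNReal.ofReal (Real.exp (ψ t)) := by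
        congr 1; ext t
        rw [lintegral_mul_const _ (show Measurable fun x => i x * i (x - t) from him.mul (him.comp (measurable_id.sub_const t)))]
    _ = ∫⁻ x, ∫⁻ t, i x * i (x - t) * ENNReal.ofReal (Real.exp (ψ t)) := by
        apply lintegral_lintegral_swap
        apply Measurable.aemeasurable
        exact ((him.comp measurable_snd).mul (him.comp (measurable_snd.sub measurable_fst))).mul ((m2 ψ).comp measurable_fst)
    _ = ∫⁻ x, i x * ENNReal.ofReal (Real.exp (ψ x)) * ∫⁻ y, i y * ENNReal.ofReal (Real.exp ((-ψ) y)) := by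
        congr 1; ext x
        rw [← lintegral_sub_left_eq_self _ x, ← lintegral_const_mul _ (hh (-ψ))]
        congr 1; ext t
        have : Real.exp (ψ (x - t)) = Real.exp (ψ x) * Real.exp ((-ψ) t) := by
          rw [← Real.exp_add]; simp [sub_eq_add_neg]
        rw [this, ENNReal.ofReal_mul (Real.exp_pos _).le, sub_sub_cancel]
        ring
    _ = _ := by rw [lintegral_mul_const _ (hh ψ)]

theorem pq_eq {S S' Q : Finset E3} {p q : AddMonoidAlgebra RR E3}
    (hp : ∀ z, MvPolynomial.eval z (DD lin Q) ≠ 0 → ∀ k : ℝ, k ≠ 0 → ev z k p =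
      MvPolynomial.eval z (DD lin Q) * (k ^ 3 * ∫ x in convexHull ℝ (S : Set E3), Real.exp ((k • pz z) x)))
    (hq : ∀ z, MvPolynomial.eval z (DD lin Q) ≠ 0 → ∀ k : ℝ, k ≠ 0 → ev z k q =
      MvPolynomial.eval z (DD lin Q) * (k ^ 3 * ∫ x in convexHull ℝ (S' : Set E3), Real.exp ((k • pz z) x)))
    (hcov : ∀ t, volume (convexHull ℝ (S : Set E3) ∩ ((fun x => x + t) '' convexHull ℝ (S : Set E3))) =
      volume (convexHull ℝ (S' : Set E3) ∩ ((fun x => x + t) '' convexHull ℝ (S' : Set E3)))) : p * st p = q * st q := by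
  rw [← sub_eq_zero]
  refine IND (D := DD lin Q) (Finset.prod_ne_zero_iff.2 fun q hq => lin_ne (sub_ne_zero.2 (Finset.mem_offDiag.1 hq).2.2)) ?_
  intro z hz k hk
  have hk' : (k : ℝ) ≠ 0 := by positivity
  have h1 := cov_int (hull_ms S) (Set.Finite.isCompact_convexHull (𝕜 := ℝ) S.finite_toSet) ((k : ℝ) • pz z)
  have h2 := cov_int (hull_ms S') (Set.Finite.isCompact_convexHull (𝕜 := ℝ) S'.finite_toSet) ((k : ℝ) • pz z)
  simp only [hcov] at h1
  rw [h1] at h2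
  have nn : ∀ (P : Set E3) (φ : E3 →ₗ[ℝ] ℝ), 0 ≤ ∫ x in P, Real.exp (φ x) := fun P φ => integral_nonneg fun x => (Real.exp_pos _).le
  rw [ENNReal.ofReal_eq_ofReal_iff (mul_nonneg (nn _ _) (nn _ _)) (mul_nonneg (nn _ _) (nn _ _)), show -((k : ℝ) • pz z) = (-(k : ℝ)) • pz z from (neg_smul _ _).symm] at h2
  rw [map_sub, map_mul, map_mul, ev_st, ev_st, hp z hz _ hk', hp z hz _ (neg_ne_zero.2 hk'), hq z hz _ hk', hq z hz _ (neg_ne_zero.2 hk')]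
  linear_combination (-(MvPolynomial.eval z (DD lin Q)) ^ 2 * (k : ℝ) ^ 6) * h2

end PC

section UFD
variable {V : Type*} [AddCommGroup V] [Module ℝ V] {K : Type*} [CommRing K]
open Classical AddMonoidAlgebra

lemma exists_iota (s : Finset V) : ∃ (m : ℕ) (ι : (Fin m →₀ ℕ) →+ V) (β : V) (Γ : AddSubgroup V), Function.Injective ι ∧
    (s : Set V) ⊆ Γ ∧ (∀ n, ι n ∈ Γ) ∧ ∀ v ∈ Γ, ∀ᶠ M : ℕ in Filter.atTop, ∃ n, ι n = M • β + v := by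
  have : Module.IsTorsionFree ℤ V := Module.IsTorsionFree.trans_faithfulSMul ℤ ℝ V
  set Γ := Submodule.span ℤ (s : Set V)
  have b := Module.finBasis ℤ Γ
  set m := Module.finrank ℤ Γ
  refine ⟨m, (Finsupp.linearCombination ℕ (fun j => (b j : V))).toAddMonoidHom, ∑ j, (b j : V), Γ.toAddSubgroup,
    ?_, Submodule.subset_span, ?_, ?_⟩
  · intro n n' h
    have h1 : ∑ j, (n j) • (b j : V) = ∑ j, (n' j) • (b j : V) := by
      simpa [Finsupp.linearCombination_apply, Finsupp.sum_fintype] using h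
    have h2 : ∑ j, ((n j : ℤ) - n' j) • b j = 0 := by
      apply Subtype.ext
      simp only [sub_smul, natCast_zsmul, Finset.sum_sub_distrib]
      push_cast
      rw [h1, sub_self]
    have h3 := (Fintype.linearIndependent_iff.1 b.linearIndependent) _ h2
    ext j
    have := h3 j
    omega
  · intro n
    simp only [LinearMap.toAddMonoidHom_coe, Finsupp.linearCombination_apply, Finsupp.sum_fintype, zero_smul, implies_true]
    exact sum_mem fun j _ => nsmul_mem (b j).2 _
  · intro v hv
    filter_upwards [Filter.eventually_ge_atTop (∑ j, (b.repr ⟨v, hv⟩ j).natAbs)] with M hM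
    refine ⟨Finsupp.equivFunOnFinite.symm fun j => (M + b.repr ⟨v, hv⟩ j).toNat, ?_⟩
    simp only [LinearMap.toAddMonoidHom_coe, Finsupp.linearCombination_apply, Finsupp.sum_fintype, zero_smul, implies_true,
      Finsupp.equivFunOnFinite_symm_apply_apply]
    have h1 : v = ∑ j, b.repr ⟨v, hv⟩ j • (b j : V) := by
      have := congrArg (Subtype.val) (b.sum_repr ⟨v, hv⟩)
      push_cast at this
      exact this.symm
    conv_rhs => rw [h1, Finset.smul_sum, ← Finset.sum_add_distrib]
    refine Finset.sum_congr rfl fun j _ => ?_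
    have h2 : (b.repr ⟨v, hv⟩ j).natAbs ≤ M := (Finset.single_le_sum (f := fun j => (b.repr ⟨v, hv⟩ j).natAbs) (fun _ _ => Nat.zero_le _) (Finset.mem_univ j)).trans hM
    rw [← natCast_zsmul, ← natCast_zsmul, ← add_smul, Int.toNat_of_nonneg (by omega)]

lemma lift_shift {m : ℕ} {ι : (Fin m →₀ ℕ) →+ V} {β : V} {Γ : AddSubgroup V}
    (h : ∀ v ∈ Γ, ∀ᶠ M : ℕ in Filter.atTop, ∃ n, ι n = M • β + v) {f : AddMonoidAlgebra K V} (hf : ∀ v ∈ supp f, v ∈ Γ) :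
    ∀ᶠ M : ℕ in Filter.atTop, ∃ g, mapDomainRingHom K ι g = single (M • β) 1 * f := by
  have : ∀ᶠ M : ℕ in Filter.atTop, ∀ v ∈ supp f, ∃ n, ι n = M • β + v :=
    (Filter.eventually_all_finset _).2 fun v hv => h v (hf v hv)
  filter_upwards [this] with M hM
  choose! n hn using hM
  refine ⟨∑ v ∈ supp f, single (n v) (f.coeff v), ?_⟩
  conv_rhs => rw [← sum_coeff_single f, Finsupp.sum, Finset.mul_sum]
  rw [map_sum]
  refine Finset.sum_congr rfl fun v hv => ?_
  rw [mapDomainRingHom_apply, mapDomain_single, single_mul_single, one_mul, hn v hv]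

lemma supp_map {m : ℕ} {ι : (Fin m →₀ ℕ) →+ V} {Γ : AddSubgroup V} (h : ∀ n, ι n ∈ Γ) (g : AddMonoidAlgebra K (Fin m →₀ ℕ)) :
    ∀ v ∈ supp (mapDomainRingHom K ι g), v ∈ Γ := by
  induction g using AddMonoidAlgebra.induction_linear with
  | zero => simp [supp]
  | add f g hf hg =>
    intro v hv
    by_contra hc
    have h1 := not_not.1 (fun h => hc (hf v (mem_supp.2 h)))
    have h2 := not_not.1 (fun h => hc (hg v (mem_supp.2 h)))
    rw [mem_supp, map_add] at hv
    exact hv (by rw [AddMonoidAlgebra.coeff_add, Finsupp.add_apply, h1, h2, add_zero])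
  | single u c =>
    intro v hv
    rw [mem_supp, mapDomainRingHom_apply, mapDomain_single, coeff_single, Finsupp.single_apply] at hv
    split_ifs at hv with h1
    · exact h1 ▸ h u
    · exact absurd rfl hv

lemma unit_single [IsDomain K] {U : AddMonoidAlgebra K V} (h : U * st U = 1) : ∃ (κ : V) (r : K), U = single κ r ∧ r * r = 1 := by
  have hU : U ≠ 0 := by rintro rfl; simp at h
  obtain ⟨κ, hκ⟩ := supp_nonempty hU
  have h0 : ∀ v ∈ supp U, v = κ := by
    intro v hv
    rw [← sub_eq_zero, ← Module.forall_dual_apply_eq_zero_iff ℝ]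
    intro φ
    have key : ∀ φ : V →ₗ[ℝ] ℝ, φ v - φ κ ≤ 0 := by
      intro φ
      obtain ⟨a, ha⟩ := face_nonempty (φ := φ) (supp_nonempty hU)
      obtain ⟨b, hb⟩ := face_nonempty (φ := φ) (supp_nonempty (st_ne_zero hU))
      obtain ⟨y, hy⟩ := face_nonempty (φ := φ) (supp_nonempty (mul_ne_zero hU (st_ne_zero hU)))
      have h1 := face_mul φ hU (st_ne_zero hU) ha hb hy
      have h2 : y = 0 := by
        have := (mem_face.1 hy).1
        rw [h, mem_supp, AddMonoidAlgebra.one_def, coeff_single, Finsupp.single_apply] at this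
        by_contra hc
        exact this (if_neg (Ne.symm hc))
      rw [h2, map_zero] at h1
      have h3 := (mem_face.1 ha).2 v hv
      have h4 := (mem_face.1 hb).2 (-κ) (mem_supp_st.2 (by simpa using hκ))
      rw [map_neg] at h4
      linarith
    have h1 := key φ
    have h2 := key (-φ)
    simp only [LinearMap.neg_apply] at h2
    rw [map_sub]; linarith
  have hUe : U = single κ (U.coeff κ) := by
    apply coeff_injective
    ext v
    rw [coeff_single, Finsupp.single_apply]
    split_ifs with hv
    · rw [hv]
    · by_contra hc
      exact hv (h0 v (mem_supp.2 hc)).symm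
  refine ⟨κ, U.coeff κ, hUe, ?_⟩
  rw [hUe, st_single, single_mul_single, add_neg_cancel, AddMonoidAlgebra.one_def] at h
  simpa using congrArg (fun f => f.coeff 0) h

theorem factor [IsDomain K] [UniqueFactorizationMonoid K] {p q : AddMonoidAlgebra K V} (hp : p ≠ 0) (h : p * st p = q * st q) :
    ∃ (A B : AddMonoidAlgebra K V) (κ : V) (r : K), r * r = 1 ∧ p = A * B ∧ q = single κ r * (A * st B) := by
  have hq : q ≠ 0 := by rintro rfl; rw [zero_mul] at h; exact mul_ne_zero hp (st_ne_zero hp) h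
  obtain ⟨m, ι, β, Γ, hι, hs, hΓ, hM⟩ := exists_iota (supp p ∪ supp q)
  have hθ : Function.Injective (mapDomainRingHom K ι) := fun a b hab =>
    mapDomain_injective hι (by simpa only [mapDomainRingHom_apply] using hab)
  set θ : MvPolynomial (Fin m) K →+* AddMonoidAlgebra K V := mapDomainRingHom K ι with hθd
  obtain ⟨M, ⟨p1, hp1⟩, ⟨q1, hq1⟩⟩ := ((lift_shift hM (f := p) fun v hv => hs (by simp [hv])).and
    (lift_shift hM (f := q) fun v hv => hs (by simp [hv]))).exists
  have inv : ∀ s : V, (single s 1 : AddMonoidAlgebra K V) * single (-s) 1 = 1 := fun s => by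
    rw [single_mul_single, add_neg_cancel, mul_one, AddMonoidAlgebra.one_def]
  have e0 : ∀ s : V, (single s 1 : AddMonoidAlgebra K V) ≠ 0 := fun s h0 => by
    have := inv s; rw [h0, zero_mul] at this; exact zero_ne_one this
  have hp10 : p1 ≠ 0 := by
    rintro rfl
    rw [map_zero] at hp1
    exact mul_ne_zero (e0 _) hp hp1.symm
  obtain ⟨b, c, a, hrel, hab, hac⟩ := UniqueFactorizationMonoid.exists_reduced_factors (R := MvPolynomial (Fin m) K) p1 hp10 q1
  change θ p1 = _ at hp1
  change θ q1 = _ at hq1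
  obtain ⟨N, ⟨b1, hb1⟩, ⟨c1, hc1⟩⟩ := ((lift_shift hM (f := st (θ b)) fun v hv => by
      have := supp_map hΓ b _ (mem_supp_st.1 hv); simpa using this).and
    (lift_shift hM (f := st (θ c)) fun v hv => by
      have := supp_map hΓ c _ (mem_supp_st.1 hv); simpa using this)).exists
  change θ b1 = _ at hb1
  change θ c1 = _ at hc1
  have hqe : q1 ≠ 0 := by
    rintro rfl
    rw [map_zero] at hq1
    exact mul_ne_zero (e0 _) hq hq1.symm
  have ha0 : a ≠ 0 := by rintro rfl; rw [zero_mul] at hab; exact hp10 hab.symm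
  have hb0 : b ≠ 0 := by rintro rfl; rw [mul_zero] at hab; exact hp10 hab.symm
  have hc0 : c ≠ 0 := by rintro rfl; rw [mul_zero] at hac; exact hqe hac.symm
  have i0 : ∀ {g : MvPolynomial (Fin m) K}, g ≠ 0 → θ g ≠ 0 := fun hg h0 => hg (hθ (by rw [map_zero]; exact h0))
  have h1 : θ b * st (θ b) = θ c * st (θ c) := by
    have h2 : θ a * st (θ a) ≠ 0 := mul_ne_zero (i0 ha0) (st_ne_zero (i0 ha0))
    apply mul_left_cancel₀ h2
    have e1 : θ a * θ b = single (M • β) 1 * p := by rw [← map_mul, hab, hp1]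
    have e2 : θ a * θ c = single (M • β) 1 * q := by rw [← map_mul, hac, hq1]
    have e3 := congrArg st e1
    have e4 := congrArg st e2
    rw [map_mul, map_mul] at e3 e4
    linear_combination (exp := 1) st (θ a) * st (θ b) * e1 + (single (M • β) 1 * p) * e3 - st (θ a) * st (θ c) * e2 -
      (single (M • β) 1 * q) * e4 + single (M • β) 1 * st (single (M • β) 1) * h
  have h2 : b * b1 = c * c1 := by
    apply hθ
    change θ (b * b1) = θ (c * c1)
    rw [map_mul, map_mul, hb1, hc1]
    linear_combination single (N • β) 1 * h1
  obtain ⟨u, hu⟩ := hrel.dvd_of_dvd_mul_left (Dvd.intro b1 h2)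
  have h3 : b1 = c * u := mul_left_cancel₀ hb0 (by rw [h2, hu]; ring)
  rw [hu, map_mul] at hc1
  rw [h3, map_mul] at hb1
  have h4 : θ u * st (θ u) = 1 := by
    have e3 := congrArg st hc1
    rw [map_mul, map_mul, st_st, st_single] at e3
    apply mul_left_cancel₀ (i0 hc0)
    linear_combination st (θ u) * hb1 + single (N • β) 1 * e3 + θ c * inv (N • β)
  obtain ⟨κ, r, hU, hr⟩ := unit_single h4
  have h5 : θ c = single (N • β - κ) r * st (θ b) := by
    have e3 := congrArg st hc1
    rw [map_mul, map_mul, st_st, st_single, hU, st_single] at e3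
    have e4 : (single (N • β - κ) r : AddMonoidAlgebra K V) = single (N • β) 1 * single (-κ) r := by
      rw [single_mul_single, one_mul, sub_eq_add_neg]
    rw [e4]
    linear_combination (- single (N • β) 1) * e3 - θ c * inv (N • β)
  have ee : ∀ (x y : V) (r s : K), (single x r : AddMonoidAlgebra K V) * single y s = single (x + y) (r * s) := fun x y r s => single_mul_single ..
  refine ⟨θ a, single (-(M • β)) 1 * θ b, -(M • β) + (N • β - κ) - M • β, r, hr, ?_, ?_⟩
  · have e1 : θ a * θ b = single (M • β) 1 * p := by rw [← map_mul, hab, hp1]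
    linear_combination (-single (-(M • β)) 1) * e1 - p * inv (M • β)
  · have e2 : θ a * θ c = single (M • β) 1 * q := by rw [← map_mul, hac, hq1]
    rw [h5] at e2
    rw [map_mul, st_single, neg_neg]
    have e4 : (single (-(M • β) + (N • β - κ) - M • β) r : AddMonoidAlgebra K V) = single (-(M • β)) 1 * single (N • β - κ) r * single (-(M • β)) 1 := by
      rw [ee, ee, one_mul, mul_one, ← sub_eq_add_neg]
    rw [e4]
    linear_combination (-single (-(M • β)) 1) * e2 + (-q - single (-(M • β)) 1 * single (N • β - κ) r * θ a * st (θ b)) * inv (M • β)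

end UFD

section LINK
open Classical Polynomial

lemma cor_unique {V : Type*} [AddCommGroup V] [Module ℝ V] {n w x : V →ₗ[ℝ] ℝ} (F : Frame n w x) {s : Finset V} {c c' : C3 V}
    (h : Cor n w x s c) (h' : Cor n w x s c') : c = c' := by
  funext σ τ ρ
  exact face3_unique (F.sg σ τ ρ) (h σ τ ρ) (h' σ τ ρ)

lemma shift_coeff {V : Type*} [AddCommGroup V] {K : Type*} [CommRing K] (κ : V) (r : K) (f : AddMonoidAlgebra K V) (v : V) :
    (AddMonoidAlgebra.single κ r * f).coeff (κ + v) = r * f.coeff v := AddMonoidAlgebra.coeff_single_mul_add ..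

lemma GF.shift {V : Type*} [AddCommGroup V] [Module ℝ V] {n w x : V →ₗ[ℝ] ℝ} {κ : V} {r : ℝ[X]} (hr : r * r = 1)
    {f : AddMonoidAlgebra ℝ[X] V} {c : C3 V} {d : ℕ} (h : GF n w x (AddMonoidAlgebra.single κ r * f) ((fun _ _ _ => κ) + c) d) :
    GF n w x f c d := by
  have hu : IsUnit r := IsUnit.of_mul_eq_one _ hr
  have hr0 : r ≠ 0 := hu.ne_zero
  have hdeg : ∀ v, ((AddMonoidAlgebra.single κ r * f).coeff (κ + v)).natDegree = (f.coeff v).natDegree := by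
    intro v
    rw [shift_coeff]
    by_cases h0 : f.coeff v = 0
    · rw [h0, mul_zero]
    · rw [natDegree_mul hr0 h0, natDegree_eq_zero_of_isUnit hu, zero_add]
  have hs : ∀ v ∈ supp f, κ + v ∈ supp (AddMonoidAlgebra.single κ r * f) := fun v hv => by
    rw [mem_supp, shift_coeff]; exact mul_ne_zero hr0 (mem_supp.1 hv)
  have hw : ∀ σ, wd w ((fun _ _ _ => κ) + c) σ = wd w c σ := fun σ => by simp [wd]
  have hl : ∀ σ τ, ln x ((fun _ _ _ => κ) + c) σ τ = ln x c σ τ := fun σ τ => by simp [ln]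
  refine ⟨fun v hv => ?_, fun v hv hd => ?_, fun σ τ ρ h1 h2 => ?_, fun σ τ ρ h1 h2 => ?_⟩
  · rw [← hdeg]; exact h.g1 _ (hs v hv)
  · obtain ⟨σ, τ, ρ, e, h1, h2⟩ := h.g2 _ (hs v hv) (by rw [hdeg]; exact hd)
    rw [hw] at h1; rw [hl] at h2
    exact ⟨σ, τ, ρ, add_left_cancel e, h1, h2⟩
  · rw [← hdeg]; exact h.l1 σ τ ρ (by rwa [hw]) (by rwa [hl])
  · rw [← hdeg]; exact h.l2 σ τ ρ (by rwa [hw]) (by rwa [hl])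

noncomputable def sub3 (n w x : E3 →ₗ[ℝ] ℝ) : RR →ₐ[ℝ] ℝ[X] :=
  MvPolynomial.aeval fun i => Lp n w x (EuclideanSpace.single i 1)

lemma sub3_lin (n w x : E3 →ₗ[ℝ] ℝ) (d : E3) : sub3 n w x (lin d) = Lp n w x d := by
  have hd : d = ∑ i, d i • EuclideanSpace.single i (1 : ℝ) := by
    ext j; simp [Finset.sum_apply, Pi.single_apply]
  have e : ∀ φ : E3 →ₗ[ℝ] ℝ, φ d = ∑ i, d i * φ (EuclideanSpace.single i 1) := by
    intro φ; conv_lhs => rw [hd, map_sum]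
    simp
  simp only [lin, sub3, map_sum, map_mul, MvPolynomial.aeval_X, MvPolynomial.aeval_C]
  simp only [Lp, e n, e w, e x, map_sum, map_mul, Finset.sum_mul, ← Finset.sum_add_distrib]
  refine Finset.sum_congr rfl fun i _ => ?_
  rw [show algebraMap ℝ ℝ[X] (d i) = C (d i) from rfl]
  ring

noncomputable def sb3 (n w x : E3 →ₗ[ℝ] ℝ) : AddMonoidAlgebra RR E3 →+* AddMonoidAlgebra ℝ[X] E3 :=
  AddMonoidAlgebra.mapRingHom E3 (sub3 n w x).toRingHom

lemma sb3_coeff (n w x : E3 →ₗ[ℝ] ℝ) (f : AddMonoidAlgebra RR E3) (v : E3) :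
    (sb3 n w x f).coeff v = sub3 n w x (f.coeff v) := by
  rw [sb3, AddMonoidAlgebra.coeff_mapRingHom]; simp

lemma sb3_st (n w x : E3 →ₗ[ℝ] ℝ) (f : AddMonoidAlgebra RR E3) : sb3 n w x (st f) = st (sb3 n w x f) := by
  apply AddMonoidAlgebra.coeff_injective
  ext1 v
  rw [sb3_coeff, st_coeff, st_coeff, sb3_coeff]

lemma supp_sb3 {n w x : E3 →ₗ[ℝ] ℝ} {f : AddMonoidAlgebra RR E3} : supp (sb3 n w x f) ⊆ supp f := by
  intro v hv
  rw [mem_supp, sb3_coeff] at hv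
  rw [mem_supp]; intro h0; exact hv (by rw [h0, map_zero])

lemma supp_Rep {V : Type*} [AddCommGroup V] [Module ℝ V] {K : Type*} [CommRing K] [Algebra ℝ K] {l : V → K} {C : Finset V → ℝ}
    {S Q : Finset V} {p : AddMonoidAlgebra K V} (h : Rep S Q l C p) : supp p ⊆ S := by
  intro v hv
  obtain ⟨c, hc, -⟩ := exists_cost S 0 0
  rw [mem_supp, h c hc v] at hv
  obtain ⟨T, hT, -⟩ := Finset.exists_ne_zero_of_sum_ne_zero hv
  have hT := Finset.mem_filter.1 hT
  exact hT.2.1.1 hT.2.2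

lemma cor_link {n w x : E3 →ₗ[ℝ] ℝ} (F : Frame n w x) {S Q : Finset E3} (hS : Nice S) (hSQ : S ⊆ Q)
    {p : AddMonoidAlgebra RR E3} (h : Rep S Q lin CT p) {c : C3 E3} (hc : Cor n w x S c) :
    Cor n w x (supp p) c ∧ Cor n w x (supp (sb3 n w x p)) c ∧ GF n w x (sb3 n w x p) c (DD (Lp n w x) Q).natDegree := by
  have h1 := h.map (sub3 n w x)
  simp only [sub3_lin] at h1
  obtain ⟨h2, h4, -⟩ := GFof h3E F hS hSQ CT_pos h1 hc
  exact ⟨fun σ τ ρ => face3_mono (hc σ τ ρ) (supp_Rep h) (supp_sb3 (h2.mem σ τ ρ)), h2, h4⟩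

lemma sys_of {n w x : E3 →ₗ[ℝ] ℝ} (F : Frame n w x) {S S' Q : Finset E3} (hS : Nice S) (hS' : Nice S') (hSQ : S ⊆ Q)
    (hSQ' : S' ⊆ Q) {A B : AddMonoidAlgebra RR E3} {κ : E3} {r : RR} (hr : r * r = 1) (hA : A ≠ 0) (hB : B ≠ 0)
    (hp : Rep S Q lin CT (A * B)) (hq : Rep S' Q lin CT (AddMonoidAlgebra.single κ r * (A * st B))) {a b : C3 E3}
    (ha : Cor n w x (supp A) a) (hb : Cor n w x (supp B) b) (nA : ¬ Cst n (supp A)) (nB : ¬ Cst n (supp B)) :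
    Sys n w x (sb3 n w x A) (sb3 n w x B) a b (DD (Lp n w x) Q).natDegree := by
  have hn : ∀ {s : Finset E3} {c : C3 E3}, Cor n w x s c → ¬ Cst n s → n (c false true true) < n (c true true true) := by
    intro s c hc hs
    by_contra hlt
    apply hs
    intro u hu v hv
    have h1 := hc.n_le true true hu; have h2 := hc.le_n true true hu
    have h3 := hc.n_le true true hv; have h4 := hc.le_n true true hv
    linarith
  have sne : ∀ {S : Finset E3}, Nice S → S.Nonempty := by
    intro S hS
    by_contra h0
    rw [Finset.not_nonempty_iff_eq_empty] at h0
    have hz : ∀ m : E3 →ₗ[ℝ] ℝ, m = 0 := fun m => hS.pl m (by rw [h0]; intro u hu; simp at hu)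
    exact nA fun u _ v _ => by rw [hz n]; simp
  obtain ⟨c, hc⟩ := exists_cor n w x (sne hS)
  obtain ⟨c', hc'⟩ := exists_cor n w x (sne hS')
  obtain ⟨p1, p2, p3⟩ := cor_link F hS hSQ hp hc
  obtain ⟨q1, q2, q3⟩ := cor_link F hS' hSQ' hq hc'
  have hcab : c = a + b := cor_unique F p1 (Cor.add F hA hB ha hb)
  subst hcab
  have hco : ∀ σ τ ρ, sub3 n w x (A.coeff (a σ τ ρ)) ≠ 0 ∧ sub3 n w x (B.coeff (b σ τ ρ)) ≠ 0 := by
    intro σ τ ρ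
    have h1 := p2.mem σ τ ρ
    have h2 := (face3_mul (F.sg σ τ ρ) hA hB (ha σ τ ρ) (hb σ τ ρ)).2
    rw [mem_supp, sb3_coeff] at h1
    rw [show (a + b) σ τ ρ = a σ τ ρ + b σ τ ρ from rfl, h2, map_mul] at h1
    exact ⟨left_ne_zero_of_mul h1, right_ne_zero_of_mul h1⟩
  have hA1 : ∀ σ τ ρ, a σ τ ρ ∈ supp (sb3 n w x A) := fun σ τ ρ => by rw [mem_supp, sb3_coeff]; exact (hco σ τ ρ).1
  have hB1 : ∀ σ τ ρ, b σ τ ρ ∈ supp (sb3 n w x B) := fun σ τ ρ => by rw [mem_supp, sb3_coeff]; exact (hco σ τ ρ).2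
  have hA0 : sb3 n w x A ≠ 0 := fun h0 => by have := hA1 true true true; rw [h0] at this; simp [supp] at this
  have hB0 : sb3 n w x B ≠ 0 := fun h0 => by have := hB1 true true true; rw [h0] at this; simp [supp] at this
  have ca : Cor n w x (supp (sb3 n w x A)) a := fun σ τ ρ => face3_mono (ha σ τ ρ) supp_sb3 (hA1 σ τ ρ)
  have cb : Cor n w x (supp (sb3 n w x B)) b := fun σ τ ρ => face3_mono (hb σ τ ρ) supp_sb3 (hB1 σ τ ρ)
  refine ⟨F, hA0, hB0, ca, cb, hn ha nA, hn hb nB, by rw [← map_mul]; exact p3, ?_⟩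
  have hr' : sub3 n w x r * sub3 n w x r = 1 := by rw [← map_mul, hr, map_one]
  have hr0 : sub3 n w x r ≠ 0 := (IsUnit.of_mul_eq_one _ hr').ne_zero
  have hsq : sb3 n w x (AddMonoidAlgebra.single κ r * (A * st B)) =
      AddMonoidAlgebra.single κ (sub3 n w x r) * (sb3 n w x A * st (sb3 n w x B)) := by
    rw [map_mul, map_mul, sb3_st, sb3, AddMonoidAlgebra.mapRingHom_single]; rfl
  rw [hsq] at q2 q3
  have hk : Cor n w x (supp (AddMonoidAlgebra.single κ (sub3 n w x r) : AddMonoidAlgebra ℝ[X] E3)) (fun _ _ _ => κ) := by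
    have : supp (AddMonoidAlgebra.single κ (sub3 n w x r) : AddMonoidAlgebra ℝ[X] E3) = {κ} := by
      rw [supp, AddMonoidAlgebra.coeff_single, Finsupp.support_single_ne_zero _ hr0]
    rw [this]
    intro σ τ ρ
    have : ∀ (φ : E3 →ₗ[ℝ] ℝ), face φ {κ} = {κ} := fun φ => by
      ext v; rw [mem_face]; simp; rintro rfl; rfl
    simp [face3, this]
  have hs0 : (AddMonoidAlgebra.single κ (sub3 n w x r) : AddMonoidAlgebra ℝ[X] E3) ≠ 0 := fun h0 => by
    have := hk.mem true true true; rw [h0] at this; simp [supp] at this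
  have hcc := cor_unique F q2 (Cor.add F hs0 (mul_ne_zero hA0 (st_ne_zero hB0)) hk
    (Cor.add F hA0 (st_ne_zero hB0) ca (cb.neg fun v => mem_supp_st)))
  rw [hcc] at q3
  exact q3.shift hr'

theorem sym_or {S S' Q : Finset E3} (hS : Nice S) (hS' : Nice S') (hSQ : S ⊆ Q)
    (hSQ' : S' ⊆ Q) {A B : AddMonoidAlgebra RR E3} {κ : E3} {r : RR} (hr : r * r = 1) (hA : A ≠ 0) (hB : B ≠ 0)
    (hp : Rep S Q lin CT (A * B)) (hq : Rep S' Q lin CT (AddMonoidAlgebra.single κ r * (A * st B)))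
    (hface : ∀ u : E3 →ₗ[ℝ] ℝ, ∃ v ∈ supp (A * B), v ∈ face u S) :
    Sym (supp A) ∨ Sym (supp B) := by
  refine closing h3E (supp_nonempty hA) (supp_nonempty hB) (fun n w x a b F ha hb nA nB =>
      (sys_of F hS hS' hSQ hSQ' hr hA hB hp hq ha hb nA nB).FL)
    (fun n w x b a F hb ha nB nA => (sys_of F hS hS' hSQ hSQ' hr hA hB hp hq ha hb nA nB).swap.FL) ?_
  rintro m hm ⟨h1, h2⟩
  apply hm
  apply hS.pl
  have h3 : Cst m (supp (A * B)) := by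
    intro u hu v hv
    obtain ⟨a, ha, b, hb, rfl⟩ := supp_mul hu
    obtain ⟨a', ha', b', hb', rfl⟩ := supp_mul hv
    rw [map_add, map_add, h1 a ha a' ha', h2 b hb b' hb']
  obtain ⟨v, hv, hv1⟩ := hface m
  obtain ⟨v', hv', hv1'⟩ := hface (-m)
  have e := h3 v hv v' hv'
  have key : ∀ s ∈ S, m s = m v := fun s hs => by
    have h5 := (mem_face.1 hv1).2 s hs
    have h6 := (mem_face.1 hv1').2 s hs
    simp at h6
    linarith
  intro s hs t ht
  rw [key s hs, key t ht]

end LINK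

section FIN
open Classical

lemma hb {K : Set E3} (hc : Convex ℝ K) (hcl : IsClosed K) {s : E3} (h : ∀ u : E3 →ₗ[ℝ] ℝ, ∃ y ∈ K, u s ≤ u y) : s ∈ K := by
  by_contra hs
  obtain ⟨f, t, h1, h2⟩ := geometric_hahn_banach_closed_point hc hcl hs
  obtain ⟨y, hy, h3⟩ := h f.toLinearMap
  have h4 := h1 y hy
  have h5 : f s ≤ f y := h3
  linarith

lemma body_eq {P Q : Set E3} (hP : Convex ℝ P) (hQ : Convex ℝ Q) (cP : IsClosed P) (cQ : IsClosed Q) {v : E3}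
    (h : ∀ u : E3 →ₗ[ℝ] ℝ, ∃ y ∈ P, ∃ y' ∈ Q, (∀ z ∈ P, u z ≤ u y) ∧ (∀ z ∈ Q, u z ≤ u y') ∧ u y' = u y + u v) :
    Q = (fun x => x + v) '' P := by
  ext s
  constructor
  · intro hs
    refine ⟨s - v, hb hP cP fun u => ?_, sub_add_cancel s v⟩
    obtain ⟨y, hy, y', hy', h1, h2, e⟩ := h u
    refine ⟨y, hy, ?_⟩
    rw [map_sub]; linarith [h2 s hs]
  · rintro ⟨s, hs, rfl⟩
    refine hb hQ cQ fun u => ?_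
    obtain ⟨y, hy, y', hy', h1, h2, e⟩ := h u
    refine ⟨y', hy', ?_⟩
    simp only [map_add]; linarith [h1 s hs]

lemma hull_le {S : Finset E3} {u : E3 →ₗ[ℝ] ℝ} {y : E3} (hy : y ∈ face u S) : ∀ z ∈ convexHull ℝ (S : Set E3), u z ≤ u y := by
  intro z hz
  exact convexHull_min (t := {z | u z ≤ u y}) (fun s hs => (mem_face.1 hy).2 s hs) (convex_halfSpace_le u.isLinear _) hz

lemma hull_mem {S : Finset E3} {u : E3 →ₗ[ℝ] ℝ} {y : E3} (hy : y ∈ face u S) : y ∈ convexHull ℝ (S : Set E3) :=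
  subset_convexHull ℝ _ (mem_face.1 hy).1

lemma hull_closed (S : Finset E3) : IsClosed (convexHull ℝ (S : Set E3)) :=
  (Set.Finite.isCompact_convexHull (𝕜 := ℝ) S.finite_toSet).isClosed

lemma exists_nice {P : Set E3} (h : ∃ S : Set E3, S.Finite ∧ P = convexHull ℝ S) (hi : (interior P).Nonempty) :
    ∃ S : Finset E3, P = convexHull ℝ (S : Set E3) ∧ Nice S := by
  have hex : ∃ k, ∃ S : Finset E3, S.card = k ∧ P = convexHull ℝ (S : Set E3) := by
    obtain ⟨S, hS, hP⟩ := h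
    exact ⟨_, hS.toFinset, rfl, by rw [hS.coe_toFinset]; exact hP⟩
  obtain ⟨S, hk, hP⟩ := Nat.find_spec hex
  refine ⟨S, hP, ?_, ?_⟩
  · intro s hs hmem
    have hlt : (S.erase s).card < Nat.find hex := by rw [← hk]; exact Finset.card_erase_lt_of_mem hs
    refine Nat.find_min hex hlt ⟨S.erase s, rfl, ?_⟩
    rw [hP]
    apply subset_antisymm
    · apply convexHull_min _ (convex_convexHull ℝ _)
      intro x hx
      by_cases hxs : x = s
      · rw [hxs]; convert hmem
      · exact subset_convexHull ℝ _ (by simpa [hxs] using hx)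
    · exact convexHull_mono (by simp)
  · intro m hm
    obtain ⟨x, hx⟩ := hi
    have hc : ∀ y ∈ P, m y = m x := by
      have : ∀ s ∈ S, ∀ y ∈ P, m y = m s := by
        intro s hs y hy
        rw [hP] at hy
        exact convexHull_min (t := {z | m z = m s}) (fun s' hs' => hm s' hs' s hs) (convex_hyperplane m.isLinear _) hy
      intro y hy
      have hne : (S : Set E3).Nonempty := by
        rw [← convexHull_nonempty_iff (𝕜 := ℝ), ← hP]; exact ⟨y, hy⟩
      obtain ⟨s, hs⟩ := hne
      rw [this s hs y hy, this s hs x (interior_subset hx)]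
    ext d
    have h1 : Filter.Tendsto (fun t : ℝ => x + t • d) (nhds 0) (nhds x) := by
      have : Continuous fun t : ℝ => x + t • d := by fun_prop
      simpa using this.tendsto 0
    have h2 := h1.eventually (mem_interior_iff_mem_nhds.1 hx)
    obtain ⟨ε, hε, h3⟩ := Metric.eventually_nhds_iff.1 h2
    have h4 := hc _ (h3 (y := ε / 2) (by rw [Real.dist_eq, sub_zero, abs_of_pos (by linarith)]; linarith))
    rw [map_add, map_smul, smul_eq_mul, add_eq_left] at h4
    simpa [hε.ne'] using h4

lemma face_link {S Q : Finset E3} (hS : Nice S) (hSQ : S ⊆ Q) {p : AddMonoidAlgebra RR E3} (h : Rep S Q lin CT p)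
    (u : E3 →ₗ[ℝ] ℝ) : ∃ v ∈ supp p, v ∈ face u S := by
  have main : ∀ u : E3 →ₗ[ℝ] ℝ, u ≠ 0 → ∃ v ∈ supp p, v ∈ face u S := by
    intro u hu
    obtain ⟨w, x, F⟩ : ∃ w x, Frame u w x := by
      obtain ⟨e1, h1⟩ : ∃ e1, u e1 ≠ 0 := by
        by_contra hc; push Not at hc; exact hu (LinearMap.ext hc)
      obtain ⟨e, he, h2⟩ : ∃ e, u e = 0 ∧ e ≠ 0 := by
        by_contra hc
        push Not at hc
        have := LinearMap.finrank_le_finrank_of_injective (f := u) ((injective_iff_map_eq_zero u).2 hc)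
        rw [h3E, Module.finrank_self] at this
        omega
      obtain ⟨f, hf⟩ : ∃ f : E3 →ₗ[ℝ] ℝ, f e ≠ 0 := by
        by_contra hc
        push Not at hc
        exact h2 ((Module.forall_dual_apply_eq_zero_iff ℝ e).1 hc)
      obtain ⟨w, hw, -⟩ := exists_frame h3E (u := u) (m := f - (f e1 / u e1) • u) (e := e) (e1 := e1) he (by simpa [he] using hf) h1
        (by simp [h1])
      exact ⟨w, _, hw⟩
    have hne : S.Nonempty := by
      by_contra h0
      rw [Finset.not_nonempty_iff_eq_empty] at h0
      exact hu (hS.pl u (by rw [h0]; intro a ha; simp at ha))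
    obtain ⟨c, hc⟩ := exists_cor u w x hne
    have h1 := (cor_link F hS hSQ h hc).1
    exact ⟨_, h1.mem true true true, face_subset (face_subset (hc true true true))⟩
  by_cases hu : u = 0
  · obtain ⟨v, hv, -⟩ := main (pz 1) fun h0 => by
      have := congrArg (fun f => f (EuclideanSpace.single 0 1)) h0
      simp [pz] at this
    refine ⟨v, hv, mem_face.2 ⟨supp_Rep h hv, fun s _ => by simp [hu]⟩⟩
  · exact main u hu

theorem main {P Q : Set E3} (hP : ∃ S : Set E3, S.Finite ∧ P = convexHull ℝ S) (hPi : (interior P).Nonempty)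
    (hQ : ∃ S : Set E3, S.Finite ∧ Q = convexHull ℝ S) (hQi : (interior Q).Nonempty)
    (hcov : ∀ t, volume (P ∩ ((fun x => x + t) '' P)) = volume (Q ∩ ((fun x => x + t) '' Q))) :
    (∃ v, Q = (fun x => x + v) '' P) ∨ (∃ v, Q = (fun x => x + v) '' (-P)) := by
  obtain ⟨S, rfl, hS⟩ := exists_nice hP hPi
  obtain ⟨S', rfl, hS'⟩ := exists_nice hQ hQi
  have hSQ : S ⊆ S ∪ S' := Finset.subset_union_left
  have hSQ' : S' ⊆ S ∪ S' := Finset.subset_union_right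
  obtain ⟨p, rp, ep⟩ := exists_p hSQ
  obtain ⟨q, rq, eq⟩ := exists_p hSQ'
  have hp0 : p ≠ 0 := by
    obtain ⟨v, hv, -⟩ := face_link hS hSQ rp 0
    rintro rfl
    simp [supp] at hv
  obtain ⟨A, B, κ, r, hr, rfl, rfl⟩ := factor hp0 (pq_eq ep eq hcov)
  have hA : A ≠ 0 := left_ne_zero_of_mul hp0
  have hB : B ≠ 0 := right_ne_zero_of_mul hp0
  have hr0 : r ≠ 0 := (IsUnit.of_mul_eq_one _ hr).ne_zero
  have hP1 : ∀ u : E3 →ₗ[ℝ] ℝ, ∀ a ∈ face u (supp A), ∀ b ∈ face u (supp B), ∃ y ∈ face u S, u y = u a + u b := by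
    intro u a ha b hb
    obtain ⟨y, hy, hy1⟩ := face_link hS hSQ rp u
    refine ⟨y, hy1, face_mul u hA hB ha hb ?_⟩
    exact mem_face.2 ⟨hy, fun z hz => (mem_face.1 hy1).2 z (supp_Rep rp hz)⟩
  have hQ1 : ∀ u : E3 →ₗ[ℝ] ℝ, ∀ a ∈ face u (supp A), ∀ b ∈ face (-u) (supp B), ∃ y ∈ face u S', u y = u κ + (u a - u b) := by
    intro u a ha b hb
    obtain ⟨y, hy, hy1⟩ := face_link hS' hSQ' rq u
    have hs0 : (AddMonoidAlgebra.single κ r : AddMonoidAlgebra RR E3) ≠ 0 := fun h0 => hr0 (by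
      simpa using congrArg (fun f => f.coeff κ) h0)
    have hAB := mul_ne_zero hA (st_ne_zero hB)
    obtain ⟨y1, hy2⟩ := face_nonempty (φ := u) (supp_nonempty hAB)
    have hk : κ ∈ face u (supp (AddMonoidAlgebra.single κ r : AddMonoidAlgebra RR E3)) := by
      have : supp (AddMonoidAlgebra.single κ r : AddMonoidAlgebra RR E3) = {κ} := by
        rw [supp, AddMonoidAlgebra.coeff_single, Finsupp.support_single_ne_zero _ hr0]
      rw [this, mem_face]; simp
    have hb' : -b ∈ face u (supp (st B)) := by
      rw [mem_face_st (s := supp B) fun v => mem_supp_st, neg_neg]; exact hb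
    have e1 := face_mul u hs0 hAB hk hy2 (mem_face.2 ⟨hy, fun z hz => (mem_face.1 hy1).2 z (supp_Rep rq hz)⟩)
    have e2 := face_mul u hA (st_ne_zero hB) ha hb' hy2
    refine ⟨y, hy1, ?_⟩
    rw [e1, e2, map_neg, sub_eq_add_neg]
  have fn : ∀ {f : AddMonoidAlgebra RR E3}, f ≠ 0 → ∀ u, (face u (supp f)).Nonempty := fun hf u => face_nonempty (supp_nonempty hf)
  rcases sym_or hS hS' hSQ hSQ' hr hA hB rp rq (face_link hS hSQ rp) with ⟨c, hc⟩ | ⟨c, hc⟩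
  · right
    refine ⟨κ + c, body_eq (convex_convexHull ℝ _).neg (convex_convexHull ℝ _) (hull_closed S).neg (hull_closed S') fun u => ?_⟩
    obtain ⟨a, ha⟩ := fn hA u
    obtain ⟨a', ha'⟩ := fn hA (-u)
    obtain ⟨b, hb⟩ := fn hB (-u)
    obtain ⟨y, hy, e1⟩ := hP1 (-u) a' ha' b hb
    obtain ⟨y', hy', e2⟩ := hQ1 u a ha b hb
    have e3 := hc u a ha a' ha'
    refine ⟨-y, by simpa using hull_mem hy, y', hull_mem hy', fun z hz => ?_, hull_le hy', ?_⟩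
    · have := hull_le hy (-z) hz
      simpa using this
    · simp only [LinearMap.neg_apply] at e1
      rw [map_neg, map_add, e2]; linarith
  · left
    refine ⟨κ - c, body_eq (convex_convexHull ℝ _) (convex_convexHull ℝ _) (hull_closed S) (hull_closed S') fun u => ?_⟩
    obtain ⟨a, ha⟩ := fn hA u
    obtain ⟨b, hb⟩ := fn hB u
    obtain ⟨b', hb'⟩ := fn hB (-u)
    obtain ⟨y, hy, e1⟩ := hP1 u a ha b hb
    obtain ⟨y', hy', e2⟩ := hQ1 u a ha b' hb'
    have e3 := hc u b hb b' hb'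
    refine ⟨y, hull_mem hy, y', hull_mem hy', hull_le hy, hull_le hy', ?_⟩
    rw [map_sub, e2, e1]; linarith

end FIN

end Cov

theorem covariogram_determines_3d_polytopes
    (P Q : Set (EuclideanSpace ℝ (Fin 3)))
    (hPpoly : ∃ S : Set (EuclideanSpace ℝ (Fin 3)), S.Finite ∧ P = convexHull ℝ S)
    (hPint : (interior P).Nonempty)
    (hQpoly : ∃ S : Set (EuclideanSpace ℝ (Fin 3)), S.Finite ∧ Q = convexHull ℝ S)
    (hQint : (interior Q).Nonempty)
    (hcov : ∀ t : EuclideanSpace ℝ (Fin 3),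
      volume (P ∩ ((fun x => x + t) '' P)) = volume (Q ∩ ((fun x => x + t) '' Q))) :
    (∃ v : EuclideanSpace ℝ (Fin 3), Q = (fun x => x + v) '' P) ∨
      (∃ v : EuclideanSpace ℝ (Fin 3), Q = (fun x => x + v) '' (-P)) := by
  exact Cov.main hPpoly hPint hQpoly hQint hcov
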